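/- arXiv:math/9312205 — 2 statements merged into one kernel-verified Lean document; each statement's English description precedes it below -/
import Mathlib

section
/- Let n ≥ 3, let p > 0 be not an even integer, let E₁, E₂ be bounded domains in ℝⁿ with int(cl E₁) = E₁, let A, B be real symmetric n×n matrices with nonzero determinants having equal signatures 2ℓ−n, and let a, b ∈ ℝⁿ. If exactly one of the vectors a, b is zero and the other is nonzero, then the space L^p_{D_A}(E₁) is not linearly isometric to any subspace of L^p_{D_B}(E₂). -/
open MeasureTheory Matrix

noncomputable section

/-- The sign pattern: `1` for the first `ℓ` coordinates, `-1` for the rest. -/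
def epsl (n ℓ : ℕ) (i : Fin n) : ℝ := if (i : ℕ) < ℓ then 1 else -1

/-- The diagonal matrix `I_ℓ` with the first `ℓ` diagonal entries `1`, the rest `-1`. -/
def Imat (n ℓ : ℕ) : Matrix (Fin n) (Fin n) ℝ := Matrix.diagonal (epsl n ℓ)

/-- The quadratic form `‖z‖_ℓ² = ∑_{i≤ℓ} z_i² - ∑_{i>ℓ} z_i²`. -/
def lnormSq (n ℓ : ℕ) (z : Fin n → ℝ) : ℝ := ∑ i, epsl n ℓ i * z i ^ 2

/-- First partial derivative `∂f/∂x_i`. -/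
def pd {n : ℕ} (f : (Fin n → ℝ) → ℝ) (i : Fin n) (x : Fin n → ℝ) : ℝ :=
  fderiv ℝ f x (Pi.single i 1)

/-- Second partial derivative `∂²f/∂x_i∂x_j`. -/
def pd2 {n : ℕ} (f : (Fin n → ℝ) → ℝ) (i j : Fin n) (x : Fin n → ℝ) : ℝ :=
  pd (pd f j) i x

/-- The differential operator `D_A f = ∑ a_ij ∂²f/∂x_i∂x_j + ∑ a_i ∂f/∂x_i`. -/
def DOp {n : ℕ} (A : Matrix (Fin n) (Fin n) ℝ) (a : Fin n → ℝ)
    (f : (Fin n → ℝ) → ℝ) (x : Fin n → ℝ) : ℝ :=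
  (∑ i, ∑ j, A i j * pd2 f i j x) + ∑ i, a i * pd f i x

/-- `L^p_{D_A}(E)`: real `C²` solutions of `D_A f = 0` on `E` with finite `L^p(E)` norm. -/
def SolSpace {n : ℕ} (A : Matrix (Fin n) (Fin n) ℝ) (a : Fin n → ℝ)
    (E : Set (Fin n → ℝ)) (p : ℝ) : Set ((Fin n → ℝ) → ℝ) :=
  {f | ContDiffOn ℝ 2 f E ∧ (∀ x ∈ E, DOp A a f x = 0) ∧
    IntegrableOn (fun x => |f x| ^ p) E volume}

/-- A bounded domain: a nonempty bounded connected open set. -/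
def IsBoundedDomain {n : ℕ} (E : Set (Fin n → ℝ)) : Prop :=
  IsOpen E ∧ IsConnected E ∧ Bornology.IsBounded E

/-- `S₁` embeds isometrically (as a linear subspace, with the `L^p` norms over `E₁`, `E₂`)
into `S₂`: there is a linear norm-preserving map from `S₁` into `S₂`. -/
def IsometricallyEmbeds {n : ℕ} (p : ℝ) (E₁ E₂ : Set (Fin n → ℝ))
    (S₁ S₂ : Set ((Fin n → ℝ) → ℝ)) : Prop :=
  ∃ T : ((Fin n → ℝ) → ℝ) → ((Fin n → ℝ) → ℝ),
    (∀ f ∈ S₁, T f ∈ S₂) ∧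
    (∀ f ∈ S₁, ∀ g ∈ S₁, T (f + g) = T f + T g) ∧
    (∀ (c : ℝ), ∀ f ∈ S₁, T (c • f) = c • T f) ∧
    (∀ f ∈ S₁, ∫ x in E₂, |T f x| ^ p = ∫ x in E₁, |f x| ^ p)

/-- The Jacobi matrix `J(x)` of a mapping `τ : ℝⁿ → ℝⁿ` at `x`. -/
def jacobiMatrix {n : ℕ} (τ : (Fin n → ℝ) → (Fin n → ℝ)) (x : Fin n → ℝ) :
    Matrix (Fin n) (Fin n) ℝ :=
  Matrix.of fun i j => fderiv ℝ τ x (Pi.single j 1) i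

/-- An `ℓ`-similarity: the composition of a homothety and an affine map preserving
the metric `‖·‖_ℓ²`, i.e. `z ↦ t • L z + v` with `Lᵀ I_ℓ L = I_ℓ`. -/
def IsLSimilarity (n ℓ : ℕ) (τ : (Fin n → ℝ) → (Fin n → ℝ)) : Prop :=
  ∃ (t : ℝ) (L : Matrix (Fin n) (Fin n) ℝ) (v : Fin n → ℝ),
    Lᵀ * Imat n ℓ * L = Imat n ℓ ∧ τ = fun z => t • L.mulVec z + v

/-- The `ℓ`-inversion with center `z₀`: `z ↦ (z-z₀)/‖z-z₀‖_ℓ² + z₀`. -/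
def lInversion (n ℓ : ℕ) (z₀ : Fin n → ℝ) (z : Fin n → ℝ) : Fin n → ℝ :=
  (lnormSq n ℓ (z - z₀))⁻¹ • (z - z₀) + z₀

/-- The domains `E₁` and `E₂` coincide up to the `C¹` mapping `τ : E₂ → cl E₁`,
i.e. `m(E₁ \ τ(E₂)) = 0`. -/
def CoincideUpTo {n : ℕ} (E₁ E₂ : Set (Fin n → ℝ))
    (τ : (Fin n → ℝ) → (Fin n → ℝ)) : Prop :=
  ContDiffOn ℝ 1 τ E₂ ∧ τ '' E₂ ⊆ closure E₁ ∧ volume (E₁ \ τ '' E₂) = 0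

/-- Signed Taylor remainder of the cosine. -/
def cosRem (k : ℕ) (x : ℝ) : ℝ :=
  (-1) ^ (k + 1) * (Real.cos x - ∑ j ∈ Finset.range (k + 1), (-1) ^ j * x ^ (2 * j) / (2 * j).factorial)

/-- Signed Taylor remainder of the sine. -/
def sinRem (k : ℕ) (x : ℝ) : ℝ :=
  (-1) ^ k * (Real.sin x - ∑ j ∈ Finset.range k, (-1) ^ j * x ^ (2 * j + 1) / (2 * j + 1).factorial)

lemma hd_congr {f g : ℝ → ℝ} {f' g' x : ℝ} (h : HasDerivAt f f' x) (hf : ∀ y, g y = f y)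
    (hf' : g' = f') : HasDerivAt g g' x := by
  have : g = f := funext hf
  rw [this, hf']; exact h

lemma hasDerivAt_powfac (m : ℕ) (x : ℝ) :
    HasDerivAt (fun x : ℝ => x ^ (m + 1) / (m + 1).factorial) (x ^ m / m.factorial) x := by
  have := (hasDerivAt_pow (m + 1) x).div_const ((m + 1).factorial : ℝ)
  refine hd_congr this (fun y => rfl) ?_
  rw [Nat.factorial_succ]
  push_cast
  have : (m.factorial : ℝ) ≠ 0 := by positivity
  field_simp

lemma hasDerivAt_sinRem (k : ℕ) (x : ℝ) : HasDerivAt (sinRem (k + 1)) (cosRem k x) x := by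
  unfold sinRem cosRem
  refine HasDerivAt.const_mul _ ((Real.hasDerivAt_sin x).sub ?_)
  refine HasDerivAt.fun_sum fun j _ => ?_
  have := (hasDerivAt_powfac (2 * j) x).const_mul ((-1 : ℝ) ^ j)
  refine hd_congr this (fun y => ?_) ?_
  · ring
  · ring

lemma hasDerivAt_cosRem (k : ℕ) (x : ℝ) : HasDerivAt (cosRem k) (sinRem k x) x := by
  unfold sinRem cosRem
  simp_rw [Finset.sum_range_succ' _ k]
  have h1 : HasDerivAt (fun x : ℝ => ∑ j ∈ Finset.range k,
      (-1 : ℝ) ^ (j + 1) * x ^ (2 * (j + 1)) / (2 * (j + 1)).factorial)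
      (∑ j ∈ Finset.range k, (-1 : ℝ) ^ (j + 1) * x ^ (2 * j + 1) / (2 * j + 1).factorial) x := by
    refine HasDerivAt.fun_sum fun j _ => ?_
    have := (hasDerivAt_powfac (2 * j + 1) x).const_mul ((-1 : ℝ) ^ (j + 1))
    refine hd_congr this (fun y => ?_) ?_
    · rw [show 2 * (j + 1) = 2 * j + 1 + 1 by ring]; ring
    · ring
  have := (((Real.hasDerivAt_cos x).sub (h1.add_const
    ((-1 : ℝ) ^ 0 * x ^ (2 * 0) / (2 * 0).factorial)))).const_mul ((-1 : ℝ) ^ (k + 1))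
  refine hd_congr this (fun y => ?_) ?_
  · simp
  · rw [pow_succ, mul_assoc]
    congr 1
    rw [mul_sub, Finset.mul_sum]
    have : ∀ j : ℕ, -1 * ((-1 : ℝ) ^ (j + 1) * x ^ (2 * j + 1) / (2 * j + 1).factorial)
      = ((-1 : ℝ) ^ j * x ^ (2 * j + 1) / (2 * j + 1).factorial) := by intro j; ring
    simp_rw [this]
    ring

lemma nonneg_of_deriv_nonneg {f f' : ℝ → ℝ} (h : ∀ x, HasDerivAt f (f' x) x) (h0 : 0 ≤ f 0)
    (h' : ∀ x, 0 ≤ x → 0 ≤ f' x) (x : ℝ) (hx : 0 ≤ x) : 0 ≤ f x := by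
  have hm : MonotoneOn f (Set.Ici 0) := by
    refine monotoneOn_of_deriv_nonneg (convex_Ici 0)
      (fun y _ => (h y).continuousAt.continuousWithinAt)
      (fun y _ => (h y).differentiableAt.differentiableWithinAt) ?_
    intro y hy
    rw [(h y).deriv]
    rw [interior_Ici] at hy
    exact h' y (le_of_lt hy)
  exact h0.trans (hm (Set.self_mem_Ici) hx hx)

lemma sinRem_zero (k : ℕ) : sinRem k 0 = 0 := by simp [sinRem]

lemma cosRem_zero (k : ℕ) : cosRem k 0 = 0 := by
  simp [cosRem, Finset.sum_range_succ']

lemma cosRem_zero_left (x : ℝ) : cosRem 0 x = 1 - Real.cos x := by simp [cosRem]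

lemma cosRem_bounds (k : ℕ) : ∀ x : ℝ, 0 ≤ x → 0 ≤ cosRem k x ∧
    cosRem k x ≤ x ^ (2 * k + 2) / (2 * k + 2).factorial ∧
    cosRem k x ≤ 2 * (x ^ (2 * k) / (2 * k).factorial) := by
  induction k with
  | zero =>
    intro x hx
    rw [cosRem_zero_left]
    refine ⟨by linarith [Real.cos_le_one x], ?_, ?_⟩
    · have := Real.one_sub_sq_div_two_le_cos (x := x)
      norm_num [Nat.factorial]; linarith
    · norm_num; linarith [Real.neg_one_le_cos x]
  | succ k ih =>
    have d1 := hasDerivAt_sinRem k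
    have d2 := hasDerivAt_cosRem (k + 1)
    intro x hx
    refine ⟨?_, ?_, ?_⟩
    · exact nonneg_of_deriv_nonneg d2 (cosRem_zero _).ge
        (nonneg_of_deriv_nonneg d1 (sinRem_zero _).ge (fun x hx => (ih x hx).1)) x hx
    · have e1 := fun x => (hasDerivAt_powfac (2 * k + 2) x).sub (d1 x)
      have e2 := fun x => (hasDerivAt_powfac (2 * k + 3) x).sub (d2 x)
      have := nonneg_of_deriv_nonneg e2 (by simp [cosRem_zero])
        (nonneg_of_deriv_nonneg e1 (by simp [sinRem_zero])
          (fun x hx => sub_nonneg.2 (ih x hx).2.1)) x hx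
      exact sub_nonneg.1 this
    · have e1 := fun x => ((hasDerivAt_powfac (2 * k) x).const_mul 2).sub (d1 x)
      have e2 := fun x => ((hasDerivAt_powfac (2 * k + 1) x).const_mul 2).sub (d2 x)
      have := nonneg_of_deriv_nonneg e2 (by simp [cosRem_zero])
        (nonneg_of_deriv_nonneg e1 (by simp [sinRem_zero])
          (fun x hx => sub_nonneg.2 (ih x hx).2.2)) x hx
      exact sub_nonneg.1 this

lemma cosRem_neg (k : ℕ) (x : ℝ) : cosRem k (-x) = cosRem k x := by
  simp [cosRem, pow_mul]

lemma cosRem_abs (k : ℕ) (x : ℝ) : cosRem k |x| = cosRem k x := by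
  rcases abs_choice x with h | h <;> rw [h]
  exact cosRem_neg k x

lemma continuous_cosRem (k : ℕ) : Continuous (cosRem k) := by
  unfold cosRem; fun_prop

/-- Integrability of the kernel. -/
lemma integrableOn_cosRem {p : ℝ} {k : ℕ} (h1 : 2 * (k : ℝ) < p) (h2 : p < 2 * k + 2) :
    IntegrableOn (fun u : ℝ => cosRem k u * u ^ (-1 - p)) (Set.Ioi 0) := by
  have hmeas : AEStronglyMeasurable (fun u : ℝ => cosRem k u * u ^ (-1 - p))
      (volume.restrict (Set.Ioi 0)) := by
    refine ContinuousOn.aestronglyMeasurable ?_ measurableSet_Ioi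
    refine (continuous_cosRem k).continuousOn.mul ?_
    intro u hu
    exact (Real.continuousAt_rpow_const u _ (Or.inl (ne_of_gt hu))).continuousWithinAt
  rw [← Set.Ioc_union_Ioi_eq_Ioi (zero_le_one)]
  refine IntegrableOn.union ?_ ?_
  · have hi : IntegrableOn (fun u : ℝ => u ^ (2 * (k : ℝ) + 1 - p)) (Set.Ioc 0 1) := by
      rw [← intervalIntegrable_iff_integrableOn_Ioc_of_le zero_le_one]
      exact intervalIntegral.intervalIntegrable_rpow' (by linarith)
    refine Integrable.mono hi (hmeas.mono_measure (Measure.restrict_mono Set.Ioc_subset_Ioi_self le_rfl)) ?_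
    refine (ae_restrict_iff' measurableSet_Ioc).2 (Filter.Eventually.of_forall fun u hu => ?_)
    have hu0 : 0 < u := hu.1
    obtain ⟨b1, b2, -⟩ := cosRem_bounds k u hu0.le
    rw [Real.norm_eq_abs, Real.norm_eq_abs, abs_of_nonneg (by positivity), abs_of_nonneg (by positivity)]
    have : u ^ (2 * (k : ℝ) + 1 - p) = u ^ (2 * k + 2) * u ^ (-1 - p) := by
      rw [← Real.rpow_natCast, ← Real.rpow_add hu0]; congr 1; push_cast; ring
    rw [this]
    refine mul_le_mul_of_nonneg_right (b2.trans ?_) (by positivity)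
    exact div_le_self (by positivity) (by exact_mod_cast Nat.succ_le_of_lt (Nat.factorial_pos _))
  · have hi : IntegrableOn (fun u : ℝ => 2 * u ^ (2 * (k : ℝ) - 1 - p)) (Set.Ioi 1) :=
      (integrableOn_Ioi_rpow_of_lt (by linarith) one_pos).const_mul 2
    refine Integrable.mono hi (hmeas.mono_measure (Measure.restrict_mono (Set.Ioi_subset_Ioi zero_le_one) le_rfl)) ?_
    refine (ae_restrict_iff' measurableSet_Ioi).2 (Filter.Eventually.of_forall fun u hu => ?_)
    have hu0 : 0 < u := lt_trans one_pos hu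
    obtain ⟨b1, -, b2⟩ := cosRem_bounds k u hu0.le
    rw [Real.norm_eq_abs, Real.norm_eq_abs, abs_of_nonneg (by positivity), abs_of_nonneg (by positivity)]
    have : u ^ (2 * (k : ℝ) - 1 - p) = u ^ (2 * k) * u ^ (-1 - p) := by
      rw [← Real.rpow_natCast, ← Real.rpow_add hu0]; congr 1; push_cast; ring
    rw [this, ← mul_assoc]
    refine mul_le_mul_of_nonneg_right (b2.trans ?_) (by positivity)
    refine mul_le_mul_of_nonneg_left ?_ (by norm_num)
    exact div_le_self (by positivity) (by exact_mod_cast Nat.succ_le_of_lt (Nat.factorial_pos _))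

lemma cosRem_integral_scale {p : ℝ} (hp : 0 < p) {k : ℕ} (h1 : 2 * (k : ℝ) < p) (h2 : p < 2 * k + 2)
    (y : ℝ) :
    IntegrableOn (fun u : ℝ => cosRem k (u * y) * u ^ (-1 - p)) (Set.Ioi 0) ∧
    ∫ u in Set.Ioi (0 : ℝ), cosRem k (u * y) * u ^ (-1 - p) =
      |y| ^ p * ∫ u in Set.Ioi (0 : ℝ), cosRem k u * u ^ (-1 - p) := by
  rcases eq_or_ne y 0 with rfl | hy
  · simp [cosRem_zero, Real.zero_rpow hp.ne']
  have hy' : 0 < |y| := abs_pos.2 hy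
  have key : ∀ u ∈ Set.Ioi (0 : ℝ), cosRem k (u * y) * u ^ (-1 - p) =
      |y| ^ (1 + p) * (cosRem k (|y| * u) * (|y| * u) ^ (-1 - p)) := by
    intro u hu
    have hu : 0 < u := hu
    rw [Real.mul_rpow hy'.le hu.le, ← cosRem_abs k (u * y), abs_mul, abs_of_pos hu, mul_comm u |y|]
    have : |y| ^ (1 + p) * |y| ^ (-1 - p) = 1 := by
      rw [← Real.rpow_add hy']; simp
    linear_combination (-cosRem k (|y| * u) * u ^ (-1 - p)) * this
  constructor
  · rw [integrableOn_congr_fun key measurableSet_Ioi]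
    refine Integrable.const_mul ?_ _
    have := (integrableOn_Ioi_comp_mul_left_iff
      (fun u : ℝ => cosRem k u * u ^ (-1 - p)) 0 hy').2
    simp only [mul_zero] at this
    exact this (integrableOn_cosRem h1 h2)
  · rw [setIntegral_congr_fun measurableSet_Ioi key, integral_const_mul,
      integral_comp_mul_left_Ioi (fun u : ℝ => cosRem k u * u ^ (-1 - p)) 0 hy']
    rw [mul_zero, smul_eq_mul, ← mul_assoc, Real.rpow_add hy', Real.rpow_one]
    field_simp

lemma cosRem_const_pos {p : ℝ} {k : ℕ} (h1 : 2 * (k : ℝ) < p) (h2 : p < 2 * k + 2)  :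
    ∫ u in Set.Ioi (0 : ℝ), cosRem k u * u ^ (-1 - p) ≠ 0 := by
  intro h
  have hnn : 0 ≤ᵐ[volume.restrict (Set.Ioi (0 : ℝ))] fun u : ℝ => cosRem k u * u ^ (-1 - p) := by
    refine (ae_restrict_iff' measurableSet_Ioi).2 (Filter.Eventually.of_forall fun u hu => ?_)
    have hu0 : 0 < u := hu
    have := (cosRem_bounds k u hu0.le).1
    simp only [Pi.zero_apply]
    positivity
  have h0 := (integral_eq_zero_iff_of_nonneg_ae hnn (integrableOn_cosRem h1 h2)).1 h
  have hz : Set.EqOn (fun u : ℝ => cosRem k u * u ^ (-1 - p)) 0 (Set.Ioi 0) := by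
    refine Measure.eqOn_open_of_ae_eq h0 isOpen_Ioi ?_ continuousOn_const
    refine (continuous_cosRem k).continuousOn.mul ?_
    intro u hu
    exact (Real.continuousAt_rpow_const u _ (Or.inl (ne_of_gt hu))).continuousWithinAt
  -- all remainders vanish on the positive axis, contradiction by descending
  have hz' : ∀ u ∈ Set.Ioi (0 : ℝ), cosRem k u = 0 := by
    intro u hu
    have hu0 : 0 < u := hu
    have := hz hu
    simp only [Pi.zero_apply] at this
    exact (mul_eq_zero.1 this).resolve_right (by positivity)
  have desc : ∀ k : ℕ, (∀ u ∈ Set.Ioi (0 : ℝ), cosRem k u = 0) → False := by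
    intro k
    induction k with
    | zero =>
      intro h
      have := h Real.pi Real.pi_pos
      rw [cosRem_zero_left, Real.cos_pi] at this
      norm_num at this
    | succ k ih =>
      intro h
      apply ih
      have hs : ∀ u ∈ Set.Ioi (0 : ℝ), sinRem (k + 1) u = 0 := by
        intro u hu
        have e : cosRem (k + 1) =ᶠ[nhds u] fun _ => 0 := by
          filter_upwards [isOpen_Ioi.mem_nhds hu] with v hv using h v hv
        rw [← (hasDerivAt_cosRem (k + 1) u).deriv, e.deriv_eq]; simp
      intro u hu
      have e : sinRem (k + 1) =ᶠ[nhds u] fun _ => 0 := by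
        filter_upwards [isOpen_Ioi.mem_nhds hu] with v hv using hs v hv
      rw [← (hasDerivAt_sinRem k u).deriv, e.deriv_eq]; simp
  exact desc k hz'

/-- Symmetric second difference with step one. -/
def sd (f : ℝ → ℝ) (s : ℝ) : ℝ := f (s + 1) + f (s - 1) - 2 * f s

lemma sd_iter_integral {Ω : Type*} [MeasurableSpace Ω] (m : Measure Ω) (K : ℕ) :
    ∀ (f : ℝ → Ω → ℝ), (∀ s, Integrable (f s) m) → ∀ s,
    Integrable (fun x => sd^[K] (fun s => f s x) s) m ∧
    sd^[K] (fun s => ∫ x, f s x ∂m) s = ∫ x, sd^[K] (fun s => f s x) s ∂m := by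
  induction K with
  | zero => intro f hf s; exact ⟨hf s, rfl⟩
  | succ K ih =>
    intro f hf s
    have hi : ∀ s, Integrable (fun x => sd (fun s => f s x) s) m := fun s =>
      ((hf (s + 1)).add (hf (s - 1))).sub ((hf s).const_mul 2)
    have e : sd (fun s => ∫ x, f s x ∂m) = fun s => ∫ x, sd (fun s => f s x) s ∂m := by
      ext s
      have e1 := integral_sub ((hf (s + 1)).add (hf (s - 1))) ((hf s).const_mul 2)
      have e2 := integral_add (hf (s + 1)) (hf (s - 1))
      simp only [Pi.add_apply] at e1
      simp only [sd]
      rw [e1, e2, integral_const_mul]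
    have := ih (fun s x => sd (fun s => f s x) s) hi s
    simp only [Function.iterate_succ, Function.comp]
    rw [e]
    exact this

lemma sd_iter_add (K : ℕ) : ∀ (f g : ℝ → ℝ) (s : ℝ),
    sd^[K] (fun s => f s + g s) s = sd^[K] f s + sd^[K] g s := by
  induction K with
  | zero => intro f g s; rfl
  | succ K ih =>
    intro f g s
    simp only [Function.iterate_succ, Function.comp]
    rw [← ih]
    refine congrArg (fun g => sd^[K] g s) ?_
    ext t; simp only [sd]; ring

lemma sd_iter_mul (K : ℕ) : ∀ (c : ℝ) (f : ℝ → ℝ) (s : ℝ),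
    sd^[K] (fun s => c * f s) s = c * sd^[K] f s := by
  induction K with
  | zero => intro f g s; rfl
  | succ K ih =>
    intro c f s
    simp only [Function.iterate_succ, Function.comp]
    rw [← ih]
    refine congrArg (fun g => sd^[K] g s) ?_
    ext t; simp only [sd]; ring

lemma sd_iter_fwdDiff (K : ℕ) : ∀ (f : ℝ → ℝ) (s : ℝ),
    sd^[K] f s = (fwdDiff 1)^[2 * K] f (s - K) := by
  induction K with
  | zero => intro f s; simp
  | succ K ih =>
    intro f s
    rw [Function.iterate_succ, Function.comp, ih, show 2 * (K + 1) = 2 * K + 1 + 1 by ring,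
      Function.iterate_succ, Function.comp, Function.iterate_succ, Function.comp,
      fwdDiff_iter_eq_sum_shift, fwdDiff_iter_eq_sum_shift]
    refine Finset.sum_congr rfl fun j _ => ?_
    congr 1
    simp only [sd, fwdDiff]
    push_cast
    simp only [nsmul_eq_mul, mul_one]
    ring_nf

lemma sd_iter_const (K : ℕ) (hK : 0 < K) (c s : ℝ) : sd^[K] (fun _ => c) s = 0 := by
  rw [sd_iter_fwdDiff]
  have := Polynomial.fwdDiff_iter_eq_zero_of_degree_lt (P := Polynomial.C c) (n := 2 * K)
    (by simp; omega)
  have e : (Polynomial.C c).eval = fun _ : ℝ => c := by ext; simp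
  rw [e] at this
  rw [this]; rfl

lemma sd_iter_shift (K : ℕ) : ∀ (f : ℝ → ℝ) (y s : ℝ),
    sd^[K] (fun s => f (s + y)) s = sd^[K] f (s + y) := by
  induction K with
  | zero => intro f y s; rfl
  | succ K ih =>
    intro f y s
    simp only [Function.iterate_succ, Function.comp]
    rw [← ih]
    refine congrArg (fun g => sd^[K] g s) ?_
    ext t; simp only [sd]; ring_nf

lemma sd_iter_cos (K : ℕ) (u s : ℝ) :
    sd^[K] (fun s => Real.cos (u * s)) s = (2 * Real.cos u - 2) ^ K * Real.cos (u * s) := by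
  induction K generalizing s with
  | zero => simp
  | succ K ih =>
    have e : sd (fun s => Real.cos (u * s)) = fun s => (2 * Real.cos u - 2) * Real.cos (u * s) := by
      ext s; simp only [sd]
      rw [mul_add, mul_sub, Real.cos_add, Real.cos_sub]; simp; ring
    rw [Function.iterate_succ, Function.comp, e, sd_iter_mul, ih, pow_succ]; ring

lemma sd_iter_cosRem (k : ℕ) (u s : ℝ) :
    sd^[k + 1] (fun s => cosRem k (u * s)) s = (2 - 2 * Real.cos u) ^ (k + 1) * Real.cos (u * s) := by
  set P : Polynomial ℝ := ∑ j ∈ Finset.range (k + 1),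
    Polynomial.C (-(-1 : ℝ) ^ (k + 1) * (-1) ^ j / (2 * j).factorial) * (Polynomial.C u * Polynomial.X) ^ (2 * j) with hP
  have hdeg : P.natDegree < 2 * (k + 1) := by
    refine lt_of_le_of_lt (Polynomial.natDegree_sum_le_of_forall_le (n := 2 * k) _ _ ?_) (by omega)
    intro j hj
    refine (Polynomial.natDegree_C_mul_le _ _).trans (Polynomial.natDegree_pow_le.trans ?_)
    have : (Polynomial.C u * Polynomial.X : Polynomial ℝ).natDegree ≤ 1 :=
      (Polynomial.natDegree_C_mul_le _ _).trans Polynomial.natDegree_X_le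
    have hj' := Finset.mem_range.1 hj
    calc 2 * j * (Polynomial.C u * Polynomial.X : Polynomial ℝ).natDegree ≤ 2 * j * 1 :=
          Nat.mul_le_mul_left _ this
      _ ≤ 2 * k := by omega
  have e : (fun s => cosRem k (u * s)) =
      fun s => (-1) ^ (k + 1) * Real.cos (u * s) + P.eval s := by
    ext s
    simp only [cosRem, hP, Polynomial.eval_finsetSum, Polynomial.eval_mul, Polynomial.eval_C,
      Polynomial.eval_pow, Polynomial.eval_X]
    rw [mul_sub, sub_eq_add_neg, Finset.mul_sum, ← Finset.sum_neg_distrib]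
    congr 1
    refine Finset.sum_congr rfl fun j _ => ?_
    ring
  rw [e, sd_iter_add, sd_iter_mul, sd_iter_cos, sd_iter_fwdDiff (k + 1) (fun s => P.eval s)]
  have h0 := Polynomial.fwdDiff_iter_eq_zero_of_degree_lt hdeg
  have h0' : (fwdDiff (1 : ℝ))^[2 * (k + 1)] (fun s => P.eval s) = 0 := h0
  rw [h0', Pi.zero_apply, add_zero, ← mul_assoc, ← mul_pow]
  congr 2; ring

/-- The key one-dimensional uniqueness lemma. -/
lemma charFun_one_eq {p : ℝ} (hp : 0 < p) (hpNotEven : ∀ k : ℕ, p ≠ 2 * k)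
    (m₁ m₂ : Measure ℝ) [IsFiniteMeasure m₁] [IsFiniteMeasure m₂] (C : ℝ)
    (h1 : ∀ s : ℝ, Integrable (fun x => |s + x| ^ p) m₁)
    (h2 : ∀ s : ℝ, Integrable (fun x => |s + x| ^ p) m₂)
    (h : ∀ s : ℝ, ∫ x, |s + x| ^ p ∂m₁ = ∫ x, |s + x| ^ p ∂m₂ + C) :
    charFun m₁ 1 = charFun m₂ 1 := by
  set k : ℕ := ⌊p / 2⌋₊ with hk
  have hk1 : 2 * (k : ℝ) < p := by
    have := Nat.floor_le (a := p / 2) (by positivity)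
    exact lt_of_le_of_ne (by rw [hk]; linarith) (hpNotEven k).symm
  have hk2 : p < 2 * k + 2 := by
    have := Nat.lt_floor_add_one (p / 2)
    rw [hk]; linarith
  set c₀ := ∫ u in Set.Ioi (0 : ℝ), cosRem k u * u ^ (-1 - p) with hc₀
  have hc : c₀ ≠ 0 := cosRem_const_pos hk1 hk2
  set κ : ℝ → ℝ := fun u => (2 - 2 * Real.cos u) ^ (k + 1) * u ^ (-1 - p) with hκ
  set J : ℝ → ℝ := sd^[k + 1] (fun s => |s| ^ p) with hJ
  -- the kernel identity
  have hker : ∀ s : ℝ, IntegrableOn (fun u => Real.cos (u * s) * κ u) (Set.Ioi 0) ∧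
      c₀ * J s = ∫ u in Set.Ioi (0 : ℝ), Real.cos (u * s) * κ u := by
    intro s
    have h3 := sd_iter_integral (volume.restrict (Set.Ioi (0 : ℝ))) (k + 1)
      (fun s u => cosRem k (u * s) * u ^ (-1 - p))
      (fun s => (cosRem_integral_scale hp hk1 hk2 s).1) s
    have e : ∀ u : ℝ, sd^[k + 1] (fun s => cosRem k (u * s) * u ^ (-1 - p)) s =
        Real.cos (u * s) * κ u := by
      intro u
      have : (fun s => cosRem k (u * s) * u ^ (-1 - p)) =
        fun s => u ^ (-1 - p) * cosRem k (u * s) := by ext; ring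
      rw [this, sd_iter_mul, sd_iter_cosRem]
      simp only [hκ]; ring
    simp only [e] at h3
    refine ⟨h3.1, ?_⟩
    rw [← h3.2]
    have : (fun s => ∫ u in Set.Ioi (0 : ℝ), cosRem k (u * s) * u ^ (-1 - p)) =
        fun s => c₀ * |s| ^ p := by
      ext s
      rw [(cosRem_integral_scale hp hk1 hk2 s).2]; ring
    rw [this, sd_iter_mul]
  have hκi : IntegrableOn κ (Set.Ioi 0) := by
    have := (hker 0).1
    simpa using this
  have hκc : ContinuousOn κ (Set.Ioi 0) := by
    refine ContinuousOn.mul (by fun_prop) ?_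
    intro u hu
    exact (Real.continuousAt_rpow_const u _ (Or.inl (ne_of_gt hu))).continuousWithinAt
  -- equality of the smoothed integrals
  have hJm : ∀ s, ∫ x, J (s + x) ∂m₁ = ∫ x, J (s + x) ∂m₂ := by
    intro s
    have a1 := (sd_iter_integral m₁ (k + 1) (fun s x => |s + x| ^ p) h1 s).2
    have a2 := (sd_iter_integral m₂ (k + 1) (fun s x => |s + x| ^ p) h2 s).2
    have b : ∀ x : ℝ, sd^[k + 1] (fun s => |s + x| ^ p) s = J (s + x) := by
      intro x
      rw [sd_iter_shift (k + 1) (fun s => |s| ^ p) x s]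
    simp only [b] at a1 a2
    rw [← a1, ← a2]
    have : (fun s => ∫ x, |s + x| ^ p ∂m₁) = fun s => ∫ x, |s + x| ^ p ∂m₂ + (fun _ => C) s := by
      ext s; exact h s
    rw [this, sd_iter_add, sd_iter_const _ (by omega), add_zero]
  -- Fubini
  have hprodint : ∀ (m : Measure ℝ) [IsFiniteMeasure m] (g : ℝ × ℝ → ℝ), Continuous g →
      (∀ z, |g z| ≤ 1) →
      Integrable (fun z : ℝ × ℝ => g z * κ z.2) (m.prod (volume.restrict (Set.Ioi 0))) := by
    intro m _ g hg hb
    have hκ2 : Integrable (fun z : ℝ × ℝ => κ z.2) (m.prod (volume.restrict (Set.Ioi 0))) :=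
      Integrable.comp_snd hκi m
    exact hκ2.bdd_mul hg.aestronglyMeasurable (Filter.Eventually.of_forall fun z => hb z)
  set A : Measure ℝ → ℝ → ℝ := fun m u => ∫ x, Real.cos (u * x) ∂m with hA
  set B : Measure ℝ → ℝ → ℝ := fun m u => ∫ x, Real.sin (u * x) ∂m with hB
  have hci : ∀ (m : Measure ℝ) [IsFiniteMeasure m] (u : ℝ), Integrable (fun x => Real.cos (u * x)) m := by
    intro m _ u
    refine Integrable.of_bound (by fun_prop) 1 (Filter.Eventually.of_forall fun x => ?_)
    exact Real.abs_cos_le_one _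
  have hsi : ∀ (m : Measure ℝ) [IsFiniteMeasure m] (u : ℝ), Integrable (fun x => Real.sin (u * x)) m := by
    intro m _ u
    refine Integrable.of_bound (by fun_prop) 1 (Filter.Eventually.of_forall fun x => ?_)
    exact Real.abs_sin_le_one _
  have hAc : ∀ (m : Measure ℝ) [IsFiniteMeasure m], Continuous (A m) := by
    intro m _
    refine continuous_of_dominated (bound := fun _ => 1) (fun u => by fun_prop) ?_
      (integrable_const _) ?_
    · intro u; exact Filter.Eventually.of_forall fun x => Real.abs_cos_le_one _
    · exact Filter.Eventually.of_forall fun x => by fun_prop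
  have hBc : ∀ (m : Measure ℝ) [IsFiniteMeasure m], Continuous (B m) := by
    intro m _
    refine continuous_of_dominated (bound := fun _ => 1) (fun u => by fun_prop) ?_
      (integrable_const _) ?_
    · intro u; exact Filter.Eventually.of_forall fun x => Real.abs_sin_le_one _
    · exact Filter.Eventually.of_forall fun x => by fun_prop
  have hAb : ∀ (m : Measure ℝ) [IsFiniteMeasure m] (u : ℝ), |A m u| ≤ m.real Set.univ := by
    intro m _ u
    have := norm_integral_le_of_norm_le_const (μ := m) (f := fun x => Real.cos (u * x)) (C := 1)
      (Filter.Eventually.of_forall fun x => Real.abs_cos_le_one _)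
    simpa using this
  have hBb : ∀ (m : Measure ℝ) [IsFiniteMeasure m] (u : ℝ), |B m u| ≤ m.real Set.univ := by
    intro m _ u
    have := norm_integral_le_of_norm_le_const (μ := m) (f := fun x => Real.sin (u * x)) (C := 1)
      (Filter.Eventually.of_forall fun x => Real.abs_sin_le_one _)
    simpa using this
  have hF1 : ∀ (m : Measure ℝ) [IsFiniteMeasure m] (s : ℝ), c₀ * ∫ x, J (s + x) ∂m =
      ∫ u in Set.Ioi (0 : ℝ), (Real.cos (u * s) * A m u - Real.sin (u * s) * B m u) * κ u := by
    intro m _ s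
    rw [← integral_const_mul]
    simp_rw [(hker _).2]
    rw [integral_integral_swap]
    · refine integral_congr_ae (Filter.Eventually.of_forall fun u => ?_)
      simp only
      rw [integral_mul_const]
      congr 1
      simp_rw [mul_add, Real.cos_add]
      rw [integral_sub ((hci m u).const_mul _) ((hsi m u).const_mul _), integral_const_mul,
        integral_const_mul]
    · exact hprodint m (fun z => Real.cos (z.2 * (s + z.1))) (by fun_prop)
        (fun z => Real.abs_cos_le_one _)
  set DA : ℝ → ℝ := fun u => A m₁ u - A m₂ u with hDA
  set DB : ℝ → ℝ := fun u => B m₁ u - B m₂ u with hDB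
  have hDAc : Continuous DA := (hAc m₁).sub (hAc m₂)
  have hDBc : Continuous DB := (hBc m₁).sub (hBc m₂)
  set R := m₁.real Set.univ + m₂.real Set.univ with hR
  have hDAb : ∀ u, |DA u| ≤ R := fun u => (abs_sub _ _).trans (add_le_add (hAb m₁ u) (hAb m₂ u))
  have hDBb : ∀ u, |DB u| ≤ R := fun u => (abs_sub _ _).trans (add_le_add (hBb m₁ u) (hBb m₂ u))
  have hbi : ∀ (g : ℝ → ℝ) (c : ℝ), Continuous g → (∀ u, |g u| ≤ c) →
      IntegrableOn (fun u => g u * κ u) (Set.Ioi 0) := by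
    intro g c hg hb
    exact Integrable.bdd_mul hκi hg.aestronglyMeasurable (Filter.Eventually.of_forall fun z => hb z)
  have hF2 : ∀ s : ℝ,
      ∫ u in Set.Ioi (0 : ℝ), (Real.cos (u * s) * DA u - Real.sin (u * s) * DB u) * κ u = 0 := by
    intro s
    have e1 := hF1 m₁ s
    have e2 := hF1 m₂ s
    rw [hJm s, e2] at e1
    have hitg : ∀ (m : Measure ℝ) [IsFiniteMeasure m], IntegrableOn (fun u => 
      (Real.cos (u * s) * A m u - Real.sin (u * s) * B m u) * κ u) (Set.Ioi 0) := by
      intro m _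
      have := hAc m
      have := hBc m
      refine hbi _ (m.real Set.univ + m.real Set.univ) (by fun_prop) ?_
      intro u
      refine (abs_sub _ _).trans (add_le_add ?_ ?_)
      · rw [abs_mul]
        exact (mul_le_mul_of_nonneg_right (Real.abs_cos_le_one _) (abs_nonneg _)).trans
          (by rw [one_mul]; exact hAb m u)
      · rw [abs_mul]
        exact (mul_le_mul_of_nonneg_right (Real.abs_sin_le_one _) (abs_nonneg _)).trans
          (by rw [one_mul]; exact hBb m u)
    have := integral_sub (hitg m₁) (hitg m₂)
    rw [e1, sub_self] at this
    refine Eq.trans ?_ this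
    refine integral_congr_ae (Filter.Eventually.of_forall fun u => ?_)
    simp only [hDA, hDB]; ring
  have hF3 : ∀ (m : Measure ℝ) [IsFiniteMeasure m],
      ∫ u in Set.Ioi (0 : ℝ), (A m u * DA u + B m u * DB u) * κ u = 0 := by
    intro m _
    have e : ∫ y, (∫ u in Set.Ioi (0 : ℝ),
        (Real.cos (u * y) * DA u + Real.sin (u * y) * DB u) * κ u) ∂m = 0 := by
      have : ∀ y, ∫ u in Set.Ioi (0 : ℝ),
        (Real.cos (u * y) * DA u + Real.sin (u * y) * DB u) * κ u = 0 := by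
        intro y
        refine Eq.trans ?_ (hF2 (-y))
        refine integral_congr_ae (Filter.Eventually.of_forall fun u => ?_)
        simp
      simp_rw [this]; simp
    rw [integral_integral_swap] at e
    · refine Eq.trans ?_ e
      refine integral_congr_ae (Filter.Eventually.of_forall fun u => ?_)
      simp only
      rw [integral_mul_const, integral_add ((hci m u).mul_const _) ((hsi m u).mul_const _),
        integral_mul_const, integral_mul_const]
    · have hκ2 : Integrable (fun z : ℝ × ℝ => κ z.2) (m.prod (volume.restrict (Set.Ioi 0))) :=
        Integrable.comp_snd hκi m
      refine hκ2.bdd_mul (c := R + R) (Continuous.aestronglyMeasurable (by fun_prop))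
        (Filter.Eventually.of_forall fun z => ?_)
      refine (abs_add_le _ _).trans (add_le_add ?_ ?_)
      · rw [abs_mul]
        exact (mul_le_mul_of_nonneg_right (Real.abs_cos_le_one _) (abs_nonneg _)).trans
          (by rw [one_mul]; exact hDAb _)
      · rw [abs_mul]
        exact (mul_le_mul_of_nonneg_right (Real.abs_sin_le_one _) (abs_nonneg _)).trans
          (by rw [one_mul]; exact hDBb _)
  have hitgD : ∀ (m : Measure ℝ) [IsFiniteMeasure m],
      IntegrableOn (fun u => (A m u * DA u + B m u * DB u) * κ u) (Set.Ioi 0) := by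
    intro m _
    have := hAc m
    have := hBc m
    refine hbi _ (m.real Set.univ * R + m.real Set.univ * R) (by fun_prop) ?_
    intro u
    refine (abs_add_le _ _).trans (add_le_add ?_ ?_)
    · rw [abs_mul]
      exact mul_le_mul (hAb m u) (hDAb u) (abs_nonneg _) (by positivity)
    · rw [abs_mul]
      exact mul_le_mul (hBb m u) (hDBb u) (abs_nonneg _) (by positivity)
  have hfin : ∫ u in Set.Ioi (0 : ℝ), (DA u ^ 2 + DB u ^ 2) * κ u = 0 := by
    have := integral_sub (hitgD m₁) (hitgD m₂)
    rw [hF3 m₁, hF3 m₂, sub_zero] at this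
    refine Eq.trans ?_ this
    refine integral_congr_ae (Filter.Eventually.of_forall fun u => ?_)
    simp only [hDA, hDB]; ring
  have hκnn : ∀ u ∈ Set.Ioi (0 : ℝ), 0 ≤ κ u := by
    intro u hu
    have hu0 : 0 < u := hu
    have : 0 ≤ 2 - 2 * Real.cos u := by linarith [Real.cos_le_one u]
    simp only [hκ]; positivity
  have hz : Set.EqOn (fun u => (DA u ^ 2 + DB u ^ 2) * κ u) 0 (Set.Ioi 0) := by
    have hi : IntegrableOn (fun u => (DA u ^ 2 + DB u ^ 2) * κ u) (Set.Ioi 0) := by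
      have := (hitgD m₁).sub (hitgD m₂)
      refine this.congr (Filter.Eventually.of_forall fun u => ?_)
      simp only [hDA, hDB, Pi.sub_apply]; ring
    have hnn : 0 ≤ᵐ[volume.restrict (Set.Ioi (0 : ℝ))] fun u : ℝ => (DA u ^ 2 + DB u ^ 2) * κ u := by
      refine (ae_restrict_iff' measurableSet_Ioi).2 (Filter.Eventually.of_forall fun u hu => ?_)
      have := hκnn u hu
      simp only [Pi.zero_apply]; positivity
    have h0 := (integral_eq_zero_iff_of_nonneg_ae hnn hi).1 hfin
    refine Measure.eqOn_open_of_ae_eq h0 isOpen_Ioi ?_ continuousOn_const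
    exact (((hDAc.pow 2).add (hDBc.pow 2)).continuousOn).mul hκc
  have h11 := hz (show (1 : ℝ) ∈ Set.Ioi 0 from Set.mem_Ioi.2 one_pos)
  have hκ1 : κ 1 ≠ 0 := by
    have : Real.cos 1 < 1 := by
      have := Real.cos_one_le
      linarith
    have : 0 < 2 - 2 * Real.cos 1 := by linarith
    simp only [hκ]; positivity
  have hs := (mul_eq_zero.1 h11).resolve_right hκ1
  have hA0 : DA 1 = 0 := by nlinarith [sq_nonneg (DA 1), sq_nonneg (DB 1)]
  have hB0 : DB 1 = 0 := by nlinarith [sq_nonneg (DA 1), sq_nonneg (DB 1)]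
  have hch : ∀ (m : Measure ℝ) [IsFiniteMeasure m], charFun m 1 = (A m 1 : ℂ) + (B m 1 : ℂ) * Complex.I := by
    intro m _
    rw [charFun_apply_real]
    simp only [hA, hB]
    rw [← integral_complex_ofReal, ← integral_complex_ofReal, ← integral_mul_const,
      ← integral_add (hci m 1).ofReal ((hsi m 1).ofReal.mul_const _)]
    refine integral_congr_ae (Filter.Eventually.of_forall fun x => ?_)
    simp [Complex.exp_mul_I]
  rw [hch m₁, hch m₂, sub_eq_zero.1 hA0, sub_eq_zero.1 hB0]

lemma equimeas {X : Type*} [TopologicalSpace X] [MeasurableSpace X] [BorelSpace X] (vol : Measure X)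
    {ι : Type*} [Fintype ι]
    {p : ℝ} (hp : 0 < p) (hpNotEven : ∀ k : ℕ, p ≠ 2 * k)
    {E₁ E₂ : Set X} (hE₂ : IsOpen E₂) (hfin : vol E₁ ≠ ⊤)
    (f h : ι → X → ℝ) (w : X → ℝ) (hf : ∀ i, Continuous (f i))
    (hh : ∀ i, ContinuousOn (h i) E₂) (hw : ContinuousOn w E₂)
    (hi1 : ∀ (s : ℝ) (L : ι → ℝ), IntegrableOn (fun x => |s + ∑ i, L i * f i x| ^ p) E₁ vol)
    (hi2 : ∀ (s : ℝ) (L : ι → ℝ), IntegrableOn (fun x => |s * w x + ∑ i, L i * h i x| ^ p) E₂ vol)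
    (heq : ∀ (s : ℝ) (L : ι → ℝ), ∫ x in E₂, |s * w x + ∑ i, L i * h i x| ^ p ∂vol =
      ∫ x in E₁, |s + ∑ i, L i * f i x| ^ p ∂vol) :
    (vol.restrict E₁).map (fun x i => f i x) =
      ((vol.restrict {x ∈ E₂ | w x ≠ 0}).withDensity (fun x => ENNReal.ofReal (|w x| ^ p))).map
        (fun x i => h i x / w x) := by
  set U : Set X := {x ∈ E₂ | w x ≠ 0} with hU
  have hUo : IsOpen U := hw.isOpen_inter_preimage hE₂ isOpen_ne
  have hUE : U ⊆ E₂ := fun x hx => hx.1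
  have hUm : MeasurableSet U := hUo.measurableSet
  set ν := (vol.restrict U).withDensity (fun x => ENNReal.ofReal (|w x| ^ p)) with hν
  have hwU : ContinuousOn w U := hw.mono hUE
  have hwm : AEMeasurable w (vol.restrict U) := hwU.aemeasurable hUm
  have hdm : AEMeasurable (fun x => ENNReal.ofReal (|w x| ^ p)) (vol.restrict U) :=
    ((continuous_abs.measurable.comp_aemeasurable hwm).pow_const p).ennreal_ofReal
  have hwi : IntegrableOn (fun x => |w x| ^ p) E₂ vol := by
    have := hi2 1 0
    simpa using this
  haveI : IsFiniteMeasure ν := by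
    refine isFiniteMeasure_withDensity_ofReal ?_
    exact (hwi.mono_set hUE).2
  haveI : IsFiniteMeasure (vol.restrict E₁) := ⟨by
    rw [Measure.restrict_apply_univ]; exact hfin.lt_top⟩
  have hFm : Measurable (fun x i => f i x) := measurable_pi_lambda _ fun i => (hf i).measurable
  have hac : ν ≪ vol.restrict U := withDensity_absolutelyContinuous _ _
  have hGm : AEMeasurable (fun x i => h i x / w x) ν := by
    refine AEMeasurable.mono_ac ?_ hac
    refine aemeasurable_pi_lambda _ fun i => ?_
    exact (((hh i).mono hUE).aemeasurable hUm).div hwm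
  refine Measure.ext_of_charFunDual ?_
  ext1 L
  rw [charFunDual_eq_charFun_map_one, charFunDual_eq_charFun_map_one]
  classical
  set l : ι → ℝ := fun i => L (Pi.single i 1) with hl
  have hL : ∀ v : ι → ℝ, L v = ∑ i, l i * v i := by
    intro v
    conv_lhs => rw [← Finset.univ_sum_single v]
    rw [map_sum]
    refine Finset.sum_congr rfl fun i _ => ?_
    have : Pi.single i (v i) = v i • (Pi.single i (1 : ℝ) : ι → ℝ) := by
      rw [← Pi.single_smul]; simp
    rw [this, map_smul, smul_eq_mul, mul_comm]
  have hLm : Measurable L := L.continuous.measurable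
  have hcont : ∀ s : ℝ, Continuous (fun x : ℝ => |s + x| ^ p) := fun s =>
    (by fun_prop : Continuous fun x : ℝ => |s + x|).rpow_const (fun _ => Or.inr hp.le)
  have hLF : AEMeasurable (fun x => L (fun i => f i x)) (vol.restrict E₁) :=
    (hLm.comp hFm).aemeasurable
  have hLG : AEMeasurable (fun x => L (fun i => h i x / w x)) ν := hLm.comp_aemeasurable hGm
  rw [Measure.map_map hLm hFm, AEMeasurable.map_map_of_aemeasurable hLm.aemeasurable hGm]
  -- pointwise identity on U
  have hpt : ∀ s : ℝ, ∀ x ∈ U, (ENNReal.ofReal (|w x| ^ p)).toReal * |s + L (fun i => h i x / w x)| ^ p =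
      |s * w x + ∑ i, l i * h i x| ^ p := by
    intro s x hx
    rw [ENNReal.toReal_ofReal (by positivity), ← Real.mul_rpow (abs_nonneg _) (abs_nonneg _),
      ← abs_mul, hL]
    congr 2
    rw [mul_add, Finset.mul_sum, mul_comm]
    congr 1
    refine Finset.sum_congr rfl fun i _ => ?_
    have := hx.2
    field_simp
  have hGint : ∀ s : ℝ, Integrable (fun x => |s + L (fun i => h i x / w x)| ^ p) ν := by
    intro s
    rw [hν, integrable_withDensity_iff_integrable_smul₀' hdm
      (Filter.Eventually.of_forall fun x => ENNReal.ofReal_lt_top)]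
    refine ((hi2 s l).mono_set hUE).congr ?_
    refine (ae_restrict_iff' hUm).2 (Filter.Eventually.of_forall fun x hx => ?_)
    exact (hpt s x hx).symm
  refine charFun_one_eq hp hpNotEven _ _ (∫ x in E₂ \ U, |∑ i, l i * h i x| ^ p ∂vol) ?_ ?_ ?_
  · intro s
    refine (integrable_map_measure (hcont s).aestronglyMeasurable hLF).2 ?_
    refine (hi1 s l).congr (Filter.Eventually.of_forall fun x => ?_)
    simp only [Function.comp, hL]
  · intro s
    exact (integrable_map_measure (hcont s).aestronglyMeasurable hLG).2 (hGint s)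
  · intro s
    have e1 := integral_map hLF (hcont s).aestronglyMeasurable
    have e2 := integral_map hLG (hcont s).aestronglyMeasurable
    have e1' : ∫ y, |s + y| ^ p ∂(Measure.map (⇑L ∘ fun x i => f i x) (vol.restrict E₁)) =
      ∫ x in E₁, |s + ∑ i, l i * f i x| ^ p ∂vol := by
      refine e1.trans ?_
      simp only [hL]
    have e2' : ∫ y, |s + y| ^ p ∂(Measure.map (⇑L ∘ fun x i => h i x / w x) ν) =
      ∫ x in U, |s * w x + ∑ i, l i * h i x| ^ p ∂vol := by
      refine e2.trans ?_
      rw [hν, integral_withDensity_eq_integral_toReal_smul₀ hdm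
        (Filter.Eventually.of_forall fun x => ENNReal.ofReal_lt_top)]
      refine setIntegral_congr_fun hUm fun x hx => ?_
      rw [← hpt s x hx]; rfl
    rw [e1', e2', ← heq s l]
    have e3 : ∫ x in E₂ \ U, |∑ i, l i * h i x| ^ p ∂vol =
        ∫ x in E₂ \ U, |s * w x + ∑ i, l i * h i x| ^ p ∂vol := by
      refine setIntegral_congr_fun (hE₂.measurableSet.diff hUm) fun x hx => ?_
      have : w x = 0 := by
        by_contra hne
        exact hx.2 ⟨hx.1, hne⟩
      simp [this]
    rw [e3, ← setIntegral_union Set.disjoint_sdiff_right (hE₂.measurableSet.diff hUm)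
      ((hi2 s l).mono_set hUE) ((hi2 s l).mono_set Set.sdiff_subset),
      Set.union_sdiff_cancel hUE]

section ddcalc
variable {E : Type*} [NormedAddCommGroup E] [NormedSpace ℝ E]

/-- directional derivative -/
def dd (v : E) (f : E → ℝ) (x : E) : ℝ := fderiv ℝ f x v

lemma dd_add (v : E) {f g : E → ℝ} {x : E} (hf : DifferentiableAt ℝ f x)
    (hg : DifferentiableAt ℝ g x) :
    dd v (fun y => f y + g y) x = dd v f x + dd v g x := by
  unfold dd; rw [fderiv_fun_add hf hg]; rfl

lemma dd_sub (v : E) {f g : E → ℝ} {x : E} (hf : DifferentiableAt ℝ f x)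
    (hg : DifferentiableAt ℝ g x) :
    dd v (fun y => f y - g y) x = dd v f x - dd v g x := by
  unfold dd; rw [fderiv_fun_sub hf hg]; rfl

lemma dd_neg (v : E) {f : E → ℝ} {x : E} :
    dd v (fun y => - f y) x = - dd v f x := by
  unfold dd; rw [fderiv_fun_neg]; rfl

lemma dd_mul (v : E) {f g : E → ℝ} {x : E} (hf : DifferentiableAt ℝ f x)
    (hg : DifferentiableAt ℝ g x) :
    dd v (fun y => f y * g y) x = dd v f x * g x + f x * dd v g x := by
  unfold dd; rw [fderiv_fun_mul hf hg]; simp [mul_comm, add_comm]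

lemma dd_const (v : E) (c : ℝ) (x : E) : dd v (fun _ => c) x = 0 := by
  unfold dd; simp

lemma dd_const_mul (v : E) (c : ℝ) {f : E → ℝ} {x : E} (hf : DifferentiableAt ℝ f x) :
    dd v (fun y => c * f y) x = c * dd v f x := by
  rw [dd_mul v (differentiableAt_const c) hf, dd_const]; ring

lemma dd_mul_const (v : E) (c : ℝ) {f : E → ℝ} {x : E} (hf : DifferentiableAt ℝ f x) :
    dd v (fun y => f y * c) x = dd v f x * c := by
  rw [dd_mul v hf (differentiableAt_const c), dd_const]; ring

lemma dd_sum {ι : Type*} (s : Finset ι) (v : E) {f : ι → E → ℝ} {x : E}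
    (hf : ∀ i ∈ s, DifferentiableAt ℝ (f i) x) :
    dd v (fun y => ∑ i ∈ s, f i y) x = ∑ i ∈ s, dd v (f i) x := by
  unfold dd; rw [fderiv_fun_sum hf]; simp

lemma dd_comp (v : E) {ψ : ℝ → ℝ} {ψ' : ℝ} {f : E → ℝ} {x : E} (hψ : HasDerivAt ψ ψ' (f x))
    (hf : DifferentiableAt ℝ f x) : dd v (fun y => ψ (f y)) x = ψ' * dd v f x := by
  unfold dd
  have := (hψ.comp_hasFDerivAt x hf.hasFDerivAt).fderiv
  have h2 : fderiv ℝ (fun y => ψ (f y)) x = ψ' • fderiv ℝ f x := this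
  rw [h2]; rfl

lemma dd_congr (v : E) {f g : E → ℝ} {x : E} (h : f =ᶠ[nhds x] g) : dd v f x = dd v g x := by
  unfold dd; rw [h.fderiv_eq]

lemma dd_congr_on (v : E) {f g : E → ℝ} {U : Set E} (hU : IsOpen U) (h : ∀ y ∈ U, f y = g y) :
    ∀ x ∈ U, dd v f x = dd v g x := fun x hx =>
  dd_congr v (Filter.eventuallyEq_of_mem (hU.mem_nhds hx) h)

lemma dd_vsum {ι : Type*} (s : Finset ι) (c : ι → ℝ) (v : ι → E) (f : E → ℝ) (x : E) :
    dd (∑ i ∈ s, c i • v i) f x = ∑ i ∈ s, c i * dd (v i) f x := by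
  unfold dd; simp

lemma cda_dd {k m : WithTop ℕ∞} (hkm : k + 1 ≤ m) (v : E) {f : E → ℝ} {x : E} (h : ContDiffAt ℝ m f x) :
    ContDiffAt ℝ k (dd v f) x := by
  have := (h.fderiv_right hkm).clm_apply (contDiffAt_const (c := v))
  exact this

lemma cda1_dd (v : E) {f : E → ℝ} {x : E} (h : ContDiffAt ℝ 2 f x) :
    ContDiffAt ℝ 1 (dd v f) x := cda_dd (by norm_num) v h

lemma cda_da {f : E → ℝ} {x : E} (h : ContDiffAt ℝ 2 f x) : DifferentiableAt ℝ f x :=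
  h.differentiableAt (by norm_num)

lemma cda_da1 {f : E → ℝ} {x : E} (h : ContDiffAt ℝ 1 f x) : DifferentiableAt ℝ f x :=
  h.differentiableAt (by norm_num)

lemma dd_da (v : E) {f : E → ℝ} {x : E} (h : ContDiffAt ℝ 2 f x) : DifferentiableAt ℝ (dd v f) x :=
  cda_da1 (cda1_dd v h)

lemma dd_comm (u v : E) {f : E → ℝ} {x : E} (h : ContDiffAt ℝ 2 f x) :
    dd u (dd v f) x = dd v (dd u f) x := by
  have hs : IsSymmSndFDerivAt ℝ f x := h.isSymmSndFDerivAt (by simp)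
  have hd : DifferentiableAt ℝ (fderiv ℝ f) x :=
    (h.fderiv_right (m := 1) (by norm_num)).differentiableAt (by norm_num)
  have key : ∀ u v : E, dd u (dd v f) x = fderiv ℝ (fderiv ℝ f) x u v := by
    intro u v
    show fderiv ℝ (fun y => fderiv ℝ f y v) x u = _
    rw [fderiv_clm_apply hd (differentiableAt_const v)]
    simp
  rw [key, key]; exact hs u v

lemma dd_zero_of_const {U : Set E} (hU : IsOpen U) (v : E) {f : E → ℝ} {c : ℝ} (h : ∀ x ∈ U, f x = c) :
    ∀ x ∈ U, dd v f x = 0 := fun x hx => by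
  rw [dd_congr_on v hU (g := fun _ => c) h x hx, dd_const]

end ddcalc

lemma DOp_diag {n ℓ : ℕ} (A : Matrix (Fin n) (Fin n) ℝ) (a : Fin n → ℝ) (d : Fin n → Fin n → ℝ)
    (α : Fin n → ℝ) (hA : ∀ i j, A i j = ∑ k, epsl n ℓ k * d k i * d k j)
    (ha : ∀ i, a i = ∑ k, α k * d k i)
    {f : (Fin n → ℝ) → ℝ} {x : Fin n → ℝ} (hf : ContDiffAt ℝ 2 f x) :
    DOp A a f x = ∑ k, epsl n ℓ k * dd (d k) (dd (d k) f) x + ∑ k, α k * dd (d k) f x := by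
  have hd : ∀ (k : Fin n) (g : (Fin n → ℝ) → ℝ) (y : Fin n → ℝ),
      dd (d k) g y = ∑ i, d k i * dd (Pi.single i 1) g y := by
    intro k g y
    rw [← dd_vsum]
    congr 1
    ext j
    simp [Finset.sum_apply, Pi.single_apply]
  have hdd : ∀ k, dd (d k) (dd (d k) f) x =
      ∑ i, ∑ j, d k i * d k j * dd (Pi.single i 1) (dd (Pi.single j 1) f) x := by
    intro k
    rw [hd k (dd (d k) f) x]
    refine Finset.sum_congr rfl fun i _ => ?_
    have : dd (d k) f = fun y => ∑ j, d k j * dd (Pi.single j 1) f y := funext fun y => hd k f y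
    rw [this, dd_sum _ _ (fun j _ => (dd_da _ hf).const_mul _), Finset.mul_sum]
    refine Finset.sum_congr rfl fun j _ => ?_
    rw [dd_const_mul _ _ (dd_da _ hf)]; ring
  show (∑ i, ∑ j, A i j * dd (Pi.single i 1) (dd (Pi.single j 1) f) x) +
    ∑ i, a i * dd (Pi.single i 1) f x = _
  congr 1
  · simp only [hdd, hA, Finset.sum_mul, Finset.mul_sum]
    have : ∀ i : Fin n, (∑ j, ∑ k, epsl n ℓ k * d k i * d k j * dd (Pi.single i 1) (dd (Pi.single j 1) f) x)
      = ∑ k, ∑ j, epsl n ℓ k * d k i * d k j * dd (Pi.single i 1) (dd (Pi.single j 1) f) x := fun i =>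
        Finset.sum_comm
    simp only [this]
    rw [Finset.sum_comm]
    refine Finset.sum_congr rfl fun k _ => Finset.sum_congr rfl fun i _ => Finset.sum_congr rfl fun j _ => ?_
    ring
  · simp only [ha, hd, Finset.sum_mul, Finset.mul_sum]
    rw [Finset.sum_comm]
    refine Finset.sum_congr rfl fun k _ => Finset.sum_congr rfl fun i _ => ?_
    ring

/-- decomposition of a matrix from its diagonalization -/
lemma diag_decomp {n ℓ : ℕ} {A M : Matrix (Fin n) (Fin n) ℝ} (hM : Mᵀ * A * M = Imat n ℓ) (a : Fin n → ℝ) :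
    ∃ d : Fin n → Fin n → ℝ, (∀ i j, A i j = ∑ k, epsl n ℓ k * d k i * d k j) ∧
      (∀ i, a i = ∑ k, (Mᵀ.mulVec a) k * d k i) ∧
      (∀ k l, (Mᵀ.mulVec (d k)) l = if l = k then 1 else 0) ∧ M.det ≠ 0 ∧
      (∀ x : Fin n → ℝ, x = ∑ k, (Mᵀ.mulVec x) k • d k) := by
  have hdet : (Imat n ℓ).det ≠ 0 := by
    rw [Imat, det_diagonal]
    refine Finset.prod_ne_zero_iff.2 fun i _ => ?_
    unfold epsl; split_ifs <;> norm_num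
  have hMd : M.det ≠ 0 := by
    intro h
    rw [← hM, det_mul, h, mul_zero] at hdet
    exact hdet rfl
  have hMtu : IsUnit Mᵀ.det := by rw [det_transpose]; exact isUnit_iff_ne_zero.2 hMd
  have hMu : IsUnit M.det := isUnit_iff_ne_zero.2 hMd
  have h1 : Mᵀ * (Mᵀ)⁻¹ = 1 := mul_nonsing_inv _ hMtu
  have h2 : (Mᵀ)⁻¹ * Mᵀ = 1 := nonsing_inv_mul _ hMtu
  have hrec : ∀ x : Fin n → ℝ, ∀ i, x i = ∑ k, (Mᵀ.mulVec x) k * (Mᵀ)⁻¹ i k := by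
    intro x i
    have : ((Mᵀ)⁻¹).mulVec (Mᵀ.mulVec x) = x := by rw [mulVec_mulVec, h2, one_mulVec]
    conv_lhs => rw [← this]
    simp [mulVec, dotProduct, mul_comm]
  refine ⟨fun k i => (Mᵀ)⁻¹ i k, ?_, hrec a, ?_, hMd, ?_⟩
  · intro i j
    have hAe : A = (Mᵀ)⁻¹ * Imat n ℓ * ((Mᵀ)⁻¹)ᵀ := by
      have h3 : M * ((Mᵀ)⁻¹)ᵀ = 1 := by
        rw [← transpose_transpose M, ← transpose_mul, transpose_transpose, h2, transpose_one]
      rw [← hM]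
      calc A = ((Mᵀ)⁻¹ * Mᵀ) * A * (M * ((Mᵀ)⁻¹)ᵀ) := by rw [h2, h3]; simp
        _ = _ := by simp only [Matrix.mul_assoc]
    conv_lhs => rw [hAe]
    rw [mul_apply]
    refine Finset.sum_congr rfl fun k _ => ?_
    rw [Imat, mul_diagonal, transpose_apply]; ring
  · intro k l
    have := congrFun (congrFun h1 l) k
    rw [one_apply] at this
    rw [← this]
    rfl
  · intro x
    ext i
    rw [hrec x i]
    simp [Finset.sum_apply]

lemma hdR {f : ℝ → ℝ} {a b x : ℝ} (h : HasDerivAt f a x) (hab : a = b) : HasDerivAt f b x := hab ▸ h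

section Lopcalc
variable {E : Type*} [NormedAddCommGroup E] [NormedSpace ℝ E] {n : ℕ}

def Lop (ε α : Fin n → ℝ) (d : Fin n → E) (u : E → ℝ) (x : E) : ℝ :=
  ∑ k, ε k * dd (d k) (dd (d k) u) x + ∑ k, α k * dd (d k) u x

def sg (ε : Fin n → ℝ) (d : Fin n → E) (u v : E → ℝ) (x : E) : ℝ :=
  ∑ k, ε k * (dd (d k) u x * dd (d k) v x)

variable {ε α : Fin n → ℝ} {d : Fin n → E}

lemma cda2_ev {u : E → ℝ} {x : E} (hu : ContDiffAt ℝ 2 u x) : ∀ᶠ y in nhds x, ContDiffAt ℝ 2 u y :=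
  hu.eventually (by simp)

lemma dd2_mul (e : E) {u v : E → ℝ} {x : E} (hu : ContDiffAt ℝ 2 u x) (hv : ContDiffAt ℝ 2 v x) :
    dd e (dd e (fun y => u y * v y)) x =
      dd e (dd e u) x * v x + u x * dd e (dd e v) x + 2 * (dd e u x * dd e v x) := by
  have h1 : dd e (fun y => u y * v y) =ᶠ[nhds x] fun y => dd e u y * v y + u y * dd e v y := by
    filter_upwards [cda2_ev hu, cda2_ev hv] with y h1 h2
    exact dd_mul e (cda_da h1) (cda_da h2)
  rw [dd_congr e h1, dd_add e ((dd_da e hu).fun_mul (cda_da hv)) ((cda_da hu).fun_mul (dd_da e hv)),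
    dd_mul e (dd_da e hu) (cda_da hv), dd_mul e (cda_da hu) (dd_da e hv)]
  ring

lemma dd2_add (e : E) {u v : E → ℝ} {x : E} (hu : ContDiffAt ℝ 2 u x) (hv : ContDiffAt ℝ 2 v x) :
    dd e (dd e (fun y => u y + v y)) x = dd e (dd e u) x + dd e (dd e v) x := by
  have h1 : dd e (fun y => u y + v y) =ᶠ[nhds x] fun y => dd e u y + dd e v y := by
    filter_upwards [cda2_ev hu, cda2_ev hv] with y h1 h2
    exact dd_add e (cda_da h1) (cda_da h2)
  rw [dd_congr e h1, dd_add e (dd_da e hu) (dd_da e hv)]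

lemma dd2_const_mul (e : E) (c : ℝ) {u : E → ℝ} {x : E} (hu : ContDiffAt ℝ 2 u x) :
    dd e (dd e (fun y => c * u y)) x = c * dd e (dd e u) x := by
  have h1 : dd e (fun y => c * u y) =ᶠ[nhds x] fun y => c * dd e u y := by
    filter_upwards [cda2_ev hu] with y h1
    exact dd_const_mul e c (cda_da h1)
  rw [dd_congr e h1, dd_const_mul e c (dd_da e hu)]

lemma dd2_comp (e : E) {ψ ψ' : ℝ → ℝ} {ψ'' : ℝ} {u : E → ℝ} {x : E} (hu : ContDiffAt ℝ 2 u x)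
    (h1 : ∀ t, HasDerivAt ψ (ψ' t) t) (h2 : HasDerivAt ψ' ψ'' (u x)) :
    dd e (dd e (fun y => ψ (u y))) x = ψ'' * (dd e u x * dd e u x) + ψ' (u x) * dd e (dd e u) x := by
  have h3 : dd e (fun y => ψ (u y)) =ᶠ[nhds x] fun y => ψ' (u y) * dd e u y := by
    filter_upwards [cda2_ev hu] with y hy
    exact dd_comp e (h1 _) (cda_da hy)
  have h4 : DifferentiableAt ℝ (fun y => ψ' (u y)) x := h2.differentiableAt.comp x (cda_da hu)
  rw [dd_congr e h3, dd_mul e h4 (dd_da e hu), dd_comp e h2 (cda_da hu)]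
  ring

lemma Lop_mul {u v : E → ℝ} {x : E} (hu : ContDiffAt ℝ 2 u x) (hv : ContDiffAt ℝ 2 v x) :
    Lop ε α d (fun y => u y * v y) x = u x * Lop ε α d v x + v x * Lop ε α d u x + 2 * sg ε d u v x := by
  unfold Lop sg
  simp only [dd2_mul _ hu hv, dd_mul _ (cda_da hu) (cda_da hv), Finset.mul_sum, mul_add,
    ← Finset.sum_add_distrib]
  refine Finset.sum_congr rfl fun k _ => ?_
  ring

lemma Lop_add {u v : E → ℝ} {x : E} (hu : ContDiffAt ℝ 2 u x) (hv : ContDiffAt ℝ 2 v x) :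
    Lop ε α d (fun y => u y + v y) x = Lop ε α d u x + Lop ε α d v x := by
  unfold Lop
  simp only [dd2_add _ hu hv, dd_add _ (cda_da hu) (cda_da hv),
    ← Finset.sum_add_distrib]
  refine Finset.sum_congr rfl fun k _ => ?_
  ring

lemma Lop_const_mul (c : ℝ) {u : E → ℝ} {x : E} (hu : ContDiffAt ℝ 2 u x) :
    Lop ε α d (fun y => c * u y) x = c * Lop ε α d u x := by
  unfold Lop
  simp only [dd2_const_mul _ c hu, dd_const_mul _ c (cda_da hu), mul_add, Finset.mul_sum,
    ← Finset.sum_add_distrib]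
  refine Finset.sum_congr rfl fun k _ => ?_
  ring

lemma Lop_sub {u v : E → ℝ} {x : E} (hu : ContDiffAt ℝ 2 u x) (hv : ContDiffAt ℝ 2 v x) :
    Lop ε α d (fun y => u y - v y) x = Lop ε α d u x - Lop ε α d v x := by
  have : (fun y => u y - v y) = fun y => u y + (-1) * v y := by ext y; ring
  rw [this, Lop_add hu (contDiffAt_const.mul hv), Lop_const_mul _ hv]; ring

lemma Lop_const (c : ℝ) {x : E} : Lop ε α d (fun _ => c) x = 0 := by
  have h : ∀ e : E, dd e (fun _ : E => c) = fun _ => 0 := fun e => funext fun y => dd_const e c y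
  unfold Lop
  simp [h, dd_const]

lemma Lop_comp {ψ ψ' : ℝ → ℝ} {ψ'' : ℝ} {u : E → ℝ} {x : E} (hu : ContDiffAt ℝ 2 u x)
    (h1 : ∀ t, HasDerivAt ψ (ψ' t) t) (h2 : HasDerivAt ψ' ψ'' (u x)) :
    Lop ε α d (fun y => ψ (u y)) x = ψ'' * sg ε d u u x + ψ' (u x) * Lop ε α d u x := by
  unfold Lop sg
  simp only [dd2_comp _ hu h1 h2, dd_comp _ (h1 _) (cda_da hu), Finset.mul_sum, mul_add,
    ← Finset.sum_add_distrib]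
  refine Finset.sum_congr rfl fun k _ => ?_
  ring

lemma sg_comp_left {ψ : ℝ → ℝ} {ψ' : ℝ} {u v : E → ℝ} {x : E} (hu : ContDiffAt ℝ 2 u x)
    (h1 : HasDerivAt ψ ψ' (u x)) :
    sg ε d (fun y => ψ (u y)) v x = ψ' * sg ε d u v x := by
  unfold sg
  simp only [dd_comp _ h1 (cda_da hu), Finset.mul_sum]
  refine Finset.sum_congr rfl fun k _ => ?_
  ring

lemma sg_comm {u v : E → ℝ} {x : E} : sg ε d u v x = sg ε d v u x := by
  unfold sg
  refine Finset.sum_congr rfl fun k _ => ?_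
  ring

lemma sg_comp_right {ψ : ℝ → ℝ} {ψ' : ℝ} {u v : E → ℝ} {x : E} (hv : ContDiffAt ℝ 2 v x)
    (h1 : HasDerivAt ψ ψ' (v x)) :
    sg ε d u (fun y => ψ (v y)) x = ψ' * sg ε d u v x := by
  rw [sg_comm, sg_comp_left hv h1, sg_comm]

lemma sg_mul_right {u v w : E → ℝ} {x : E} (hu : ContDiffAt ℝ 2 u x) (hv : ContDiffAt ℝ 2 v x) :
    sg ε d w (fun y => u y * v y) x = u x * sg ε d w v x + v x * sg ε d w u x := by
  unfold sg
  simp only [dd_mul _ (cda_da hu) (cda_da hv), Finset.mul_sum,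
    ← Finset.sum_add_distrib]
  refine Finset.sum_congr rfl fun k _ => ?_
  ring

lemma sg_sub_right {u v w : E → ℝ} {x : E} (hu : ContDiffAt ℝ 2 u x) (hv : ContDiffAt ℝ 2 v x) :
    sg ε d w (fun y => u y - v y) x = sg ε d w u x - sg ε d w v x := by
  unfold sg
  simp only [dd_sub _ (cda_da hu) (cda_da hv),
    ← Finset.sum_sub_distrib]
  refine Finset.sum_congr rfl fun k _ => ?_
  ring

end Lopcalc

/-! one-variable functions -/

def Efun (s t : ℝ) : ℝ := if s = 0 then t else (1 - Real.exp (-(s * t))) / s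

lemma Efun_deriv (s t : ℝ) : HasDerivAt (Efun s) (Real.exp (-(s * t))) t := by
  by_cases hs : s = 0
  · have : Efun s = fun t => t := by ext t; simp [Efun, hs]
    rw [this, hs]; simpa using hasDerivAt_id' t
  · have : Efun s = fun t => (1 - Real.exp (-(s * t))) / s := by ext t; simp [Efun, hs]
    rw [this]
    have h1 : HasDerivAt (fun t : ℝ => -(s * t)) (-(s * 1)) t := ((hasDerivAt_id' t).const_mul s).neg
    have h2 := (h1.exp.const_sub 1).div_const s
    refine hdR h2 ?_
    field_simp

lemma Efun_deriv2 (s t : ℝ) : HasDerivAt (fun t => Real.exp (-(s * t))) (-s * Real.exp (-(s * t))) t := by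
  have h1 : HasDerivAt (fun t : ℝ => -(s * t)) (-(s * 1)) t := ((hasDerivAt_id' t).const_mul s).neg
  refine hdR h1.exp ?_
  ring

lemma Efun_contDiff (s : ℝ) : ContDiff ℝ 2 (Efun s) := by
  by_cases hs : s = 0
  · have : Efun s = fun t => t := by ext t; simp [Efun, hs]
    rw [this]; exact contDiff_id
  · have : Efun s = fun t => (1 - Real.exp (-(s * t))) / s := by ext t; simp [Efun, hs]
    rw [this]; fun_prop

def Einv (s v : ℝ) : ℝ := if s = 0 then v else - Real.log (1 - s * v) / s

lemma Einv_Efun (s t : ℝ) : Einv s (Efun s t) = t := by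
  by_cases hs : s = 0
  · simp [Einv, Efun, hs]
  · simp only [Einv, Efun, hs, if_false]
    have : 1 - s * ((1 - Real.exp (-(s * t))) / s) = Real.exp (-(s * t)) := by field_simp; ring
    rw [this, Real.log_exp]; field_simp

lemma Einv_cda (s t : ℝ) : ContDiffAt ℝ 2 (Einv s) (Efun s t) := by
  by_cases hs : s = 0
  · have : Einv s = fun t => t := by ext t; simp [Einv, hs]
    rw [this]; exact contDiffAt_id
  · have h1 : Einv s = fun v => - Real.log (1 - s * v) / s := by ext t; simp [Einv, hs]
    have : 1 - s * (Efun s t) = Real.exp (-(s * t)) := by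
      simp only [Efun, hs, if_false]; field_simp; ring
    rw [h1]
    have h2 : 1 - s * (Efun s t) ≠ 0 := by rw [this]; positivity
    have h3 : ContDiffAt ℝ 2 (fun v => 1 - s * v) (Efun s t) := by fun_prop
    exact ((h3.log h2).neg).div_const s

def qfun (e α t : ℝ) : ℝ := if α = 0 then e * t ^ 2 / 2 else t / α
def qfun1 (e α t : ℝ) : ℝ := if α = 0 then e * t else 1 / α
def qfun2 (e α : ℝ) : ℝ := if α = 0 then e else 0

lemma qfun_deriv (e α t : ℝ) : HasDerivAt (qfun e α) (qfun1 e α t) t := by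
  by_cases hs : α = 0
  · have : qfun e α = fun t => e * t ^ 2 / 2 := by ext t; simp [qfun, hs]
    rw [this]
    refine hdR (((hasDerivAt_pow 2 t).const_mul e).div_const 2) ?_
    simp [qfun1, hs]; ring
  · have : qfun e α = fun t => t / α := by ext t; simp [qfun, hs]
    rw [this]
    refine hdR ((hasDerivAt_id' t).div_const α) ?_
    simp [qfun1, hs]

lemma qfun_deriv2 (e α t : ℝ) : HasDerivAt (qfun1 e α) (qfun2 e α) t := by
  by_cases hs : α = 0
  · have : qfun1 e α = fun t => e * t := by ext t; simp [qfun1, hs]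
    rw [this]
    refine hdR ((hasDerivAt_id' t).const_mul e) ?_
    simp [qfun2, hs]
  · have : qfun1 e α = fun t => 1 / α := by ext t; simp [qfun1, hs]
    rw [this]
    refine hdR (hasDerivAt_const t _) ?_
    simp [qfun2, hs]

lemma qfun_contDiff (e α : ℝ) : ContDiff ℝ 2 (qfun e α) := by
  by_cases hs : α = 0
  · have : qfun e α = fun t => e * t ^ 2 / 2 := by ext t; simp [qfun, hs]
    rw [this]; fun_prop
  · have : qfun e α = fun t => t / α := by ext t; simp [qfun, hs]
    rw [this]; fun_prop

lemma qfun_eq (e α t : ℝ) (he : e * e = 1) : e * qfun2 e α + α * qfun1 e α t = 1 := by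
  unfold qfun1 qfun2
  by_cases hs : α = 0
  · simp [hs, he]
  · simp [hs]

lemma epsl_sq (n ℓ : ℕ) (i : Fin n) : epsl n ℓ i * epsl n ℓ i = 1 := by
  unfold epsl; split_ifs <;> norm_num

/-- data of a diagonalization -/
structure DiagData (n ℓ : ℕ) (A M : Matrix (Fin n) (Fin n) ℝ) (a : Fin n → ℝ)
    (d : Fin n → Fin n → ℝ) (α : Fin n → ℝ) : Prop where
  hA : ∀ i j, A i j = ∑ k, epsl n ℓ k * d k i * d k j
  ha : ∀ i, a i = ∑ k, α k * d k i
  hd : ∀ k l, (Mᵀ.mulVec (d k)) l = if l = k then 1 else 0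
  hdet : M.det ≠ 0
  hrec : ∀ x : Fin n → ℝ, x = ∑ k, (Mᵀ.mulVec x) k • d k

def Fc {n : ℕ} (M : Matrix (Fin n) (Fin n) ℝ) (k : Fin n) (x : Fin n → ℝ) : ℝ := (Mᵀ.mulVec x) k

lemma Fc_eq {n : ℕ} (M : Matrix (Fin n) (Fin n) ℝ) (k : Fin n) :
    Fc M k = fun x => ∑ j, Mᵀ k j * x j := rfl

lemma Fc_contDiff {n : ℕ} {m : WithTop ℕ∞} (M : Matrix (Fin n) (Fin n) ℝ) (k : Fin n) : ContDiff ℝ m (Fc M k) := by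
  rw [Fc_eq]; fun_prop

lemma dd_Fc {n : ℕ} (M : Matrix (Fin n) (Fin n) ℝ) (k : Fin n) (v x : Fin n → ℝ) :
    dd v (Fc M k) x = Fc M k v := by
  have h : Fc M k = fun x => (((LinearMap.proj k).comp Mᵀ.mulVecLin).toContinuousLinearMap : (Fin n → ℝ) →L[ℝ] ℝ) x := by
    ext x; rfl
  unfold dd
  conv_lhs => rw [h]
  rw [ContinuousLinearMap.fderiv]
  rfl

section nice
variable {n ℓ : ℕ} {A M : Matrix (Fin n) (Fin n) ℝ} {a : Fin n → ℝ} {d : Fin n → Fin n → ℝ} {α : Fin n → ℝ}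

lemma DiagData.DOp_eq (H : DiagData n ℓ A M a d α) {f : (Fin n → ℝ) → ℝ} {x : Fin n → ℝ}
    (hf : ContDiffAt ℝ 2 f x) : DOp A a f x = Lop (epsl n ℓ) α d f x :=
  DOp_diag A a d α H.hA H.ha hf

lemma DiagData.dd_Fc (H : DiagData n ℓ A M a d α) (i k : Fin n) (x : Fin n → ℝ) :
    dd (d i) (Fc M k) x = if k = i then 1 else 0 := by
  rw [_root_.dd_Fc]; exact H.hd i k

lemma DiagData.Lop_Fc (H : DiagData n ℓ A M a d α) (k : Fin n) (x : Fin n → ℝ) :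
    Lop (epsl n ℓ) α d (Fc M k) x = α k := by
  have : ∀ i, dd (d i) (Fc M k) = fun _ => if k = i then 1 else 0 := fun i => funext fun y => H.dd_Fc i k y
  unfold Lop
  simp [this, dd_const]

lemma DiagData.sg_Fc (H : DiagData n ℓ A M a d α) (k l : Fin n) (x : Fin n → ℝ) :
    sg (epsl n ℓ) d (Fc M k) (Fc M l) x = if l = k then epsl n ℓ k else 0 := by
  unfold sg
  simp [H.dd_Fc]
  by_cases h : k = l
  · simp [h]
  · simp [h, Ne.symm h]

def Nice (A : Matrix (Fin n) (Fin n) ℝ) (a : Fin n → ℝ) (f : (Fin n → ℝ) → ℝ) : Prop :=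
  ContDiff ℝ 2 f ∧ ∀ x, DOp A a f x = 0

lemma bdd_integrable {p : ℝ} (hp : 0 < p) {E : Set (Fin n → ℝ)} (hE : IsBoundedDomain E)
    {f : (Fin n → ℝ) → ℝ} (hf : Continuous f) : IntegrableOn (fun x => |f x| ^ p) E volume := by
  have hc : IsCompact (closure E) := hE.2.2.isCompact_closure
  have h1 : Continuous fun x => |f x| ^ p := hf.abs.rpow_const fun _ => Or.inr hp.le
  exact (h1.continuousOn.integrableOn_compact hc).mono_set subset_closure

lemma Nice.sol {p : ℝ} (hp : 0 < p) {E : Set (Fin n → ℝ)} (hE : IsBoundedDomain E)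
    {f : (Fin n → ℝ) → ℝ} (hf : Nice A a f) : f ∈ SolSpace A a E p :=
  ⟨hf.1.contDiffOn, fun x _ => hf.2 x, bdd_integrable hp hE hf.1.continuous⟩

lemma Nice.add (H : DiagData n ℓ A M a d α) {f g : (Fin n → ℝ) → ℝ} (hf : Nice A a f) (hg : Nice A a g) :
    Nice A a (f + g) := by
  have hc : ContDiff ℝ 2 (f + g) := hf.1.add hg.1
  refine ⟨hc, fun x => ?_⟩
  have h1 := hf.2 x
  have h2 := hg.2 x
  rw [H.DOp_eq hf.1.contDiffAt] at h1
  rw [H.DOp_eq hg.1.contDiffAt] at h2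
  rw [H.DOp_eq hc.contDiffAt]
  have := Lop_add (ε := epsl n ℓ) (α := α) (d := d) hf.1.contDiffAt hg.1.contDiffAt (x := x)
  refine Eq.trans this ?_
  rw [h1, h2, add_zero]

lemma Nice.smul (H : DiagData n ℓ A M a d α) {f : (Fin n → ℝ) → ℝ} (hf : Nice A a f) (c : ℝ) :
    Nice A a (c • f) := by
  have hc : ContDiff ℝ 2 (c • f) := hf.1.const_smul c
  refine ⟨hc, fun x => ?_⟩
  have h1 := hf.2 x
  rw [H.DOp_eq hf.1.contDiffAt] at h1
  rw [H.DOp_eq hc.contDiffAt]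
  have := Lop_const_mul (ε := epsl n ℓ) (α := α) (d := d) c hf.1.contDiffAt (x := x)
  refine Eq.trans this ?_
  rw [h1, mul_zero]

lemma Nice.sum (H : DiagData n ℓ A M a d α) {ι : Type*} (s : Finset ι) (L : ι → ℝ) {f : ι → (Fin n → ℝ) → ℝ}
    (hf : ∀ i, Nice A a (f i)) : Nice A a (∑ i ∈ s, L i • f i) := by
  classical
  induction s using Finset.induction_on with
  | empty =>
    refine ⟨by rw [Finset.sum_empty]; exact contDiff_const (c := (0:ℝ)), fun x => ?_⟩
    rw [Finset.sum_empty, H.DOp_eq (by exact contDiffAt_const (c := (0:ℝ)))]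
    exact Lop_const (0 : ℝ)
  | insert i s hi ih =>
    rw [Finset.sum_insert hi]
    exact ((hf i).smul H _).add H ih

lemma nice_one (H : DiagData n ℓ A M a d α) : Nice A a (fun _ => 1) :=
  ⟨contDiff_const, fun x => by rw [H.DOp_eq contDiffAt_const, Lop_const]⟩

def yf (M : Matrix (Fin n) (Fin n) ℝ) (ℓ : ℕ) (α : Fin n → ℝ) (k : Fin n) (x : Fin n → ℝ) : ℝ :=
  Efun (epsl n ℓ k * α k) (Fc M k x)

lemma yf_contDiff (k : Fin n) : ContDiff ℝ 2 (yf M ℓ α k) :=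
  (Efun_contDiff _).comp (Fc_contDiff M k)

lemma Lop_yf (H : DiagData n ℓ A M a d α) (k : Fin n) (x : Fin n → ℝ) :
    Lop (epsl n ℓ) α d (yf M ℓ α k) x = 0 := by
  have := Lop_comp (ε := epsl n ℓ) (α := α) (d := d) (x := x) (Fc_contDiff M k).contDiffAt
    (Efun_deriv (epsl n ℓ k * α k)) (Efun_deriv2 (epsl n ℓ k * α k) _)
  refine Eq.trans this ?_
  rw [H.Lop_Fc, H.sg_Fc, if_pos rfl]
  linear_combination (-α k * Real.exp (-(epsl n ℓ k * α k * Fc M k x))) * epsl_sq n ℓ k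

lemma nice_yf (H : DiagData n ℓ A M a d α) (k : Fin n) : Nice A a (yf M ℓ α k) :=
  ⟨yf_contDiff k, fun x => by rw [H.DOp_eq (yf_contDiff k).contDiffAt, Lop_yf H]⟩

lemma nice_yf_mul (H : DiagData n ℓ A M a d α) {k l : Fin n} (hkl : k ≠ l) :
    Nice A a (fun x => yf M ℓ α k x * yf M ℓ α l x) := by
  have hc : ContDiff ℝ 2 (fun x => yf M ℓ α k x * yf M ℓ α l x) := (yf_contDiff k).mul (yf_contDiff l)
  refine ⟨hc, fun x => ?_⟩
  rw [H.DOp_eq hc.contDiffAt, Lop_mul (yf_contDiff k).contDiffAt (yf_contDiff l).contDiffAt, Lop_yf H, Lop_yf H]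
  have h1 : sg (epsl n ℓ) d (yf M ℓ α k) (yf M ℓ α l) x = 0 := by
    refine (sg_comp_left (Fc_contDiff M k).contDiffAt (Efun_deriv _ _)).trans ?_
    refine (congrArg _ (sg_comp_right (Fc_contDiff M l).contDiffAt (Efun_deriv _ _))).trans ?_
    rw [H.sg_Fc, if_neg (Ne.symm hkl)]; simp
  rw [h1]; ring

lemma Lop_qF (H : DiagData n ℓ A M a d α) (k : Fin n) (x : Fin n → ℝ) :
    Lop (epsl n ℓ) α d (fun x => qfun (epsl n ℓ k) (α k) (Fc M k x)) x = 1 := by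
  rw [Lop_comp (Fc_contDiff M k).contDiffAt (qfun_deriv _ _) (qfun_deriv2 _ _ _), H.Lop_Fc, H.sg_Fc, if_pos rfl,
   ← qfun_eq (epsl n ℓ k) (α k) (Fc M k x) (epsl_sq n ℓ k)]
  ring

lemma nice_qF (H : DiagData n ℓ A M a d α) (k l : Fin n) :
    Nice A a (fun x => qfun (epsl n ℓ k) (α k) (Fc M k x) - qfun (epsl n ℓ l) (α l) (Fc M l x)) := by
  have h : ∀ k, ContDiff ℝ 2 (fun x => qfun (epsl n ℓ k) (α k) (Fc M k x)) := fun k =>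
    (qfun_contDiff _ _).comp (Fc_contDiff M k)
  have hc := (h k).sub (h l)
  refine ⟨hc, fun x => ?_⟩
  rw [H.DOp_eq hc.contDiffAt, Lop_sub (h k).contDiffAt (h l).contDiffAt, Lop_qF H, Lop_qF H, sub_self]

lemma Fc_inj (hM : M.det ≠ 0) {x y : Fin n → ℝ} (h : ∀ k, Fc M k x = Fc M k y) : x = y := by
  have h1 : Mᵀ.mulVec x = Mᵀ.mulVec y := funext h
  have hu : IsUnit Mᵀ := by
    rw [isUnit_iff_isUnit_det, det_transpose]; exact isUnit_iff_ne_zero.2 hM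
  exact Matrix.mulVec_injective_of_isUnit hu h1

lemma yf_inj (hM : M.det ≠ 0) {x y : Fin n → ℝ} (h : ∀ k, yf M ℓ α k x = yf M ℓ α k y) : x = y := by
  refine Fc_inj hM fun k => ?_
  rw [← Einv_Efun (epsl n ℓ k * α k) (Fc M k x), ← Einv_Efun (epsl n ℓ k * α k) (Fc M k y)]
  exact congrArg _ (h k)

end nice

section Tmap
variable {n ℓ : ℕ} {A M : Matrix (Fin n) (Fin n) ℝ} {a : Fin n → ℝ} {d : Fin n → Fin n → ℝ} {α : Fin n → ℝ}
  {E₁ E₂ : Set (Fin n → ℝ)} {p : ℝ} {S₂ : Set ((Fin n → ℝ) → ℝ)}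

/-- an isometric embedding -/
structure IsoT (p : ℝ) (E₁ E₂ : Set (Fin n → ℝ)) (S₁ S₂ : Set ((Fin n → ℝ) → ℝ))
    (T : ((Fin n → ℝ) → ℝ) → ((Fin n → ℝ) → ℝ)) : Prop where
  mem : ∀ f ∈ S₁, T f ∈ S₂
  add : ∀ f ∈ S₁, ∀ g ∈ S₁, T (f + g) = T f + T g
  smul : ∀ (c : ℝ), ∀ f ∈ S₁, T (c • f) = c • T f
  isom : ∀ f ∈ S₁, ∫ x in E₂, |T f x| ^ p = ∫ x in E₁, |f x| ^ p

lemma T_sum (H : DiagData n ℓ A M a d α) (hp : 0 < p) (hE₁ : IsBoundedDomain E₁)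
    {T : ((Fin n → ℝ) → ℝ) → ((Fin n → ℝ) → ℝ)} (hT : IsoT p E₁ E₂ (SolSpace A a E₁ p) S₂ T)
    {ι : Type*} (s : Finset ι) (L : ι → ℝ) {f : ι → (Fin n → ℝ) → ℝ} (hf : ∀ i, Nice A a (f i)) :
    T (∑ i ∈ s, L i • f i) = ∑ i ∈ s, L i • T (f i) := by
  classical
  induction s using Finset.induction_on with
  | empty =>
    rw [Finset.sum_empty, Finset.sum_empty]
    have h0 := hT.smul 0 _ ((nice_one H).sol hp hE₁)
    rw [zero_smul, zero_smul] at h0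
    exact h0
  | insert i s hi ih =>
    rw [Finset.sum_insert hi, Finset.sum_insert hi, hT.add _ (((hf i).smul H _).sol hp hE₁) _
      ((Nice.sum H s L hf).sol hp hE₁), ih, hT.smul _ _ ((hf i).sol hp hE₁)]

lemma T_equi (H : DiagData n ℓ A M a d α) (hp : 0 < p) (hpNotEven : ∀ k : ℕ, p ≠ 2 * k)
    (hE₁ : IsBoundedDomain E₁) (hE₂ : IsBoundedDomain E₂)
    {B : Matrix (Fin n) (Fin n) ℝ} {b : Fin n → ℝ}
    {T : ((Fin n → ℝ) → ℝ) → ((Fin n → ℝ) → ℝ)} (hT : IsoT p E₁ E₂ (SolSpace A a E₁ p) (SolSpace B b E₂ p) T)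
    {ι : Type*} [Fintype ι] {f : ι → (Fin n → ℝ) → ℝ} (hf : ∀ i, Nice A a (f i)) :
    (volume.restrict E₁).map (fun x i => f i x) =
      ((volume.restrict {x ∈ E₂ | T (fun _ => 1) x ≠ 0}).withDensity
        (fun x => ENNReal.ofReal (|T (fun _ => 1) x| ^ p))).map
        (fun x i => T (f i) x / T (fun _ => 1) x) := by
  have h1 := (nice_one H).sol hp hE₁
  have hlin : ∀ (s : ℝ) (L : ι → ℝ), Nice A a (s • (fun _ => (1:ℝ)) + ∑ i, L i • f i) := fun s L =>
    ((nice_one H).smul H s).add H (Nice.sum H _ L hf)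
  have hTl : ∀ (s : ℝ) (L : ι → ℝ), T (s • (fun _ => (1:ℝ)) + ∑ i, L i • f i) =
      fun x => s * T (fun _ => 1) x + ∑ i, L i * T (f i) x := by
    intro s L
    rw [hT.add _ (((nice_one H).smul H s).sol hp hE₁) _ ((Nice.sum H _ L hf).sol hp hE₁),
      T_sum H hp hE₁ hT _ L hf, hT.smul _ _ h1]
    ext x
    simp [Finset.sum_apply]
  have hpt : ∀ (s : ℝ) (L : ι → ℝ), (s • (fun _ => (1:ℝ)) + ∑ i, L i • f i) =
      fun x => s + ∑ i, L i * f i x := by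
    intro s L
    ext x
    simp [Finset.sum_apply]
  refine equimeas volume hp hpNotEven hE₂.1 hE₁.2.2.measure_lt_top.ne f (fun i => T (f i)) (T fun _ => 1)
    (fun i => (hf i).1.continuous) (fun i => (hT.mem _ ((hf i).sol hp hE₁)).1.continuousOn)
    (hT.mem _ h1).1.continuousOn ?_ ?_ ?_
  · intro s L
    have := ((hlin s L).sol hp hE₁).2.2
    rw [hpt] at this
    exact this
  · intro s L
    have := (hT.mem _ ((hlin s L).sol hp hE₁)).2.2
    rw [hTl] at this
    exact this
  · intro s L
    have := hT.isom _ ((hlin s L).sol hp hE₁)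
    rw [hTl, hpt] at this
    exact this

/-- a.e. support argument -/
lemma T_point (H : DiagData n ℓ A M a d α) (hp : 0 < p) (hpNotEven : ∀ k : ℕ, p ≠ 2 * k)
    (hE₁ : IsBoundedDomain E₁) (hE₂ : IsBoundedDomain E₂)
    {B : Matrix (Fin n) (Fin n) ℝ} {b : Fin n → ℝ}
    {T : ((Fin n → ℝ) → ℝ) → ((Fin n → ℝ) → ℝ)} (hT : IsoT p E₁ E₂ (SolSpace A a E₁ p) (SolSpace B b E₂ p) T)
    {ι : Type*} [Fintype ι] {f : ι → (Fin n → ℝ) → ℝ} (hf : ∀ i, Nice A a (f i)) :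
    ∀ x ∈ E₂, T (fun _ => 1) x ≠ 0 → ∃ z ∈ closure E₁, ∀ i, T (f i) x = T (fun _ => 1) x * f i z := by
  have heq := T_equi H hp hpNotEven hE₁ hE₂ hT hf
  set w := T (fun _ => 1) with hw
  have hwc : ContinuousOn w E₂ := (hT.mem _ ((nice_one H).sol hp hE₁)).1.continuousOn
  set U : Set (Fin n → ℝ) := {x ∈ E₂ | w x ≠ 0} with hU
  have hUo : IsOpen U := hwc.isOpen_inter_preimage hE₂.1 isOpen_ne
  have hUE : U ⊆ E₂ := fun x hx => hx.1
  have hTc : ∀ i, ContinuousOn (T (f i)) U := fun i =>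
    (hT.mem _ ((hf i).sol hp hE₁)).1.continuousOn.mono hUE
  have hwU : ContinuousOn w U := hwc.mono hUE
  have hGc : ContinuousOn (fun x i => T (f i) x / w x) U :=
    continuousOn_pi.2 fun i => (hTc i).div hwU fun x hx => hx.2
  have hFc : Continuous (fun x i => f i x) := continuous_pi fun i => (hf i).1.continuous
  set K : Set (ι → ℝ) := (fun x i => f i x) '' closure E₁ with hK
  have hKc : IsClosed K := (hE₁.2.2.isCompact_closure.image hFc).isClosed
  have hO : IsOpen (U ∩ (fun x i => T (f i) x / w x) ⁻¹' Kᶜ) := hGc.isOpen_inter_preimage hUo hKc.isOpen_compl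
  have hdm : AEMeasurable (fun x => ENNReal.ofReal (|w x| ^ p)) (volume.restrict U) :=
    ((continuous_abs.measurable.comp_aemeasurable (hwU.aemeasurable hUo.measurableSet)).pow_const p).ennreal_ofReal
  have hGm : AEMeasurable (fun x i => T (f i) x / w x)
      ((volume.restrict U).withDensity (fun x => ENNReal.ofReal (|w x| ^ p))) :=
    (hGc.aemeasurable hUo.measurableSet).mono_ac (withDensity_absolutelyContinuous _ _)
  have h0 : ((volume.restrict U).withDensity (fun x => ENNReal.ofReal (|w x| ^ p)))
      ((fun x i => T (f i) x / w x) ⁻¹' Kᶜ) = 0 := by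
    have h1 := DFunLike.congr_fun heq Kᶜ
    rw [Measure.map_apply_of_aemeasurable hGm hKc.isOpen_compl.measurableSet,
      Measure.map_apply hFc.measurable hKc.isOpen_compl.measurableSet] at h1
    rw [← h1, Measure.restrict_apply (hFc.measurable hKc.isOpen_compl.measurableSet)]
    convert measure_empty (μ := volume)
    ext x
    simp only [Set.mem_inter_iff, Set.mem_preimage, Set.mem_compl_iff, Set.mem_empty_iff_false, iff_false, not_and]
    intro h hx
    exact h ⟨x, subset_closure hx, rfl⟩
  have h2 : ∀ᵐ x ∂(volume.restrict U), ENNReal.ofReal (|w x| ^ p) ≠ 0 := by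
    refine (ae_restrict_iff' hUo.measurableSet).2 (Filter.Eventually.of_forall fun x hx => ?_)
    have : 0 < |w x| := abs_pos.2 hx.2
    have : 0 < |w x| ^ p := by positivity
    simpa using this
  have hac : volume.restrict U ≪ (volume.restrict U).withDensity (fun x => ENNReal.ofReal (|w x| ^ p)) :=
    withDensity_absolutelyContinuous' hdm h2
  have h3 := hac h0
  have h4 : volume (U ∩ (fun x i => T (f i) x / w x) ⁻¹' Kᶜ) = 0 := by
    rw [Measure.restrict_apply' hUo.measurableSet] at h3
    rw [Set.inter_comm]; exact h3
  have h5 := (hO.measure_eq_zero_iff volume).1 h4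
  intro x hx hwx
  have h6 : (fun i => T (f i) x / w x) ∈ K := by
    by_contra hne
    have : x ∈ U ∩ (fun x i => T (f i) x / w x) ⁻¹' Kᶜ := ⟨⟨hx, hwx⟩, hne⟩
    rw [h5] at this
    exact this
  obtain ⟨z, hz, hzz⟩ := h6
  refine ⟨z, hz, fun i => ?_⟩
  have := congrFun hzz i
  simp only at this
  rw [this]; field_simp

lemma T_structure (H : DiagData n ℓ A M a d α) (hp : 0 < p) (hpNotEven : ∀ k : ℕ, p ≠ 2 * k)
    (hE₁ : IsBoundedDomain E₁) (hE₂ : IsBoundedDomain E₂)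
    {B : Matrix (Fin n) (Fin n) ℝ} {b : Fin n → ℝ}
    {T : ((Fin n → ℝ) → ℝ) → ((Fin n → ℝ) → ℝ)} (hT : IsoT p E₁ E₂ (SolSpace A a E₁ p) (SolSpace B b E₂ p) T) :
    ∃ (w : (Fin n → ℝ) → ℝ) (τ : (Fin n → ℝ) → (Fin n → ℝ)),
      w ∈ SolSpace B b E₂ p ∧
      (∀ x ∈ E₂, w x ≠ 0 → τ x ∈ closure E₁) ∧
      (∀ f, Nice A a f → ∃ g ∈ SolSpace B b E₂ p, ∀ x ∈ E₂, w x ≠ 0 → g x = w x * f (τ x)) ∧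
      (∀ x ∈ E₂, w x ≠ 0 → ∀ k, ContDiffAt ℝ 2 (fun x => Fc M k (τ x)) x) ∧
      (∀ S, MeasurableSet S → volume (S ∩ E₁) = ∫⁻ x in {x ∈ E₂ | w x ≠ 0} ∩ τ ⁻¹' S, ENNReal.ofReal (|w x| ^ p)) := by
  have hpoint := T_point H hp hpNotEven hE₁ hE₂ hT (nice_yf H)
  have heq := T_equi H hp hpNotEven hE₁ hE₂ hT (nice_yf H)
  have hw0 := hT.mem _ ((nice_one H).sol hp hE₁)
  have hpf : ∀ f, Nice A a f → ∀ x ∈ E₂, T (fun _ => 1) x ≠ 0 → ∃ z ∈ closure E₁, T f x = T (fun _ => 1) x * f z ∧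
      ∀ i, T (yf M ℓ α i) x = T (fun _ => 1) x * yf M ℓ α i z := by
    intro f hf x hx hwx
    obtain ⟨z, hz, hzz⟩ := T_point H hp hpNotEven hE₁ hE₂ hT (ι := Option (Fin n))
      (f := fun o => o.elim f (yf M ℓ α)) (by
        intro o; cases o with
        | none => exact hf
        | some k => exact nice_yf H k) x hx hwx
    exact ⟨z, hz, hzz none, fun i => hzz (some i)⟩
  have hyC : ∀ k, ContDiffOn ℝ 2 (T (yf M ℓ α k)) E₂ := fun k => (hT.mem _ ((nice_yf H k).sol hp hE₁)).1
  set w := T (fun _ => 1) with hw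
  choose! τ hτ1 hτ2 using hpoint
  set U : Set (Fin n → ℝ) := {x ∈ E₂ | w x ≠ 0} with hU
  have hUo : IsOpen U := hw0.1.continuousOn.isOpen_inter_preimage hE₂.1 isOpen_ne
  have hUE : U ⊆ E₂ := fun x hx => hx.1
  have hkey : ∀ x ∈ U, ∀ k, yf M ℓ α k (τ x) = T (yf M ℓ α k) x / w x := by
    intro x hx k
    have := hτ2 x hx.1 hx.2 k
    have h2 := hx.2
    rw [this]; field_simp
  have hsmooth : ∀ x ∈ U, ∀ k, ContDiffAt ℝ 2 (fun x => Fc M k (τ x)) x := by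
    intro x hx k
    have h1 : ContDiffAt ℝ 2 (fun x => Einv (epsl n ℓ k * α k) (T (yf M ℓ α k) x / w x)) x := by
      have h2 : ContDiffAt ℝ 2 (fun x => T (yf M ℓ α k) x / w x) x :=
        ((hyC k).contDiffAt (hE₂.1.mem_nhds hx.1)).div (hw0.1.contDiffAt (hE₂.1.mem_nhds hx.1)) hx.2
      have h3 : ContDiffAt ℝ 2 (Einv (epsl n ℓ k * α k)) (T (yf M ℓ α k) x / w x) := by
        rw [← hkey x hx k]
        exact Einv_cda _ _
      exact h3.comp x h2
    refine h1.congr_of_eventuallyEq ?_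
    filter_upwards [hUo.mem_nhds hx] with y hy
    rw [← hkey y hy k]
    exact (Einv_Efun _ _).symm
  refine ⟨w, τ, hw0, hτ1, ?_, fun x hx hwx => hsmooth x ⟨hx, hwx⟩, ?_⟩
  · intro f hf
    refine ⟨T f, hT.mem _ (hf.sol hp hE₁), fun x hx hwx => ?_⟩
    obtain ⟨z, hz, h1, h2⟩ := hpf f hf x hx hwx
    have : z = τ x := by
      refine yf_inj (M := M) (ℓ := ℓ) (α := α) H.hdet fun k => ?_
      have h3 := hτ2 x hx hwx k
      rw [h2 k] at h3
      exact mul_left_cancel₀ hwx h3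
    rw [h1, this]
  · intro S hS
    have hcy : Continuous (fun x k => yf M ℓ α k x) := continuous_pi fun k => (yf_contDiff k).continuous
    have hinj : Function.Injective (fun x k => yf M ℓ α k x) := fun x y hxy =>
      yf_inj (M := M) (ℓ := ℓ) (α := α) H.hdet fun k => congrFun hxy k
    have hme := hcy.measurableEmbedding hinj
    have hK : MeasurableSet ((fun x k => yf M ℓ α k x) '' S) := hme.measurableSet_image.2 hS
    have h1 := DFunLike.congr_fun heq ((fun x k => yf M ℓ α k x) '' S)
    have hGc : ContinuousOn (fun x i => T (yf M ℓ α i) x / w x) U :=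
      continuousOn_pi.2 fun i => ((hyC i).continuousOn.mono hUE).div (hw0.1.continuousOn.mono hUE) fun x hx => hx.2
    have hGm0 : AEMeasurable (fun x i => T (yf M ℓ α i) x / w x) (volume.restrict U) :=
      hGc.aemeasurable hUo.measurableSet
    have hGm : AEMeasurable (fun x i => T (yf M ℓ α i) x / w x)
      ((volume.restrict U).withDensity (fun x => ENNReal.ofReal (|w x| ^ p))) :=
      hGm0.mono_ac (withDensity_absolutelyContinuous _ _)
    rw [Measure.map_apply_of_aemeasurable hGm hK, Measure.map_apply hcy.measurable hK,
      hinj.preimage_image, Measure.restrict_apply hS] at h1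
    have hNM : NullMeasurableSet ((fun x i => T (yf M ℓ α i) x / w x) ⁻¹' ((fun x k => yf M ℓ α k x) '' S))
        (volume.restrict U) := hGm0.nullMeasurableSet_preimage hK
    rw [h1, withDensity_apply₀ _ hNM, Measure.restrict_restrict₀ hNM]
    congr 2
    ext x
    simp only [Set.mem_inter_iff, Set.mem_preimage, and_comm (b := x ∈ U)]
    refine and_congr_right fun hx => ?_
    have : (fun i => T (yf M ℓ α i) x / w x) = fun k => yf M ℓ α k (τ x) := by
      ext k; rw [hkey x hx k]
    rw [this]
    exact hinj.mem_set_image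
end Tmap

lemma struct_core {n : ℕ} {E : Type*} [NormedAddCommGroup E] [NormedSpace ℝ E]
    {ε α β : Fin n → ℝ} (hε : ∀ k, ε k * ε k = 1) {e : Fin n → E}
    {w : E → ℝ} {t : Fin n → E → ℝ} {x : E} (hwx : w x ≠ 0) (ht' : ∀ k, ContDiffAt ℝ 2 (t k) x)
    (hXy : ∀ k, w x * Lop ε β e (fun y => Efun (ε k * α k) (t k y)) x +
      2 * sg ε e w (fun y => Efun (ε k * α k) (t k y)) x = 0)
    (hXm : ∀ k l, k ≠ l → w x * Lop ε β e (fun y => Efun (ε k * α k) (t k y) * Efun (ε l * α l) (t l y)) x +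
      2 * sg ε e w (fun y => Efun (ε k * α k) (t k y) * Efun (ε l * α l) (t l y)) x = 0)
    (hXq : ∀ k l, w x * Lop ε β e (fun y => qfun (ε k) (α k) (t k y) - qfun (ε l) (α l) (t l y)) x +
      2 * sg ε e w (fun y => qfun (ε k) (α k) (t k y) - qfun (ε l) (α l) (t l y)) x = 0) :
    (∀ k l, k ≠ l → sg ε e (t k) (t l) x = 0) ∧
    (∀ k l, ε k * sg ε e (t k) (t k) x = ε l * sg ε e (t l) (t l) x) ∧
    (∀ k, w x * Lop ε β e (t k) x + 2 * sg ε e w (t k) x =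
      w x * (α k * (ε k * sg ε e (t k) (t k) x))) := by
  have hEk : ∀ k, ContDiffAt ℝ 2 (fun y => Efun (ε k * α k) (t k y)) x := fun k =>
    (Efun_contDiff _).contDiffAt.comp x (ht' k)
  have hqk : ∀ k, ContDiffAt ℝ 2 (fun y => qfun (ε k) (α k) (t k y)) x := fun k =>
    (qfun_contDiff _ _).contDiffAt.comp x (ht' k)
  have h3 : ∀ k, w x * Lop ε β e (t k) x + 2 * sg ε e w (t k) x =
      w x * (α k * (ε k * sg ε e (t k) (t k) x)) := by
    intro k
    have h := hXy k
    rw [Lop_comp (ht' k) (Efun_deriv _) (Efun_deriv2 _ _), sg_comp_right (ht' k) (Efun_deriv _ _)] at h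
    have hpos : Real.exp (-(ε k * α k * t k x)) ≠ 0 := (Real.exp_pos _).ne'
    have h' : Real.exp (-(ε k * α k * t k x)) * (w x * Lop ε β e (t k) x + 2 * sg ε e w (t k) x -
      w x * (α k * (ε k * sg ε e (t k) (t k) x))) = 0 := by
      rw [← h]; ring
    have := (mul_eq_zero.1 h').resolve_left hpos
    linarith
  refine ⟨?_, ?_, h3⟩
  · intro k l hkl
    have h' := hXm k l hkl
    rw [Lop_mul (hEk k) (hEk l), sg_mul_right (hEk k) (hEk l), sg_comp_left (ht' k) (Efun_deriv _ _) (v := fun y => Efun (ε l * α l) (t l y)),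
      sg_comp_right (ht' l) (Efun_deriv _ _) (u := t k)] at h'
    have hz : (w x * (Real.exp (-(ε k * α k * t k x)) * Real.exp (-(ε l * α l * t l x)))) * sg ε e (t k) (t l) x = 0 := by
      linear_combination (1/2) * h' - (1/2) * Efun (ε k * α k) (t k x) * hXy l - (1/2) * Efun (ε l * α l) (t l x) * hXy k
    refine (mul_eq_zero.1 hz).resolve_left ?_
    have : w x ≠ 0 := hwx
    exact mul_ne_zero this (mul_ne_zero (Real.exp_pos _).ne' (Real.exp_pos _).ne')
  · have hq : ∀ k, w x * Lop ε β e (fun y => qfun (ε k) (α k) (t k y)) x +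
      2 * sg ε e w (fun y => qfun (ε k) (α k) (t k y)) x = w x * (ε k * sg ε e (t k) (t k) x) := by
      intro k
      rw [Lop_comp (ht' k) (qfun_deriv _ _) (qfun_deriv2 _ _ _), sg_comp_right (ht' k) (qfun_deriv _ _ _)]
      have h4 := h3 k
      have h5 := qfun_eq (ε k) (α k) (t k x) (hε k)
      have h6 : ε k * ε k = 1 := hε k
      linear_combination (qfun1 (ε k) (α k) (t k x)) * h4 + w x * ε k * sg ε e (t k) (t k) x * h5 -
        w x * qfun2 (ε k) (α k) * sg ε e (t k) (t k) x * h6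
    intro k l
    have h' := hXq k l
    rw [Lop_sub (hqk k) (hqk l), sg_sub_right (hqk k) (hqk l)] at h'
    refine mul_left_cancel₀ hwx ?_
    linear_combination h' - hq k + hq l

lemma struct_eqs {n ℓ : ℕ} {A M : Matrix (Fin n) (Fin n) ℝ} {a : Fin n → ℝ} {d : Fin n → Fin n → ℝ} {α : Fin n → ℝ}
    {B N : Matrix (Fin n) (Fin n) ℝ} {b : Fin n → ℝ} {e : Fin n → Fin n → ℝ} {β : Fin n → ℝ}
    (H : DiagData n ℓ A M a d α) (H' : DiagData n ℓ B N b e β)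
    {E₂ : Set (Fin n → ℝ)} {p : ℝ} (hE₂ : IsOpen E₂)
    {w : (Fin n → ℝ) → ℝ} {τ : (Fin n → ℝ) → (Fin n → ℝ)}
    (hw : w ∈ SolSpace B b E₂ p)
    (hf : ∀ f, Nice A a f → ∃ g ∈ SolSpace B b E₂ p, ∀ x ∈ E₂, w x ≠ 0 → g x = w x * f (τ x))
    (ht : ∀ x ∈ E₂, w x ≠ 0 → ∀ k, ContDiffAt ℝ 2 (fun x => Fc M k (τ x)) x)
    {x : Fin n → ℝ} (hx : x ∈ E₂) (hwx : w x ≠ 0) :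
    (∀ k l, k ≠ l → sg (epsl n ℓ) e (fun x => Fc M k (τ x)) (fun x => Fc M l (τ x)) x = 0) ∧
    (∀ k l, epsl n ℓ k * sg (epsl n ℓ) e (fun x => Fc M k (τ x)) (fun x => Fc M k (τ x)) x =
      epsl n ℓ l * sg (epsl n ℓ) e (fun x => Fc M l (τ x)) (fun x => Fc M l (τ x)) x) ∧
    (∀ k, w x * Lop (epsl n ℓ) β e (fun x => Fc M k (τ x)) x + 2 * sg (epsl n ℓ) e w (fun x => Fc M k (τ x)) x =
      w x * (α k * (epsl n ℓ k * sg (epsl n ℓ) e (fun x => Fc M k (τ x)) (fun x => Fc M k (τ x)) x))) := by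
  have ht' : ∀ k, ContDiffAt ℝ 2 (fun x => Fc M k (τ x)) x := fun k => ht x hx hwx k
  set U : Set (Fin n → ℝ) := {x ∈ E₂ | w x ≠ 0} with hU
  have hUo : IsOpen U := hw.1.continuousOn.isOpen_inter_preimage hE₂ isOpen_ne
  have hxU : x ∈ U := ⟨hx, hwx⟩
  have hwc : ContDiffAt ℝ 2 w x := hw.1.contDiffAt (hE₂.mem_nhds hx)
  have hLw : Lop (epsl n ℓ) β e w x = 0 := by
    rw [← H'.DOp_eq hwc]; exact hw.2.1 x hx
  have hX : ∀ f, Nice A a f → ContDiffAt ℝ 2 (fun y => f (τ y)) x →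
      w x * Lop (epsl n ℓ) β e (fun y => f (τ y)) x + 2 * sg (epsl n ℓ) e w (fun y => f (τ y)) x = 0 := by
    intro f hnf hc
    obtain ⟨g, hg, hgw⟩ := hf f hnf
    have hgc : ContDiffAt ℝ 2 g x := hg.1.contDiffAt (hE₂.mem_nhds hx)
    have h1 : Lop (epsl n ℓ) β e g x = 0 := by
      rw [← H'.DOp_eq hgc]; exact hg.2.1 x hx
    have hev : g =ᶠ[nhds x] fun y => w y * f (τ y) := by
      filter_upwards [hUo.mem_nhds hxU] with y hy
      exact hgw y hy.1 hy.2
    have h2 : Lop (epsl n ℓ) β e g x = Lop (epsl n ℓ) β e (fun y => w y * f (τ y)) x := by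
      have hdd : ∀ v, dd v g =ᶠ[nhds x] dd v (fun y => w y * f (τ y)) := fun v => by
        filter_upwards [hev.eventuallyEq_nhds] with y hy
        exact dd_congr v hy
      unfold Lop
      simp only [dd_congr _ (hdd _), dd_congr _ hev]
    rw [h2, Lop_mul hwc hc, hLw] at h1
    linarith
  have hEk : ∀ k, ContDiffAt ℝ 2 (fun y => Efun (epsl n ℓ k * α k) (Fc M k (τ y))) x := fun k =>
    (Efun_contDiff _).contDiffAt.comp x (ht' k)
  have hqk : ∀ k, ContDiffAt ℝ 2 (fun y => qfun (epsl n ℓ k) (α k) (Fc M k (τ y))) x := fun k =>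
    (qfun_contDiff _ _).contDiffAt.comp x (ht' k)
  have c1 : ∀ k, ContDiffAt ℝ 2 (fun y => yf M ℓ α k (τ y)) x := fun k => by
    unfold yf; exact hEk k
  have r1 : ∀ k, _ := fun k => hX (yf M ℓ α k) (nice_yf H k) (c1 k)
  have r2 : ∀ k l, k ≠ l → _ := fun k l hkl => hX _ (nice_yf_mul H hkl) ((c1 k).mul (c1 l))
  have r3 : ∀ k l, _ := fun k l => hX _ (nice_qF H k l) ((hqk k).sub (hqk l))
  simp only [yf] at r1 r2 r3
  exact struct_core (t := fun k x => Fc M k (τ x)) (epsl_sq n ℓ) hwx ht' r1 r2 r3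

section algebra
variable {n : ℕ} {ε : Fin n → ℝ}

/-- the diagonal form -/
def gg (ε : Fin n → ℝ) (i j : Fin n) : ℝ := if i = j then ε i else 0

lemma gg_symm (i j : Fin n) : gg ε i j = gg ε j i := by
  unfold gg
  by_cases h : i = j
  · simp [h]
  · simp [h, Ne.symm h]

lemma gg_self (i : Fin n) : gg ε i i = ε i := by simp [gg]

lemma gg_ne {i j : Fin n} (h : i ≠ j) : gg ε i j = 0 := by simp [gg, h]

lemma sum_gg (hε : ∀ k, ε k * ε k = 1) (f : Fin n → ℝ) (i : Fin n) :
    ∑ j, ε j * (gg ε i j * f j) = f i := by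
  simp only [gg, ite_mul, zero_mul, mul_ite, mul_zero, Finset.sum_ite_eq, Finset.mem_univ, if_true]
  rw [← mul_assoc, hε, one_mul]

lemma sum_gg' (hε : ∀ k, ε k * ε k = 1) (f : Fin n → ℝ) (i : Fin n) :
    ∑ j, ε j * (f j * gg ε i j) = f i := by
  rw [← sum_gg hε f i]
  refine Finset.sum_congr rfl fun j _ => ?_
  ring

lemma pairing (hε : ∀ k, ε k * ε k = 1) {T : Fin n → Fin n → ℝ} {c : ℝ}
    (h : ∀ k l, ∑ j, ε j * (T k j * T l j) = c * gg ε k l) (X : Fin n → ℝ) (l : Fin n) :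
    ∑ j, ε j * (T l j * ∑ k, ε k * (X k * T k j)) = c * X l := by
  have : ∑ j, ε j * (T l j * ∑ k, ε k * (X k * T k j)) =
      ∑ k, ε k * (X k * ∑ j, ε j * (T l j * T k j)) := by
    simp only [Finset.mul_sum]
    rw [Finset.sum_comm]
    refine Finset.sum_congr rfl fun k _ => Finset.sum_congr rfl fun j _ => ?_
    ring
  rw [this]
  simp only [h]
  have h2 := sum_gg hε (fun k => c * X k) l
  rw [← h2]
  refine Finset.sum_congr rfl fun j _ => ?_
  ring

lemma H1_transpose (hε : ∀ k, ε k * ε k = 1) {T : Fin n → Fin n → ℝ} {c : ℝ} (hc : c ≠ 0)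
    (h : ∀ k l, ∑ j, ε j * (T k j * T l j) = c * gg ε k l) :
    ∀ i j, ∑ k, ε k * (T k i * T k j) = c * gg ε i j := by
  let J : Matrix (Fin n) (Fin n) ℝ := Matrix.of T
  let K : Matrix (Fin n) (Fin n) ℝ := Matrix.of fun j k => ε j * T k j * ε k / c
  have h1 : J * K = 1 := by
    ext k l
    rw [mul_apply, one_apply]
    simp only [J, K, of_apply]
    have : ∑ j, T k j * (ε j * T l j * ε l / c) = (ε l / c) * ∑ j, ε j * (T k j * T l j) := by
      rw [Finset.mul_sum]
      refine Finset.sum_congr rfl fun j _ => ?_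
      ring
    rw [this, h, gg]
    by_cases hkl : k = l
    · subst hkl
      simp only [if_true]
      field_simp
      rw [pow_two, hε]
    · simp [hkl]
  have h2 : K * J = 1 := mul_eq_one_comm.1 h1
  intro i j
  have h3 := congrFun (congrFun h2 i) j
  rw [mul_apply, one_apply] at h3
  simp only [J, K, of_apply] at h3
  have : ∑ k, ε i * T k i * ε k / c * T k j = (ε i / c) * ∑ k, ε k * (T k i * T k j) := by
    rw [Finset.mul_sum]
    refine Finset.sum_congr rfl fun j _ => ?_
    ring
  rw [this] at h3
  have hi : ε i ≠ 0 := fun h0 => by have := hε i; rw [h0] at this; norm_num at this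
  have h4 : ∑ k, ε k * (T k i * T k j) = (c * ε i) * (ε i / c * ∑ k, ε k * (T k i * T k j)) := by
    have := hε i
    field_simp
    rw [pow_two, this]
    ring
  rw [h4, h3, gg]
  by_cases hij : i = j <;> simp [hij]

/-- Koszul formula -/
lemma koszul (hε : ∀ k, ε k * ε k = 1) {T : Fin n → Fin n → ℝ} {S : Fin n → Fin n → Fin n → ℝ} {c : ℝ}
    {C : Fin n → ℝ} (h : ∀ k l, ∑ j, ε j * (T k j * T l j) = c * gg ε k l)
    (hS : ∀ k i j, S k i j = S k j i)
    (hD : ∀ i j m, ∑ k, ε k * (S k i m * T k j + T k i * S k j m) = C m * gg ε i j) (l i m : Fin n) :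
    2 * c * S l i m = C m * T l i + C i * T l m - gg ε i m * ∑ j, ε j * (C j * T l j) := by
  have hP : ∀ i j m, ∑ k, ε k * (S k i m * T k j) + ∑ k, ε k * (S k j m * T k i) = C m * gg ε i j := by
    intro i j m
    rw [← hD i j m, ← Finset.sum_add_distrib]
    refine Finset.sum_congr rfl fun j _ => ?_
    ring
  have hPs : ∀ i j m, ∑ k, ε k * (S k i m * T k j) = ∑ k, ε k * (S k m i * T k j) := by
    intro i j m
    refine Finset.sum_congr rfl fun k _ => ?_
    rw [hS]
  have h2P : ∀ j, ∑ k, ε k * (2 * S k i m * T k j) = C m * gg ε i j + C i * gg ε m j - C j * gg ε i m := by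
    intro j
    have e1 := hP i j m
    have e2 := hP m j i
    have e3 := hP i m j
    rw [hPs m j i] at e2
    rw [hPs j m i] at e2
    rw [hPs j i m] at e1
    have : ∑ k, ε k * (2 * S k i m * T k j) = 2 * ∑ k, ε k * (S k i m * T k j) := by
      rw [Finset.mul_sum]
      refine Finset.sum_congr rfl fun k _ => ?_
      ring
    rw [this]
    linarith
  have hp := pairing hε h (fun k => 2 * S k i m) l
  simp only [h2P] at hp
  have e : ∑ j, ε j * (T l j * (C m * gg ε i j + C i * gg ε m j - C j * gg ε i m)) =
      C m * ∑ j, ε j * (T l j * gg ε i j) + C i * ∑ j, ε j * (T l j * gg ε m j) -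
        gg ε i m * ∑ j, ε j * (C j * T l j) := by
    simp only [Finset.mul_sum, ← Finset.sum_add_distrib, ← Finset.sum_sub_distrib]
    refine Finset.sum_congr rfl fun k _ => ?_
    ring
  rw [e, sum_gg' hε, sum_gg' hε] at hp
  linarith

lemma sum_eps (hε : ∀ k, ε k * ε k = 1) : ∑ i : Fin n, ε i * ε i = n := by
  simp [hε]

/-- gradient relation -/
lemma grad_rel (hε : ∀ k, ε k * ε k = 1) {T : Fin n → Fin n → ℝ} {S : Fin n → Fin n → Fin n → ℝ} {c w : ℝ}
    {C W α β : Fin n → ℝ} (hc : c ≠ 0) (hw : w ≠ 0)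
    (h : ∀ k l, ∑ j, ε j * (T k j * T l j) = c * gg ε k l)
    (hk : ∀ l i m, 2 * c * S l i m = C m * T l i + C i * T l m - gg ε i m * ∑ j, ε j * (C j * T l j))
    (h2 : ∀ l, w * (∑ i, ε i * S l i i + ∑ i, β i * T l i) + 2 * ∑ i, ε i * (W i * T l i) = w * (c * α l))
    (j : Fin n) :
    2 * W j / w - (n - 2) / 2 * (C j / c) + ε j * β j = ∑ l, ε l * (α l * T l j) := by
  have htr : ∀ l, 2 * c * ∑ i, ε i * S l i i = (2 - n) * ∑ j, ε j * (C j * T l j) := by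
    intro l
    rw [Finset.mul_sum]
    have : ∀ i, 2 * c * (ε i * S l i i) = 2 * (ε i * (C i * T l i)) - (ε i * ε i) * ∑ j, ε j * (C j * T l j) := by
      intro i
      have := hk l i i
      rw [gg_self] at this
      linear_combination ε i * this
    simp only [this]
    rw [Finset.sum_sub_distrib, ← Finset.mul_sum, ← Finset.sum_mul, sum_eps hε]
    ring
  have hmain : ∀ l, ∑ i, ε i * ((2 * W i / w - (n - 2) / 2 * (C i / c) + ε i * β i) * T l i) = c * α l := by
    intro l
    have e : ∑ i, ε i * ((2 * W i / w - (n - 2) / 2 * (C i / c) + ε i * β i) * T l i) =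
      (2 / w) * ∑ i, ε i * (W i * T l i) - (n - 2) / 2 / c * ∑ i, ε i * (C i * T l i) + ∑ i, β i * T l i := by
      simp only [Finset.mul_sum, ← Finset.sum_add_distrib, ← Finset.sum_sub_distrib]
      refine Finset.sum_congr rfl fun i _ => ?_
      have := hε i
      linear_combination β i * T l i * this
    rw [e]
    have h3 := h2 l
    have h4 := htr l
    have h5 : ∑ i, ε i * S l i i = - ((n - 2) / 2 / c * ∑ i, ε i * (C i * T l i)) := by
      have h2c : (2 * c) ≠ 0 := by simpa using hc
      refine mul_left_cancel₀ h2c ?_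
      rw [h4]
      field_simp
      ring
    rw [h5] at h3
    refine mul_left_cancel₀ hw ?_
    rw [← h3]
    field_simp
    ring
  have ht := H1_transpose hε hc h
  have hp := pairing hε (T := fun i k => T k i) (c := c) (fun i j => ht i j)
    (fun i => (2 * W i / w - (n - 2) / 2 * (C i / c) + ε i * β i)) j
  simp only [hmain] at hp
  refine mul_left_cancel₀ hc ?_
  rw [← hp, Finset.mul_sum]
  refine Finset.sum_congr rfl fun i _ => ?_
  ring

/-- integrability condition -/
lemma hess_alg (hn : 3 ≤ n) (hε : ∀ k, ε k * ε k = 1) {T : Fin n → Fin n → ℝ} {c ρ : ℝ} (hc : c ≠ 0)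
    {r : Fin n → ℝ} {R : Fin n → Fin n → ℝ} {P : Fin n → Fin n → ℝ}
    (h : ∀ k l, ∑ j, ε j * (T k j * T l j) = c * gg ε k l)
    (hPd : ∀ l j, P l j = ∑ k, ε k * (R k j * T l k) - (∑ k, ε k * (r k * r k)) / ρ * T l j)
    (hR : ∀ l i j m, R m j * T l i - R m i * T l j = gg ε i m * P l j - gg ε j m * P l i)
    (i j : Fin n) : R i j = (∑ k, ε k * (r k * r k)) / (2 * ρ) * gg ε i j := by
  set Q := ∑ k, ε k * (r k * r k) with hQ
  have hn' : (3:ℝ) ≤ n := by exact_mod_cast hn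
  have h1 : ∀ l j, (n - 2) * ∑ k, ε k * (R k j * T l k) = ((n - 1) * (Q / ρ) - ∑ k, ε k * R k k) * T l j := by
    intro l j
    have e1 : ∑ m, ε m * (R m j * T l m - R m m * T l j) = ∑ m, ε m * (gg ε m m * P l j - gg ε j m * P l m) := by
      refine Finset.sum_congr rfl fun m _ => ?_
      rw [hR l m j m]
    have e2 : ∑ m, ε m * (R m j * T l m - R m m * T l j) =
        ∑ k, ε k * (R k j * T l k) - (∑ k, ε k * R k k) * T l j := by
      rw [Finset.sum_mul, ← Finset.sum_sub_distrib]
      refine Finset.sum_congr rfl fun m _ => ?_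
      ring
    have e3 : ∑ m, ε m * (gg ε m m * P l j - gg ε j m * P l m) = n * P l j - P l j := by
      simp only [mul_sub, Finset.sum_sub_distrib, sum_gg hε, gg_self]
      rw [← sum_eps hε, Finset.sum_mul]
      congr 1
      refine Finset.sum_congr rfl fun m _ => ?_
      ring
    rw [e2, e3, hPd l j] at e1
    linear_combination -e1
  have hn2 : (n:ℝ) - 2 ≠ 0 := by linarith
  set μ := ((n - 1) * (Q / ρ) - ∑ k, ε k * R k k) / (n - 2) with hμ
  have h2 : ∀ l j, ∑ k, ε k * (R k j * T l k) = μ * T l j := by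
    intro l j
    refine mul_left_cancel₀ hn2 ?_
    rw [h1, hμ]; field_simp
  have ht := H1_transpose hε hc h
  have h3 : ∀ i j, R i j = μ * gg ε i j := by
    intro i j
    have hp := pairing hε (T := fun i k => T k i) (c := c) (fun i j => ht i j) (fun k => R k j) i
    simp only [h2] at hp
    refine mul_left_cancel₀ hc ?_
    rw [← hp]
    have h4 := ht i j
    have : ∑ l, ε l * (T l i * (μ * T l j)) = μ * ∑ l, ε l * (T l i * T l j) := by
      rw [Finset.mul_sum]
      refine Finset.sum_congr rfl fun m _ => ?_
      ring
    rw [this, h4]; ring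
  have h4 : ∑ k, ε k * R k k = n * μ := by
    rw [← sum_eps hε, Finset.sum_mul]
    refine Finset.sum_congr rfl fun m _ => ?_
    rw [h3, gg_self]; ring
  have h5 : μ = Q / (2 * ρ) := by
    have h6 : (n - 2) * μ = (n - 1) * (Q / ρ) - n * μ := by
      rw [← h4, hμ]; field_simp
    have h7 : (n:ℝ) - 1 ≠ 0 := by linarith
    refine mul_left_cancel₀ h7 ?_
    rw [div_mul_eq_div_div_swap]
    linear_combination (1/2) * h6
  rw [h3, h5]

end algebra

section geo
variable {E : Type*} [NormedAddCommGroup E] [NormedSpace ℝ E] {n : ℕ}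

lemma dd_sum_eps (ε : Fin n → ℝ) (v : E) {f g : Fin n → E → ℝ} {x : E}
    (hf : ∀ i, DifferentiableAt ℝ (f i) x) (hg : ∀ i, DifferentiableAt ℝ (g i) x) :
    dd v (fun y => ∑ i, ε i * (f i y * g i y)) x =
      ∑ i, ε i * (dd v (f i) x * g i x + f i x * dd v (g i) x) := by
  rw [dd_sum _ _ (fun i _ => ((hf i).fun_mul (hg i)).const_mul _)]
  refine Finset.sum_congr rfl fun i _ => ?_
  rw [dd_const_mul _ _ ((hf i).fun_mul (hg i)), dd_mul _ (hf i) (hg i)]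

/-- smoothness from directional derivatives -/
lemma cda_of_dd {e : Fin n → E} {F : Fin n → E →L[ℝ] ℝ} (hF : ∀ v, v = ∑ i, F i v • e i)
    {V : Set E} (hV : IsOpen V) {f : E → ℝ} (hf : ∀ x ∈ V, DifferentiableAt ℝ f x)
    (hd : ∀ x ∈ V, ∀ i, ContDiffAt ℝ 1 (dd (e i) f) x) : ∀ x ∈ V, ContDiffAt ℝ 2 f x := by
  have h1 : ContDiffOn ℝ (1 + 1) f V := by
    rw [contDiffOn_succ_iff_fderiv_of_isOpen hV]
    refine ⟨fun x hx => (hf x hx).differentiableWithinAt, by simp, ?_⟩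
    have h2 : fderiv ℝ f = fun x => ∑ i, dd (e i) f x • F i := by
      ext x v
      conv_lhs => rw [hF v]
      simp [dd, mul_comm]
    rw [h2]
    intro x hx
    refine ContDiffAt.contDiffWithinAt ?_
    refine ContDiffAt.sum fun i _ => ?_
    exact (hd x hx i).smul contDiffAt_const
  intro x hx
  have := h1.contDiffAt (hV.mem_nhds hx)
  norm_num at this
  exact this

structure Geo (ε α β : Fin n → ℝ) (e : Fin n → E) (V : Set E) (w c : E → ℝ) (t : Fin n → E → ℝ) : Prop where
  hn : 3 ≤ n
  hε : ∀ k, ε k * ε k = 1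
  hV : IsOpen V
  hw : ∀ x ∈ V, ContDiffAt ℝ 2 w x
  hw0 : ∀ x ∈ V, w x ≠ 0
  ht : ∀ x ∈ V, ∀ k, ContDiffAt ℝ 2 (t k) x
  hc : ∀ x ∈ V, ContDiffAt ℝ 1 c x
  hc0 : ∀ x ∈ V, c x ≠ 0
  h1 : ∀ x ∈ V, ∀ k l, ∑ j, ε j * (dd (e j) (t k) x * dd (e j) (t l) x) = c x * gg ε k l
  h2 : ∀ x ∈ V, ∀ k, w x * Lop ε β e (t k) x + 2 * sg ε e w (t k) x = w x * (c x * α k)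
  hF : ∃ F : Fin n → E →L[ℝ] ℝ, ∀ v, v = ∑ i, F i v • e i

variable {ε α β : Fin n → ℝ} {e : Fin n → E} {V : Set E} {w c : E → ℝ} {t : Fin n → E → ℝ}

lemma Geo.h1' (G : Geo ε α β e V w c t) : ∀ x ∈ V, ∀ i j,
    ∑ k, ε k * (dd (e i) (t k) x * dd (e j) (t k) x) = c x * gg ε i j := fun x hx =>
  H1_transpose G.hε (T := fun k j => dd (e j) (t k) x) (G.hc0 x hx) (G.h1 x hx)

lemma Geo.koszul (G : Geo ε α β e V w c t) : ∀ x ∈ V, ∀ l i m,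
    2 * c x * dd (e m) (dd (e i) (t l)) x = dd (e m) c x * dd (e i) (t l) x + dd (e i) c x * dd (e m) (t l) x -
      gg ε i m * ∑ j, ε j * (dd (e j) c x * dd (e j) (t l) x) := by
  intro x hx
  refine _root_.koszul G.hε (T := fun k j => dd (e j) (t k) x)
    (S := fun l i m => dd (e m) (dd (e i) (t l)) x) (C := fun m => dd (e m) c x) (G.h1 x hx) ?_ ?_
  · intro k i j
    exact dd_comm _ _ (G.ht x hx k)
  · intro i j m
    have := dd_congr_on (e m) G.hV (fun y hy => G.h1' y hy i j) x hx
    rw [dd_sum_eps ε (e m) (fun k => dd_da _ (G.ht x hx k)) (fun k => dd_da _ (G.ht x hx k)),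
      dd_mul_const _ _ (cda_da1 (G.hc x hx))] at this
    exact this

lemma Geo.grad (G : Geo ε α β e V w c t) : ∀ x ∈ V, ∀ j,
    2 * dd (e j) w x / w x - (n - 2) / 2 * (dd (e j) c x / c x) + ε j * β j =
      ∑ l, ε l * (α l * dd (e j) (t l) x) := by
  intro x hx
  exact grad_rel G.hε (T := fun k j => dd (e j) (t k) x)
    (S := fun l i m => dd (e m) (dd (e i) (t l)) x) (C := fun m => dd (e m) c x) (W := fun m => dd (e m) w x)
    (G.hc0 x hx) (G.hw0 x hx) (G.h1 x hx) (G.koszul x hx) (G.h2 x hx)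

lemma Geo.c2 (G : Geo ε α β e V w c t) : ∀ x ∈ V, ContDiffAt ℝ 2 c x := by
  obtain ⟨F, hF⟩ := G.hF
  have hn' : (3:ℝ) ≤ n := by exact_mod_cast G.hn
  have hn2 : (n:ℝ) - 2 ≠ 0 := by linarith
  refine cda_of_dd hF G.hV (fun x hx => cda_da1 (G.hc x hx)) fun x hx j => ?_
  have h1 : ContDiffAt ℝ 1 (fun x => c x * (2 / (n - 2)) * (2 * dd (e j) w x / w x + ε j * β j -
      ∑ l, ε l * (α l * dd (e j) (t l) x))) x := by
    refine ContDiffAt.mul ((G.hc x hx).mul contDiffAt_const) ?_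
    refine ContDiffAt.sub (ContDiffAt.add ?_ contDiffAt_const) ?_
    · exact (contDiffAt_const.mul (cda1_dd _ (G.hw x hx))).div ((G.hw x hx).of_le (by norm_num)) (G.hw0 x hx)
    · exact ContDiffAt.sum fun l _ => contDiffAt_const.mul (contDiffAt_const.mul (cda1_dd _ (G.ht x hx l)))
  refine h1.congr_of_eventuallyEq ?_
  filter_upwards [G.hV.mem_nhds hx] with y hy
  have h2 := G.grad y hy j
  have h3 := G.hc0 y hy
  rw [← h2]
  field_simp
  ring

lemma Geo.t3 (G : Geo ε α β e V w c t) : ∀ x ∈ V, ∀ l i, ContDiffAt ℝ 2 (dd (e i) (t l)) x := by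
  obtain ⟨F, hF⟩ := G.hF
  intro x hx l i
  refine cda_of_dd hF G.hV (fun x hx => dd_da _ (G.ht x hx l)) ?_ x hx
  intro x hx m
  have h1 : ContDiffAt ℝ 1 (fun x => (dd (e m) c x * dd (e i) (t l) x + dd (e i) c x * dd (e m) (t l) x -
      gg ε i m * ∑ j, ε j * (dd (e j) c x * dd (e j) (t l) x)) / (2 * c x)) x := by
    have hC : ∀ j, ContDiffAt ℝ 1 (dd (e j) c) x := fun j => cda1_dd _ (G.c2 x hx)
    have hT : ∀ j, ContDiffAt ℝ 1 (dd (e j) (t l)) x := fun j => cda1_dd _ (G.ht x hx l)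
    refine ContDiffAt.div ?_ (contDiffAt_const.mul (G.hc x hx)) (by simpa using G.hc0 x hx)
    refine ContDiffAt.sub (((hC m).mul (hT i)).add ((hC i).mul (hT m))) ?_
    exact contDiffAt_const.mul (ContDiffAt.sum fun j _ => contDiffAt_const.mul ((hC j).mul (hT j)))
  refine h1.congr_of_eventuallyEq ?_
  filter_upwards [G.hV.mem_nhds hx] with y hy
  rw [← G.koszul y hy l i m]
  have := G.hc0 y hy
  field_simp

def rh (c : E → ℝ) (x : E) : ℝ := Real.exp (-(1/2) * Real.log (c x))

lemma rh_pos (x : E) : 0 < rh c x := Real.exp_pos _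

lemma Geo.rh2 (G : Geo ε α β e V w c t) : ∀ x ∈ V, ContDiffAt ℝ 2 (rh c) x := fun x hx =>
  (contDiffAt_const.mul ((G.c2 x hx).log (G.hc0 x hx))).exp

lemma Geo.dd_log (G : Geo ε α β e V w c t) (v : E) : ∀ x ∈ V,
    dd v (fun y => Real.log (c y)) x = dd v c x / c x := fun x hx => by
  rw [dd_comp v (Real.hasDerivAt_log (G.hc0 x hx)) (cda_da1 (G.hc x hx))]
  field_simp

lemma Geo.dd_rh (G : Geo ε α β e V w c t) (v : E) : ∀ x ∈ V,
    dd v (rh c) x = -(1/2) * rh c x * (dd v c x / c x) := by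
  intro x hx
  have hl : DifferentiableAt ℝ (fun y => Real.log (c y)) x := (cda_da1 (G.hc x hx)).log (G.hc0 x hx)
  have : dd v (rh c) x = Real.exp (-(1/2) * Real.log (c x)) * dd v (fun y => -(1/2) * Real.log (c y)) x :=
    dd_comp v (Real.hasDerivAt_exp _) (hl.const_mul _)
  rw [this, dd_const_mul _ _ hl, G.dd_log v x hx]
  unfold rh; ring

lemma Geo.dd_c (G : Geo ε α β e V w c t) (v : E) : ∀ x ∈ V,
    rh c x * dd v c x = -2 * c x * dd v (rh c) x := by
  intro x hx
  have := G.hc0 x hx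
  rw [G.dd_rh v x hx]; field_simp

lemma Geo.S (G : Geo ε α β e V w c t) : ∀ x ∈ V, ∀ l i m,
    rh c x * dd (e m) (dd (e i) (t l)) x = -(dd (e i) (rh c) x * dd (e m) (t l) x +
      dd (e m) (rh c) x * dd (e i) (t l) x - gg ε i m * ∑ j, ε j * (dd (e j) (rh c) x * dd (e j) (t l) x)) := by
  intro x hx l i m
  have h := G.koszul x hx l i m
  have hc := G.hc0 x hx
  have e1 : rh c x * ∑ j, ε j * (dd (e j) c x * dd (e j) (t l) x) =
    -2 * c x * ∑ j, ε j * (dd (e j) (rh c) x * dd (e j) (t l) x) := by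
    simp only [Finset.mul_sum]
    refine Finset.sum_congr rfl fun j _ => ?_
    have := G.dd_c (e j) x hx
    linear_combination (ε j * dd (e j) (t l) x) * this
  have h2c : 2 * c x ≠ 0 := by simpa using hc
  refine mul_left_cancel₀ h2c ?_
  have ei := G.dd_c (e i) x hx
  have em := G.dd_c (e m) x hx
  linear_combination rh c x * h + dd (e i) (t l) x * em + dd (e m) (t l) x * ei - gg ε i m * e1

lemma Geo.hess (G : Geo ε α β e V w c t) : ∀ x ∈ V, ∀ i j,
    dd (e j) (dd (e i) (rh c)) x =
      (∑ k, ε k * (dd (e k) (rh c) x * dd (e k) (rh c) x)) / (2 * rh c x) * gg ε i j := by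
  intro x hx
  have hρ := (rh_pos (c := c) x).ne'
  refine hess_alg G.hn G.hε (T := fun k j => dd (e j) (t k) x) (c := c x) (G.hc0 x hx)
    (r := fun k => dd (e k) (rh c) x) (R := fun i j => dd (e j) (dd (e i) (rh c)) x)
    (P := fun l j => dd (e j) (fun y => ∑ k, ε k * (dd (e k) (rh c) y * dd (e k) (t l) y)) x)
    (G.h1 x hx) ?_ ?_
  · intro l j
    rw [dd_sum_eps ε (e j) (fun k => dd_da _ (G.rh2 x hx)) (fun k => dd_da _ (G.ht x hx l))]
    simp only [mul_add, Finset.sum_add_distrib, sub_eq_add_neg]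
    congr 1
    have e1 : ∀ k, ε k * (dd (e k) (rh c) x * dd (e j) (dd (e k) (t l)) x) =
      (1 / rh c x) * (-(ε k * (dd (e k) (rh c) x * dd (e k) (rh c) x)) * dd (e j) (t l) x -
        dd (e j) (rh c) x * (ε k * (dd (e k) (rh c) x * dd (e k) (t l) x)) +
        (ε k * (gg ε j k * dd (e k) (rh c) x)) * ∑ j, ε j * (dd (e j) (rh c) x * dd (e j) (t l) x)) := by
      intro k
      have hS := G.S x hx l k j
      rw [gg_symm] at hS
      have : dd (e j) (dd (e k) (t l)) x = (1 / rh c x) * (rh c x * dd (e j) (dd (e k) (t l)) x) := by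
        field_simp
      rw [this, hS]
      ring
    simp only [e1]
    rw [← Finset.mul_sum, Finset.sum_add_distrib, Finset.sum_sub_distrib, ← Finset.sum_mul, ← Finset.sum_mul,
      ← Finset.mul_sum, sum_gg G.hε, Finset.sum_neg_distrib]
    field_simp
    ring
  · intro l i j m
    have hd : ∀ i m j, dd (e j) (rh c) x * dd (e m) (dd (e i) (t l)) x + rh c x * dd (e j) (dd (e m) (dd (e i) (t l))) x =
      -(dd (e j) (dd (e i) (rh c)) x * dd (e m) (t l) x + dd (e i) (rh c) x * dd (e j) (dd (e m) (t l)) x +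
        (dd (e j) (dd (e m) (rh c)) x * dd (e i) (t l) x + dd (e m) (rh c) x * dd (e j) (dd (e i) (t l)) x) -
        gg ε i m * dd (e j) (fun y => ∑ k, ε k * (dd (e k) (rh c) y * dd (e k) (t l) y)) x) := by
      intro i m j
      have hr : ∀ i, DifferentiableAt ℝ (dd (e i) (rh c)) x := fun i => dd_da _ (G.rh2 x hx)
      have hT : ∀ i, DifferentiableAt ℝ (dd (e i) (t l)) x := fun i => dd_da _ (G.ht x hx l)
      have hs : DifferentiableAt ℝ (fun y => ∑ k, ε k * (dd (e k) (rh c) y * dd (e k) (t l) y)) x :=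
        DifferentiableAt.fun_sum fun k _ => ((hr k).fun_mul (hT k)).const_mul _
      have := dd_congr_on (e j) G.hV (fun y hy => G.S y hy l i m) x hx
      rw [dd_mul _ (cda_da (G.rh2 x hx)) (dd_da _ (G.t3 x hx l i)), dd_neg,
        dd_sub _ (((hr i).fun_mul (hT m)).fun_add ((hr m).fun_mul (hT i))) (hs.const_mul _),
        dd_add _ ((hr i).fun_mul (hT m)) ((hr m).fun_mul (hT i)), dd_mul _ (hr i) (hT m), dd_mul _ (hr m) (hT i),
        dd_const_mul _ _ hs] at this
      exact this
    have a1 := hd i m j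
    have a2 := hd j m i
    have cT : ∀ a b, dd (e a) (dd (e b) (t l)) x = dd (e b) (dd (e a) (t l)) x := fun a b =>
      dd_comm _ _ (G.ht x hx l)
    have cR : ∀ a b, dd (e a) (dd (e b) (rh c)) x = dd (e b) (dd (e a) (rh c)) x := fun a b =>
      dd_comm _ _ (G.rh2 x hx)
    have cTT : dd (e j) (dd (e m) (dd (e i) (t l))) x = dd (e i) (dd (e m) (dd (e j) (t l))) x := by
      have b1 := dd_congr_on (e j) G.hV (fun y hy => dd_comm (e m) (e i) (G.ht y hy l)) x hx
      have b2 := dd_congr_on (e i) G.hV (fun y hy => dd_comm (e m) (e j) (G.ht y hy l)) x hx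
      rw [b1, b2]
      exact dd_comm _ _ (G.t3 x hx l m)
    rw [cTT, cT j m, cT j i, cR j i] at a1
    rw [cT i m] at a2
    linear_combination a1 - a2

/-- the constant `μ` -/
def muf (ε : Fin n → ℝ) (e : Fin n → E) (c : E → ℝ) (x : E) : ℝ :=
  (∑ k, ε k * (dd (e k) (rh c) x * dd (e k) (rh c) x)) / (2 * rh c x)

lemma Geo.mu_diff (G : Geo ε α β e V w c t) : ∀ x ∈ V, DifferentiableAt ℝ (muf ε e c) x := by
  intro x hx
  have hr : ∀ i, DifferentiableAt ℝ (dd (e i) (rh c)) x := fun i => dd_da _ (G.rh2 x hx)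
  have hs : DifferentiableAt ℝ (fun y => ∑ k, ε k * (dd (e k) (rh c) y * dd (e k) (rh c) y)) x :=
    DifferentiableAt.fun_sum fun k _ => ((hr k).fun_mul (hr k)).const_mul _
  have h2 : 2 * rh c x ≠ 0 := by have := rh_pos (c := c) x; positivity
  have h3 : DifferentiableAt ℝ (fun y => 2 * rh c y) x := (cda_da (G.rh2 x hx)).const_mul 2
  have h4 := hs.mul (h3.inv h2)
  refine h4.congr_of_eventuallyEq (Filter.Eventually.of_forall fun y => ?_)
  simp only [muf, div_eq_mul_inv]
  rfl

lemma Geo.dd_mu (G : Geo ε α β e V w c t) (j : Fin n) : ∀ x ∈ V, dd (e j) (muf ε e c) x = 0 := by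
  intro x hx
  have hρ := (rh_pos (c := c) x).ne'
  have hr : ∀ i, DifferentiableAt ℝ (dd (e i) (rh c)) x := fun i => dd_da _ (G.rh2 x hx)
  have h0 : (fun y => muf ε e c y * (2 * rh c y)) = fun y => ∑ k, ε k * (dd (e k) (rh c) y * dd (e k) (rh c) y) := by
    ext y
    have := (rh_pos (c := c) y).ne'
    unfold muf; field_simp
  have h1 : dd (e j) (fun y => muf ε e c y * (2 * rh c y)) x =
      ∑ k, ε k * (dd (e j) (dd (e k) (rh c)) x * dd (e k) (rh c) x +
        dd (e k) (rh c) x * dd (e j) (dd (e k) (rh c)) x) := by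
    rw [h0]; exact dd_sum_eps ε (e j) hr hr
  rw [dd_mul _ (G.mu_diff x hx) ((cda_da (G.rh2 x hx)).const_mul 2), dd_const_mul _ _ (cda_da (G.rh2 x hx))] at h1
  have h2 : ∀ i, dd (e j) (dd (e i) (rh c)) x = muf ε e c x * gg ε i j := fun i => G.hess x hx i j
  have h3 : ∑ k, ε k * (dd (e j) (dd (e k) (rh c)) x * dd (e k) (rh c) x + dd (e k) (rh c) x * dd (e j) (dd (e k) (rh c)) x)
     = 2 * muf ε e c x * ∑ k, ε k * (gg ε j k * dd (e k) (rh c) x) := by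
    rw [Finset.mul_sum]
    refine Finset.sum_congr rfl fun k _ => ?_
    rw [h2 k, gg_symm k j]; ring
  rw [h3, sum_gg G.hε] at h1
  have h4 : dd (e j) (muf ε e c) x * (2 * rh c x) = 0 := by linear_combination h1
  exact (mul_eq_zero.1 h4).resolve_right (by simpa using hρ)

lemma Geo.hess' (G : Geo ε α β e V w c t) : ∀ x ∈ V, ∀ i j,
    dd (e j) (dd (e i) (rh c)) x = muf ε e c x * gg ε i j := G.hess

end geo

section glob
variable {n ℓ : ℕ} {B N : Matrix (Fin n) (Fin n) ℝ} {b : Fin n → ℝ} {e : Fin n → Fin n → ℝ}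
  {ε α β : Fin n → ℝ} {V : Set (Fin n → ℝ)} {w c : (Fin n → ℝ) → ℝ} {t : Fin n → (Fin n → ℝ) → ℝ}

lemma const_of_dd (H' : DiagData n ℓ B N b e β) (hV : IsOpen V) (hVc : IsPreconnected V)
    {f : (Fin n → ℝ) → ℝ} (hf : ∀ x ∈ V, DifferentiableAt ℝ f x)
    (h0 : ∀ x ∈ V, ∀ i, dd (e i) f x = 0) : ∀ x ∈ V, ∀ y ∈ V, f x = f y := by
  intro x hx y hy
  refine hV.is_const_of_fderiv_eq_zero (𝕜 := ℝ) hVc (fun z hz => (hf z hz).differentiableWithinAt) ?_ hx hy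
  intro z hz
  ext1 v
  have h1 : fderiv ℝ f z v = ∑ k, (Nᵀ.mulVec v) k * dd (e k) f z := by
    conv_lhs => rw [H'.hrec v]
    simp [dd]
  rw [h1]
  simp [h0 z hz]

lemma Fc_da (N : Matrix (Fin n) (Fin n) ℝ) (k : Fin n) (x : Fin n → ℝ) : DifferentiableAt ℝ (Fc N k) x :=
  (Fc_contDiff (m := 1) N k).contDiffAt.differentiableAt (by norm_num)

lemma Geo.rh_bdd (H' : DiagData n ℓ B N b e β) (G : Geo (epsl n ℓ) α β e V w c t)
    (hVc : IsPreconnected V) (hVb : Bornology.IsBounded V) : ∃ C, ∀ x ∈ V, rh c x ≤ C := by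
  rcases V.eq_empty_or_nonempty with h | ⟨x0, hx0⟩
  · exact ⟨0, by simp [h]⟩
  set μ := muf (epsl n ℓ) e c x0 with hμ
  have hmu : ∀ x ∈ V, muf (epsl n ℓ) e c x = μ := fun x hx =>
    const_of_dd H' G.hV hVc G.mu_diff (fun x hx i => G.dd_mu i x hx) x hx x0 hx0
  have hr1 : ∀ i, ∀ x ∈ V, DifferentiableAt ℝ (dd (e i) (rh c)) x := fun i x hx => dd_da _ (G.rh2 x hx)
  have hk : ∀ i, ∀ x ∈ V, ∀ y ∈ V, dd (e i) (rh c) x - μ * epsl n ℓ i * Fc N i x =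
      dd (e i) (rh c) y - μ * epsl n ℓ i * Fc N i y := by
    intro i
    refine const_of_dd H' G.hV hVc (fun x hx => (hr1 i x hx).fun_sub ((Fc_da N i x).const_mul _)) ?_
    intro x hx j
    rw [dd_sub _ (hr1 i x hx) ((Fc_da N i x).const_mul _), dd_const_mul _ _ (Fc_da N i x), G.hess' x hx i j,
      hmu x hx, H'.dd_Fc j i x, gg]
    split_ifs <;> ring
  set κ : Fin n → ℝ := fun i => dd (e i) (rh c) x0 - μ * epsl n ℓ i * Fc N i x0 with hκ
  have hr : ∀ i, ∀ x ∈ V, dd (e i) (rh c) x = μ * epsl n ℓ i * Fc N i x + κ i := by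
    intro i x hx
    have := hk i x hx x0 hx0
    simp only [hκ]; linarith
  set q : (Fin n → ℝ) → ℝ := fun x => ∑ i, (μ / 2 * epsl n ℓ i * (Fc N i x * Fc N i x) + κ i * Fc N i x) with hq
  have hqd : ∀ x, ∀ j, DifferentiableAt ℝ q x ∧ dd (e j) q x = μ * epsl n ℓ j * Fc N j x + κ j := by
    intro x j
    have h1 : ∀ i, DifferentiableAt ℝ (fun x => μ / 2 * epsl n ℓ i * (Fc N i x * Fc N i x)) x := fun i =>
      ((Fc_da N i x).fun_mul (Fc_da N i x)).const_mul _
    have h2 : ∀ i, DifferentiableAt ℝ (fun x => κ i * Fc N i x) x := fun i => (Fc_da N i x).const_mul _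
    refine ⟨DifferentiableAt.fun_sum fun i _ => (h1 i).fun_add (h2 i), ?_⟩
    rw [hq, dd_sum _ _ (fun i _ => (h1 i).fun_add (h2 i))]
    have h3 : ∀ i, dd (e j) (fun x => μ / 2 * epsl n ℓ i * (Fc N i x * Fc N i x) + κ i * Fc N i x) x =
        if i = j then μ * epsl n ℓ j * Fc N j x + κ j else 0 := by
      intro i
      rw [dd_add _ (h1 i) (h2 i), dd_const_mul _ _ ((Fc_da N i x).fun_mul (Fc_da N i x)),
        dd_const_mul _ _ (Fc_da N i x), dd_mul _ (Fc_da N i x) (Fc_da N i x), H'.dd_Fc j i x]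
      split_ifs with h
      · subst h; ring
      · ring
    simp [h3]
  have hfin : ∀ x ∈ V, ∀ y ∈ V, rh c x - q x = rh c y - q y := by
    refine const_of_dd H' G.hV hVc (fun x hx => (cda_da (G.rh2 x hx)).fun_sub (hqd x ⟨0, by have := G.hn; omega⟩).1) ?_
    intro x hx j
    rw [dd_sub _ (cda_da (G.rh2 x hx)) (hqd x j).1, (hqd x j).2, hr j x hx]; ring
  have hqc : Continuous q := by
    have : ∀ i, Continuous (Fc N i) := fun i => (Fc_contDiff (m := 1) N i).continuous
    refine continuous_finsetSum _ fun i _ => ?_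
    exact (continuous_const.mul ((this i).mul (this i))).add (continuous_const.mul (this i))
  obtain ⟨C, hC⟩ := (hVb.isCompact_closure.image hqc).bddAbove
  refine ⟨C + (rh c x0 - q x0), fun x hx => ?_⟩
  have h1 := hC ⟨x, subset_closure hx, rfl⟩
  have h2 := hfin x hx x0 hx0
  linarith

lemma Geo.lower (H' : DiagData n ℓ B N b e β) (G : Geo (epsl n ℓ) α β e V w c t)
    (hVc : IsPreconnected V) (hVb : Bornology.IsBounded V) (htb : ∃ C, ∀ x ∈ V, ∀ k, |t k x| ≤ C) :
    ∃ δ > 0, ∀ x ∈ V, δ ≤ |w x| ∧ δ ≤ |c x| := by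
  rcases V.eq_empty_or_nonempty with h | ⟨x0, hx0⟩
  · exact ⟨1, one_pos, by simp [h]⟩
  obtain ⟨C, hC⟩ := G.rh_bdd H' hVc hVb
  obtain ⟨D, hD⟩ := htb
  have hn : (3:ℝ) ≤ n := by exact_mod_cast G.hn
  have hC0 : 0 < C := (rh_pos x0).trans_le (hC x0 hx0)
  have hlc : ∀ x ∈ V, -2 * Real.log C ≤ Real.log (c x) := by
    intro x hx
    have h1 := hC x hx
    unfold rh at h1
    rw [← Real.le_log_iff_exp_le hC0] at h1
    linarith
  set Φ : (Fin n → ℝ) → ℝ := fun x => (2 * Real.log (w x) - (n - 2) / 2 * Real.log (c x)) +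
    (∑ j, epsl n ℓ j * β j * Fc N j x - ∑ k, epsl n ℓ k * α k * t k x) with hΦ
  have hconst : ∀ x ∈ V, ∀ y ∈ V, Φ x = Φ y := by
    have d1 : ∀ x ∈ V, DifferentiableAt ℝ (fun x => Real.log (w x)) x := fun x hx => (cda_da (G.hw x hx)).log (G.hw0 x hx)
    have d2 : ∀ x ∈ V, DifferentiableAt ℝ (fun x => Real.log (c x)) x := fun x hx => (cda_da1 (G.hc x hx)).log (G.hc0 x hx)
    have d3 : ∀ x ∈ V, ∀ j, DifferentiableAt ℝ (fun x => epsl n ℓ j * β j * Fc N j x) x := fun x hx j => (Fc_da N j x).const_mul _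
    have d4 : ∀ x ∈ V, ∀ j, DifferentiableAt ℝ (fun x => epsl n ℓ j * α j * t j x) x := fun x hx j => (cda_da (G.ht x hx j)).const_mul _
    have d12 : ∀ x ∈ V, DifferentiableAt ℝ (fun x => 2 * Real.log (w x) - (n - 2) / 2 * Real.log (c x)) x := fun x hx =>
      ((d1 x hx).const_mul _).fun_sub ((d2 x hx).const_mul _)
    have d3' : ∀ x ∈ V, DifferentiableAt ℝ (fun x => ∑ j, epsl n ℓ j * β j * Fc N j x) x := fun x hx =>
      DifferentiableAt.fun_sum fun j _ => d3 x hx j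
    have d4' : ∀ x ∈ V, DifferentiableAt ℝ (fun x => ∑ j, epsl n ℓ j * α j * t j x) x := fun x hx =>
      DifferentiableAt.fun_sum fun j _ => d4 x hx j
    refine const_of_dd H' G.hV hVc (fun x hx => (d12 x hx).fun_add ((d3' x hx).fun_sub (d4' x hx))) ?_
    intro x hx j
    have e1 : dd (e j) (fun x => Real.log (w x)) x = dd (e j) w x / w x := by
      rw [dd_comp _ (Real.hasDerivAt_log (G.hw0 x hx)) (cda_da (G.hw x hx))]; field_simp
    have e3 : dd (e j) (fun x => ∑ j, epsl n ℓ j * β j * Fc N j x) x = epsl n ℓ j * β j := by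
      rw [dd_sum _ _ (fun j _ => d3 x hx j)]
      have : ∀ i, dd (e j) (fun x => epsl n ℓ i * β i * Fc N i x) x = if i = j then epsl n ℓ i * β i else 0 := by
        intro i
        rw [dd_const_mul _ _ (Fc_da N i x), H'.dd_Fc j i x]; split_ifs <;> ring
      simp [this]
    have e4 : dd (e j) (fun x => ∑ j, epsl n ℓ j * α j * t j x) x = ∑ l, epsl n ℓ l * (α l * dd (e j) (t l) x) := by
      rw [dd_sum _ _ (fun j _ => d4 x hx j)]
      refine Finset.sum_congr rfl fun l _ => ?_
      rw [dd_const_mul _ _ (cda_da (G.ht x hx l))]; ring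
    have hg := G.grad x hx j
    rw [hΦ, dd_add _ (d12 x hx) ((d3' x hx).fun_sub (d4' x hx)), dd_sub _ (d3' x hx) (d4' x hx),
      dd_sub _ ((d1 x hx).const_mul _) ((d2 x hx).const_mul _), dd_const_mul _ _ (d1 x hx), dd_const_mul _ _ (d2 x hx),
      e1, e3, e4, G.dd_log _ x hx]
    rw [← hg]; ring
  set qf : (Fin n → ℝ) → ℝ := fun x => ∑ j, epsl n ℓ j * β j * Fc N j x with hqf
  have hqc : Continuous qf := by
    have : ∀ i, Continuous (Fc N i) := fun i => (Fc_contDiff (m := 1) N i).continuous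
    exact continuous_finsetSum _ fun i _ => continuous_const.mul (this i)
  obtain ⟨C2, hC2⟩ := (hVb.isCompact_closure.image hqc).bddAbove
  have hts : ∀ x ∈ V, -(∑ k, |epsl n ℓ k * α k| * D) ≤ ∑ k, epsl n ℓ k * α k * t k x := by
    intro x hx
    rw [← Finset.sum_neg_distrib]
    refine Finset.sum_le_sum fun k _ => ?_
    have h1 : |epsl n ℓ k * α k * t k x| ≤ |epsl n ℓ k * α k| * D := by
      rw [abs_mul]; exact mul_le_mul_of_nonneg_left (hD x hx k) (abs_nonneg _)
    exact (abs_le.1 h1).1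
  set S := ∑ k, |epsl n ℓ k * α k| * D
  set K := (Φ x0 + (n - 2) / 2 * (-2 * Real.log C) - C2 - S) / 2 with hK
  have hlw : ∀ x ∈ V, K ≤ Real.log (w x) := by
    intro x hx
    have h1 := hconst x hx x0 hx0
    have h2 := hts x hx
    have h3 := hC2 ⟨x, subset_closure hx, rfl⟩
    have h4 : ((n:ℝ) - 2) / 2 * (-2 * Real.log C) ≤ (n - 2) / 2 * Real.log (c x) :=
      mul_le_mul_of_nonneg_left (hlc x hx) (by linarith)
    have h5 : Φ x = (2 * Real.log (w x) - (n - 2) / 2 * Real.log (c x)) +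
      (qf x - ∑ k, epsl n ℓ k * α k * t k x) := rfl
    rw [hK]
    linarith
  refine ⟨min (Real.exp K) (Real.exp (-2 * Real.log C)), lt_min (Real.exp_pos _) (Real.exp_pos _), fun x hx => ⟨?_, ?_⟩⟩
  · refine (min_le_left _ _).trans ?_
    rw [← Real.exp_log_eq_abs (G.hw0 x hx)]
    exact Real.exp_le_exp.2 (hlw x hx)
  · refine (min_le_right _ _).trans ?_
    rw [← Real.exp_log_eq_abs (G.hc0 x hx)]
    exact Real.exp_le_exp.2 (hlc x hx)
end glob

section inj
variable {E : Type*} [NormedAddCommGroup E] [NormedSpace ℝ E] {n : ℕ}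
variable {ε α β : Fin n → ℝ} {e : Fin n → E} {V : Set E} {w c : E → ℝ} {t : Fin n → E → ℝ}

lemma Geo.hessSum (G : Geo ε α β e V w c t) (a : Fin n → ℝ) : ∀ x ∈ V, ∀ i j,
    rh c x * ∑ l, ε l * (a l * dd (e j) (dd (e i) (t l)) x) =
      -(dd (e i) (rh c) x * (∑ l, ε l * (a l * dd (e j) (t l) x)) +
        dd (e j) (rh c) x * (∑ l, ε l * (a l * dd (e i) (t l) x)) -
        gg ε i j * ∑ k, ε k * (dd (e k) (rh c) x * ∑ l, ε l * (a l * dd (e k) (t l) x))) := by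
  intro x hx i j
  have h1 : ∑ k, ε k * (dd (e k) (rh c) x * ∑ l, ε l * (a l * dd (e k) (t l) x)) =
      ∑ l, ε l * (a l * ∑ k, ε k * (dd (e k) (rh c) x * dd (e k) (t l) x)) := by
    simp only [Finset.mul_sum]
    rw [Finset.sum_comm]
    refine Finset.sum_congr rfl fun l _ => Finset.sum_congr rfl fun k _ => ?_
    ring
  rw [h1]
  simp only [Finset.mul_sum (s := Finset.univ) (a := rh c x), Finset.mul_sum (s := Finset.univ) (a := dd (e i) (rh c) x),
    Finset.mul_sum (s := Finset.univ) (a := dd (e j) (rh c) x), Finset.mul_sum (s := Finset.univ) (a := gg ε i j)]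
  rw [← Finset.sum_add_distrib, ← Finset.sum_sub_distrib, ← Finset.sum_neg_distrib]
  refine Finset.sum_congr rfl fun l _ => ?_
  have := G.S x hx l i j
  linear_combination (ε l * a l) * this

def QQ (ε : Fin n → ℝ) (t : Fin n → E → ℝ) (z : Fin n → ℝ) (x : E) : ℝ :=
  ∑ k, ε k * ((t k x - z k) * (t k x - z k))

lemma Geo.QQ2 (G : Geo ε α β e V w c t) (z : Fin n → ℝ) : ∀ x ∈ V, ContDiffAt ℝ 2 (QQ ε t z) x := fun x hx =>
  ContDiffAt.sum fun k _ => contDiffAt_const.mul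
    (((G.ht x hx k).sub contDiffAt_const).mul ((G.ht x hx k).sub contDiffAt_const))

lemma Geo.dt (G : Geo ε α β e V w c t) (z : Fin n → ℝ) (v : E) (k : Fin n) : ∀ x ∈ V,
    DifferentiableAt ℝ (fun x => t k x - z k) x ∧ dd v (fun x => t k x - z k) x = dd v (t k) x := fun x hx =>
  ⟨(cda_da (G.ht x hx k)).fun_sub (differentiableAt_const _), by
    rw [dd_sub _ (cda_da (G.ht x hx k)) (differentiableAt_const _), dd_const, sub_zero]⟩

lemma Geo.dQ (G : Geo ε α β e V w c t) (z : Fin n → ℝ) (i : Fin n) : ∀ x ∈ V,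
    dd (e i) (QQ ε t z) x = 2 * ∑ l, ε l * ((t l x - z l) * dd (e i) (t l) x) := by
  intro x hx
  have := dd_sum_eps ε (e i) (fun k => (G.dt z (e i) k x hx).1) (fun k => (G.dt z (e i) k x hx).1)
  unfold QQ
  rw [this, Finset.mul_sum]
  refine Finset.sum_congr rfl fun l _ => ?_
  rw [(G.dt z (e i) l x hx).2]; ring

lemma Geo.ddQ (G : Geo ε α β e V w c t) (z : Fin n → ℝ) : ∀ x ∈ V, ∀ i j,
    rh c x * dd (e j) (dd (e i) (QQ ε t z)) x = 2 * c x * rh c x * gg ε i j -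
      (dd (e i) (rh c) x * dd (e j) (QQ ε t z) x + dd (e j) (rh c) x * dd (e i) (QQ ε t z) x -
        gg ε i j * ∑ k, ε k * (dd (e k) (rh c) x * dd (e k) (QQ ε t z) x)) := by
  intro x hx i j
  have hT : ∀ l, DifferentiableAt ℝ (dd (e i) (t l)) x := fun l => dd_da _ (G.ht x hx l)
  have h1 := dd_congr_on (e j) G.hV (fun y hy => G.dQ z i y hy) x hx
  have hs : DifferentiableAt ℝ (fun x => ∑ l, ε l * ((t l x - z l) * dd (e i) (t l) x)) x :=
    DifferentiableAt.fun_sum fun l _ => ((G.dt z (e j) l x hx).1.fun_mul (hT l)).const_mul _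
  rw [dd_const_mul _ _ hs, dd_sum_eps ε (e j) (fun k => (G.dt z (e j) k x hx).1) hT] at h1
  simp only [(G.dt z (e j) _ x hx).2, mul_add, Finset.sum_add_distrib] at h1
  have h2 : ∑ l, ε l * (dd (e j) (t l) x * dd (e i) (t l) x) = c x * gg ε i j := by
    rw [G.h1' x hx j i, gg_symm]
  rw [h2] at h1
  have h3 := G.hessSum (fun l => t l x - z l) x hx i j
  have h4 : ∑ k, ε k * (dd (e k) (rh c) x * dd (e k) (QQ ε t z) x) =
    2 * ∑ k, ε k * (dd (e k) (rh c) x * ∑ l, ε l * ((t l x - z l) * dd (e k) (t l) x)) := by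
    rw [Finset.mul_sum]
    refine Finset.sum_congr rfl fun k _ => ?_
    rw [G.dQ z k x hx]; ring
  rw [h1, h4, G.dQ z i x hx, G.dQ z j x hx]
  linear_combination 2 * h3

def nuf (ε : Fin n → ℝ) (e : Fin n → E) (c : E → ℝ) (t : Fin n → E → ℝ) (z : Fin n → ℝ) (x : E) : ℝ :=
  muf ε e c x * QQ ε t z x + (∑ k, ε k * (dd (e k) (rh c) x * dd (e k) (QQ ε t z) x) + 2 * (c x * rh c x))

lemma Geo.mu_rr (G : Geo ε α β e V w c t) : ∀ x ∈ V,
    ∑ k, ε k * (dd (e k) (rh c) x * dd (e k) (rh c) x) = 2 * muf ε e c x * rh c x := by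
  intro x hx
  have := (rh_pos (c := c) x).ne'
  unfold muf; field_simp

lemma Geo.nu_diff (G : Geo ε α β e V w c t) (z : Fin n → ℝ) : ∀ x ∈ V,
    DifferentiableAt ℝ (nuf ε e c t z) x ∧ ∀ j, dd (e j) (nuf ε e c t z) x = 0 := by
  intro x hx
  have hρ := (rh_pos (c := c) x).ne'
  have dρ := cda_da (G.rh2 x hx)
  have dQ := cda_da (G.QQ2 z x hx)
  have dc := cda_da1 (G.hc x hx)
  have hr : ∀ i, DifferentiableAt ℝ (dd (e i) (rh c)) x := fun i => dd_da _ (G.rh2 x hx)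
  have hQ : ∀ i, DifferentiableAt ℝ (dd (e i) (QQ ε t z)) x := fun i => dd_da _ (G.QQ2 z x hx)
  have d1 := (G.mu_diff x hx).fun_mul dQ
  have d2 : DifferentiableAt ℝ (fun x => ∑ k, ε k * (dd (e k) (rh c) x * dd (e k) (QQ ε t z) x)) x :=
    DifferentiableAt.fun_sum fun k _ => ((hr k).fun_mul (hQ k)).const_mul _
  have d3 : DifferentiableAt ℝ (fun x => 2 * (c x * rh c x)) x := (dc.fun_mul dρ).const_mul _
  refine ⟨d1.fun_add (d2.fun_add d3), fun j => ?_⟩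
  unfold nuf
  rw [dd_add _ d1 (d2.fun_add d3), dd_add _ d2 d3, dd_mul _ (G.mu_diff x hx) dQ, dd_const_mul _ _ (dc.fun_mul dρ),
    dd_mul _ dc dρ, dd_sum_eps ε (e j) hr hQ, G.dd_mu j x hx]
  have s1 : rh c x * ∑ k, ε k * (dd (e j) (dd (e k) (rh c)) x * dd (e k) (QQ ε t z) x +
      dd (e k) (rh c) x * dd (e j) (dd (e k) (QQ ε t z)) x) =
      rh c x * muf ε e c x * ∑ k, ε k * (gg ε j k * dd (e k) (QQ ε t z) x) +
      (2 * c x * rh c x + ∑ k, ε k * (dd (e k) (rh c) x * dd (e k) (QQ ε t z) x)) *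
        (∑ k, ε k * (gg ε j k * dd (e k) (rh c) x)) -
      dd (e j) (QQ ε t z) x * ∑ k, ε k * (dd (e k) (rh c) x * dd (e k) (rh c) x) -
      dd (e j) (rh c) x * ∑ k, ε k * (dd (e k) (rh c) x * dd (e k) (QQ ε t z) x) := by
    set P := ∑ k, ε k * (dd (e k) (rh c) x * dd (e k) (QQ ε t z) x) with hP
    conv_rhs => rw [hP]
    rw [← hP]
    conv_rhs => rw [hP]
    rw [← hP]
    have : dd (e j) (rh c) x * P = ∑ k, dd (e j) (rh c) x * (ε k * (dd (e k) (rh c) x * dd (e k) (QQ ε t z) x)) := by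
      rw [hP, Finset.mul_sum]
    rw [this]
    rw [Finset.mul_sum (a := rh c x), Finset.mul_sum (a := rh c x * muf ε e c x), Finset.mul_sum (a := 2 * c x * rh c x + P),
      Finset.mul_sum (a := dd (e j) (QQ ε t z) x),
      ← Finset.sum_add_distrib, ← Finset.sum_sub_distrib, ← Finset.sum_sub_distrib]
    refine Finset.sum_congr rfl fun k _ => ?_
    have a1 := G.hess' x hx k j
    have a2 := G.ddQ z x hx k j
    rw [← hP, gg_symm k j] at a2
    rw [gg_symm k j] at a1
    linear_combination rh c x * ε k * dd (e k) (QQ ε t z) x * a1 + ε k * dd (e k) (rh c) x * a2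
  rw [sum_gg G.hε, sum_gg G.hε, G.mu_rr x hx] at s1
  have s2 := G.dd_c (e j) x hx
  refine mul_left_cancel₀ hρ ?_
  linear_combination s1 + 2 * rh c x * s2

lemma alg_rank1 (hn : 2 ≤ n) (hε : ∀ k, ε k * ε k = 1) {ρ s : ℝ} (hρ : ρ ≠ 0) {u : Fin n → ℝ}
    (h : ∀ i j, ρ * (u i * u j) = s * gg ε i j) : ∀ i, u i = 0 := by
  intro i
  by_contra hi
  have : ∃ j : Fin n, j ≠ i := by
    by_cases h0 : i = ⟨0, by omega⟩
    · exact ⟨⟨1, by omega⟩, by rw [h0]; simp⟩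
    · exact ⟨⟨0, by omega⟩, fun h => h0 h.symm⟩
  obtain ⟨j, hj⟩ := this
  have h1 := h j i
  rw [gg_ne hj, mul_zero] at h1
  have h2 : u j = 0 := by
    rcases mul_eq_zero.1 h1 with h | h
    · exact absurd h hρ
    · exact (mul_eq_zero.1 h).resolve_right hi
  have h3 := h j j
  rw [h2, gg_self] at h3
  have h4 : s = 0 := by linear_combination (-ε j) * h3 - s * hε j
  have h5 := h i i
  rw [h4] at h5
  have : ρ * (u i * u i) = 0 := by linear_combination h5
  simp [hρ, hi] at this

lemma Geo.final (G : Geo ε α β e V w c t) (hne : V.Nonempty) (p : ℝ)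
    (hrel : ∀ x ∈ V, ∀ i, 2 * dd (e i) w x / w x = n / p * (dd (e i) c x / c x)) :
    ((∀ k, α k = 0) → ∀ k, β k = 0) ∧ ((∀ k, β k = 0) → ∀ k, α k = 0) := by
  set κ : ℝ := n / p - (n - 2) / 2 with hκ
  obtain ⟨x, hx⟩ := hne
  have hρ := (rh_pos (c := c) x).ne'
  have key : ∀ x ∈ V, ∀ i, rh c x * (ε i * β i) - 2 * κ * dd (e i) (rh c) x =
      rh c x * ∑ l, ε l * (α l * dd (e i) (t l) x) := by
    intro x hx i
    have h1 := G.grad x hx i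
    rw [hrel x hx i] at h1
    have h2 := G.dd_rh (e i) x hx
    rw [h2]
    rw [← h1, hκ]; ring
  have hr : ∀ i, DifferentiableAt ℝ (dd (e i) (rh c)) x := fun i => dd_da _ (G.rh2 x hx)
  have dρ := cda_da (G.rh2 x hx)
  constructor
  · intro hα
    have k1 : ∀ x ∈ V, ∀ i, rh c x * (ε i * β i) = 2 * κ * dd (e i) (rh c) x := by
      intro x hx i
      have := key x hx i
      simp only [hα, zero_mul, mul_zero, Finset.sum_const_zero] at this
      linarith
    have k2 : ∀ i j, rh c x * ((ε i * β i) * (ε j * β j)) = (4 * κ * κ * muf ε e c x) * gg ε i j := by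
      intro i j
      have h := dd_congr_on (e j) G.hV (fun y hy => k1 y hy i) x hx
      rw [dd_mul_const _ _ dρ, dd_const_mul _ _ (hr i), G.hess' x hx] at h
      have h2 := k1 x hx j
      linear_combination (2 * κ) * h + ε i * β i * h2
    have k3 := alg_rank1 (by have := G.hn; omega) G.hε hρ (u := fun i => ε i * β i) k2
    intro k
    have := k3 k
    linear_combination ε k * this - β k * G.hε k
  · intro hβ
    set φ : Fin n → E → ℝ := fun i x => ∑ l, ε l * (α l * dd (e i) (t l) x) with hφ
    have k1 : ∀ x ∈ V, ∀ i, rh c x * φ i x = (-2 * κ) * dd (e i) (rh c) x := by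
      intro x hx i
      have := key x hx i
      simp only [hβ] at this
      rw [hφ]
      linear_combination -this
    have hT : ∀ i l, DifferentiableAt ℝ (dd (e i) (t l)) x := fun i l => dd_da _ (G.ht x hx l)
    have dφ : ∀ i, DifferentiableAt ℝ (φ i) x := fun i => DifferentiableAt.fun_sum fun l _ =>
      ((hT i l).const_mul _).const_mul _
    have ddφ : ∀ i j, dd (e j) (φ i) x = ∑ l, ε l * (α l * dd (e j) (dd (e i) (t l)) x) := by
      intro i j
      rw [hφ, dd_sum _ _ (fun l _ => ((hT i l).const_mul _).const_mul _)]
      refine Finset.sum_congr rfl fun l _ => ?_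
      rw [dd_const_mul _ _ ((hT i l).const_mul _), dd_const_mul _ _ (hT i l)]
    have k2 : ∀ i j, rh c x * (φ i x * φ j x) =
        (2 * κ * (-2 * κ * muf ε e c x - ∑ k, ε k * (dd (e k) (rh c) x * φ k x))) * gg ε i j := by
      intro i j
      have h := dd_congr_on (e j) G.hV (fun y hy => k1 y hy i) x hx
      rw [dd_mul _ dρ (dφ i), dd_const_mul _ _ (hr i), G.hess' x hx, ddφ, G.hessSum α x hx i j] at h
      have h2 := k1 x hx i
      change dd (e j) (rh c) x * φ i x + -(dd (e i) (rh c) x * φ j x + dd (e j) (rh c) x * φ i x -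
        gg ε i j * ∑ k, ε k * (dd (e k) (rh c) x * φ k x)) = _ at h
      linear_combination (2 * κ) * h + φ j x * h2
    have k3 := alg_rank1 (by have := G.hn; omega) G.hε hρ (u := fun i => φ i x) k2
    intro l
    have h1 := pairing G.hε (G.h1 x hx) α l
    have h2 : ∀ j, ∑ k, ε k * (α k * dd (e j) (t k) x) = 0 := fun j => k3 j
    simp only [h2, mul_zero, Finset.sum_const_zero] at h1
    exact (mul_eq_zero.1 h1.symm).resolve_left (G.hc0 x hx)

end inj

lemma Geo.inj {n ℓ : ℕ} {B N : Matrix (Fin n) (Fin n) ℝ} {b : Fin n → ℝ} {e : Fin n → Fin n → ℝ}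
    {α β : Fin n → ℝ} {V : Set (Fin n → ℝ)} {w c : (Fin n → ℝ) → ℝ} {t : Fin n → (Fin n → ℝ) → ℝ}
    (H' : DiagData n ℓ B N b e β) (G : Geo (epsl n ℓ) α β e V w c t)
    (hVc : IsPreconnected V) {x0 y0 : Fin n → ℝ} (hx0 : x0 ∈ V) (hy0 : y0 ∈ V)
    (h : ∀ k, t k x0 = t k y0) : ∀ i, Fc N i x0 = Fc N i y0 := by
  set z : Fin n → ℝ := fun k => t k x0 with hz
  set ν := nuf (epsl n ℓ) e c t z x0 with hν
  have hQ0 : QQ (epsl n ℓ) t z x0 = 0 := by simp [QQ, hz]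
  have hQ1 : QQ (epsl n ℓ) t z y0 = 0 := by simp [QQ, hz, h]
  have hdQ0 : ∀ i, dd (e i) (QQ (epsl n ℓ) t z) x0 = 0 := fun i => by rw [G.dQ z i x0 hx0]; simp [hz]
  have hdQ1 : ∀ i, dd (e i) (QQ (epsl n ℓ) t z) y0 = 0 := fun i => by rw [G.dQ z i y0 hy0]; simp [hz, h]
  have hν0 : ν ≠ 0 := by
    rw [hν]; unfold nuf
    simp [hQ0, hdQ0, G.hc0 x0 hx0, (rh_pos (c := c) x0).ne']
  have hνc : ∀ x ∈ V, nuf (epsl n ℓ) e c t z x = ν := fun x hx =>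
    const_of_dd H' G.hV hVc (fun x hx => (G.nu_diff z x hx).1) (fun x hx i => (G.nu_diff z x hx).2 i) x hx x0 hx0
  intro i
  have hc := const_of_dd H' G.hV hVc (f := fun x => (dd (e i) (rh c) x * QQ (epsl n ℓ) t z x +
    rh c x * dd (e i) (QQ (epsl n ℓ) t z) x) - ν * epsl n ℓ i * Fc N i x) ?_ ?_ x0 hx0 y0 hy0
  · simp only [hQ0, hQ1, hdQ0, hdQ1, mul_zero, add_zero, zero_sub, neg_inj] at hc
    refine mul_left_cancel₀ (mul_ne_zero hν0 ?_) hc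
    intro h0
    have := epsl_sq n ℓ i
    rw [h0] at this; norm_num at this
  · intro x hx
    exact (((dd_da _ (G.rh2 x hx)).fun_mul (cda_da (G.QQ2 z x hx))).fun_add
      ((cda_da (G.rh2 x hx)).fun_mul (dd_da _ (G.QQ2 z x hx)))).fun_sub ((Fc_da N i x).const_mul _)
  · intro x hx j
    have d1 := dd_da (e i) (G.rh2 x hx)
    have d2 := cda_da (G.QQ2 z x hx)
    have d3 := cda_da (G.rh2 x hx)
    have d4 := dd_da (e i) (G.QQ2 z x hx)
    rw [dd_sub _ ((d1.fun_mul d2).fun_add (d3.fun_mul d4)) ((Fc_da N i x).const_mul _),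
      dd_add _ (d1.fun_mul d2) (d3.fun_mul d4), dd_mul _ d1 d2, dd_mul _ d3 d4, dd_const_mul _ _ (Fc_da N i x),
      G.ddQ z x hx i j, G.hess' x hx i j, H'.dd_Fc j i x]
    have h5 := hνc x hx
    unfold nuf at h5
    have h6 : ν * epsl n ℓ i * (if i = j then (1:ℝ) else 0) = ν * gg (epsl n ℓ) i j := by
      unfold gg; split_ifs <;> ring
    rw [h6, ← h5]
    ring

section taumap
variable {n ℓ : ℕ} {A M : Matrix (Fin n) (Fin n) ℝ} {a : Fin n → ℝ} {d : Fin n → Fin n → ℝ} {α : Fin n → ℝ}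
    {B N : Matrix (Fin n) (Fin n) ℝ} {b : Fin n → ℝ} {e : Fin n → Fin n → ℝ} {β : Fin n → ℝ}
    {τ : (Fin n → ℝ) → (Fin n → ℝ)}

lemma tau_c2 (H : DiagData n ℓ A M a d α) {x : Fin n → ℝ}
    (ht : ∀ k, ContDiffAt ℝ 2 (fun x => Fc M k (τ x)) x) : ContDiffAt ℝ 2 τ x := by
  have h : τ = fun y => ∑ k, Fc M k (τ y) • d k := funext fun y => H.hrec (τ y)
  rw [h]
  exact ContDiffAt.sum fun k _ => (ht k).smul contDiffAt_const

lemma dd_FcTau {x v : Fin n → ℝ} (hτ : DifferentiableAt ℝ τ x) (k : Fin n) :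
    dd v (fun x => Fc M k (τ x)) x = Fc M k (fderiv ℝ τ x v) := by
  have h1 : HasFDerivAt (Fc M k) (fderiv ℝ (Fc M k) (τ x)) (τ x) := (Fc_da M k (τ x)).hasFDerivAt
  have h2 := (h1.comp x hτ.hasFDerivAt).fderiv
  have h3 : fderiv ℝ (fun x => Fc M k (τ x)) x = (fderiv ℝ (Fc M k) (τ x)).comp (fderiv ℝ τ x) := h2
  unfold dd
  rw [h3]
  exact dd_Fc M k _ _

lemma det_sq (H : DiagData n ℓ A M a d α) (H' : DiagData n ℓ B N b e β) {x : Fin n → ℝ} {c0 : ℝ}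
    (ht : ∀ k, ContDiffAt ℝ 2 (fun x => Fc M k (τ x)) x)
    (h1 : ∀ k l, ∑ j, epsl n ℓ j * (dd (e j) (fun x => Fc M k (τ x)) x * dd (e j) (fun x => Fc M l (τ x)) x) =
      c0 * gg (epsl n ℓ) k l) :
    (fderiv ℝ τ x).det ^ 2 = (N.det / M.det) ^ 2 * c0 ^ n := by
  have hτ : DifferentiableAt ℝ τ x := (tau_c2 H ht).differentiableAt (by norm_num)
  set D : Matrix (Fin n) (Fin n) ℝ := LinearMap.toMatrix' (fderiv ℝ τ x : (Fin n → ℝ) →ₗ[ℝ] (Fin n → ℝ)) with hD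
  have hdet : (fderiv ℝ τ x).det = D.det := by
    rw [hD, LinearMap.det_toMatrix']
  have hDv : ∀ v, D.mulVec v = fderiv ℝ τ x v := by
    intro v
    rw [hD, LinearMap.toMatrix'_mulVec]; rfl
  set P : Matrix (Fin n) (Fin n) ℝ := Matrix.of fun j i => e i j with hP
  set J : Matrix (Fin n) (Fin n) ℝ := Matrix.of fun k i => dd (e i) (fun x => Fc M k (τ x)) x with hJ
  have hPcol : ∀ i, (fun j => P j i) = e i := fun i => rfl
  have e1 : Mᵀ * (D * P) = J := by
    ext k i
    rw [hJ, Matrix.of_apply, dd_FcTau hτ k, ← hDv]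
    rfl
  have e2 : Nᵀ * P = 1 := by
    ext k i
    rw [Matrix.one_apply]
    exact H'.hd i k
  have e3 : J * diagonal (epsl n ℓ) * Jᵀ = c0 • diagonal (epsl n ℓ) := by
    ext k l
    rw [Matrix.mul_apply]
    simp only [Matrix.mul_diagonal, Matrix.transpose_apply, Matrix.smul_apply, smul_eq_mul]
    have h2 := h1 k l
    rw [Matrix.diagonal_apply]
    unfold gg at h2
    rw [← h2]
    refine Finset.sum_congr rfl fun j _ => ?_
    simp only [hJ, Matrix.of_apply]; ring
  have f1 := congrArg Matrix.det e1
  have f2 := congrArg Matrix.det e2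
  have f3 := congrArg Matrix.det e3
  simp only [Matrix.det_mul, Matrix.det_transpose, Matrix.det_one, Matrix.det_smul, Fintype.card_fin] at f1 f2 f3
  have hε : (diagonal (epsl n ℓ)).det ≠ 0 := by
    rw [Matrix.det_diagonal]
    refine Finset.prod_ne_zero_iff.2 fun i _ h0 => ?_
    have := epsl_sq n ℓ i
    rw [h0] at this; norm_num at this
  have f4 : J.det ^ 2 = c0 ^ n := by
    refine mul_right_cancel₀ hε ?_
    rw [← f3]; ring
  rw [hdet, ← f4, ← f1]
  have hM := H.hdet
  have : D.det ^ 2 = (N.det * P.det) ^ 2 * D.det ^ 2 := by rw [f2]; ring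
  rw [this]
  field_simp

end taumap

section main
variable {n ℓ : ℕ} {A M : Matrix (Fin n) (Fin n) ℝ} {a : Fin n → ℝ} {d : Fin n → Fin n → ℝ} {α : Fin n → ℝ}
    {B N : Matrix (Fin n) (Fin n) ℝ} {b : Fin n → ℝ} {e : Fin n → Fin n → ℝ} {β : Fin n → ℝ}
    {E₁ E₂ : Set (Fin n → ℝ)} {p : ℝ} {w : (Fin n → ℝ) → ℝ} {τ : (Fin n → ℝ) → (Fin n → ℝ)}

/-- the standing situation -/
structure Sit (n ℓ : ℕ) (A M : Matrix (Fin n) (Fin n) ℝ) (a : Fin n → ℝ) (d : Fin n → Fin n → ℝ) (α : Fin n → ℝ)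
    (B N : Matrix (Fin n) (Fin n) ℝ) (b : Fin n → ℝ) (e : Fin n → Fin n → ℝ) (β : Fin n → ℝ)
    (E₁ E₂ : Set (Fin n → ℝ)) (p : ℝ) (w : (Fin n → ℝ) → ℝ) (τ : (Fin n → ℝ) → (Fin n → ℝ))
    (c : (Fin n → ℝ) → ℝ) : Prop where
  hn : 3 ≤ n
  hp : 0 < p
  H : DiagData n ℓ A M a d α
  H' : DiagData n ℓ B N b e β
  hE₁ : IsBoundedDomain E₁
  hE₂ : IsBoundedDomain E₂
  hwC : ContDiffOn ℝ 2 w E₂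
  hcl : ∀ x ∈ E₂, w x ≠ 0 → τ x ∈ closure E₁
  ht : ∀ x ∈ E₂, w x ≠ 0 → ∀ k, ContDiffAt ℝ 2 (fun x => Fc M k (τ x)) x
  hm : ∀ S, MeasurableSet S → volume (S ∩ E₁) =
    ∫⁻ x in {x ∈ E₂ | w x ≠ 0} ∩ τ ⁻¹' S, ENNReal.ofReal (|w x| ^ p)
  hc : ∀ x ∈ E₂, w x ≠ 0 → ContDiffAt ℝ 1 c x
  h1 : ∀ x ∈ E₂, w x ≠ 0 → ∀ k l, ∑ j, epsl n ℓ j *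
    (dd (e j) (fun x => Fc M k (τ x)) x * dd (e j) (fun x => Fc M l (τ x)) x) = c x * gg (epsl n ℓ) k l
  h2 : ∀ x ∈ E₂, w x ≠ 0 → ∀ k, w x * Lop (epsl n ℓ) β e (fun x => Fc M k (τ x)) x +
    2 * sg (epsl n ℓ) e w (fun x => Fc M k (τ x)) x = w x * (c x * α k)

lemma mkSit (hn : 3 ≤ n) (hp : 0 < p) (H : DiagData n ℓ A M a d α) (H' : DiagData n ℓ B N b e β)
    (hE₁ : IsBoundedDomain E₁) (hE₂ : IsBoundedDomain E₂)
    (hw : w ∈ SolSpace B b E₂ p) (hcl : ∀ x ∈ E₂, w x ≠ 0 → τ x ∈ closure E₁)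
    (hf : ∀ f, Nice A a f → ∃ g ∈ SolSpace B b E₂ p, ∀ x ∈ E₂, w x ≠ 0 → g x = w x * f (τ x))
    (ht : ∀ x ∈ E₂, w x ≠ 0 → ∀ k, ContDiffAt ℝ 2 (fun x => Fc M k (τ x)) x)
    (hm : ∀ S, MeasurableSet S → volume (S ∩ E₁) =
      ∫⁻ x in {x ∈ E₂ | w x ≠ 0} ∩ τ ⁻¹' S, ENNReal.ofReal (|w x| ^ p)) :
    ∃ c, Sit n ℓ A M a d α B N b e β E₁ E₂ p w τ c := by
  set k0 : Fin n := ⟨0, by omega⟩ with hk0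
  refine ⟨fun x => epsl n ℓ k0 * sg (epsl n ℓ) e (fun x => Fc M k0 (τ x)) (fun x => Fc M k0 (τ x)) x,
    hn, hp, H, H', hE₁, hE₂, hw.1, hcl, ht, hm, ?_, ?_, ?_⟩
  · intro x hx hwx
    have h := cda1_dd (E := Fin n → ℝ) (f := fun x => Fc M k0 (τ x)) (x := x)
    unfold sg
    exact contDiffAt_const.mul (ContDiffAt.sum fun j _ => contDiffAt_const.mul
      ((h (e j) (ht x hx hwx k0)).mul (h (e j) (ht x hx hwx k0))))
  · intro x hx hwx k l
    obtain ⟨s1, s2, -⟩ := struct_eqs H H' hE₂.1 hw hf ht hx hwx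
    rw [s2 k0 k]
    by_cases hkl : k = l
    · subst hkl
      rw [gg_self]
      have := epsl_sq n ℓ k
      change sg (epsl n ℓ) e (fun x => Fc M k (τ x)) (fun x => Fc M k (τ x)) x = _
      linear_combination (-sg (epsl n ℓ) e (fun x => Fc M k (τ x)) (fun x => Fc M k (τ x)) x) * this
    · rw [gg_ne hkl, mul_zero]
      exact s1 k l hkl
  · intro x hx hwx k
    obtain ⟨-, s2, s3⟩ := struct_eqs H H' hE₂.1 hw hf ht hx hwx
    rw [s3 k, s2 k0 k]; ring

variable {c : (Fin n → ℝ) → ℝ}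

lemma Sit.geo (Z : Sit n ℓ A M a d α B N b e β E₁ E₂ p w τ c) {V : Set (Fin n → ℝ)} (hV : IsOpen V)
    (hVE : V ⊆ E₂) (hw0 : ∀ x ∈ V, w x ≠ 0) (hc0 : ∀ x ∈ V, c x ≠ 0) :
    Geo (epsl n ℓ) α β e V w c (fun k x => Fc M k (τ x)) where
  hn := Z.hn
  hε := epsl_sq n ℓ
  hV := hV
  hw := fun x hx => Z.hwC.contDiffAt (Z.hE₂.1.mem_nhds (hVE hx))
  hw0 := hw0
  ht := fun x hx k => Z.ht x (hVE hx) (hw0 x hx) k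
  hc := fun x hx => Z.hc x (hVE hx) (hw0 x hx)
  hc0 := hc0
  h1 := fun x hx => Z.h1 x (hVE hx) (hw0 x hx)
  h2 := fun x hx => Z.h2 x (hVE hx) (hw0 x hx)
  hF := ⟨fun k => (((LinearMap.proj k).comp Nᵀ.mulVecLin).toContinuousLinearMap : (Fin n → ℝ) →L[ℝ] ℝ),
    fun v => Z.H'.hrec v⟩

lemma Sit.Uopen (Z : Sit n ℓ A M a d α B N b e β E₁ E₂ p w τ c) : IsOpen {x ∈ E₂ | w x ≠ 0} :=
  Z.hwC.continuousOn.isOpen_inter_preimage Z.hE₂.1 isOpen_ne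

lemma Sit.Vopen (Z : Sit n ℓ A M a d α B N b e β E₁ E₂ p w τ c) : IsOpen {x ∈ {x ∈ E₂ | w x ≠ 0} | c x ≠ 0} := by
  have : ContinuousOn c {x ∈ E₂ | w x ≠ 0} := fun x hx => (Z.hc x hx.1 hx.2).continuousAt.continuousWithinAt
  exact this.isOpen_inter_preimage Z.Uopen isOpen_ne

lemma Sit.tau (Z : Sit n ℓ A M a d α B N b e β E₁ E₂ p w τ c) :
    ∀ x ∈ {x ∈ E₂ | w x ≠ 0}, ContDiffAt ℝ 2 τ x := fun x hx => tau_c2 Z.H (Z.ht x hx.1 hx.2)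

lemma Sit.taud (Z : Sit n ℓ A M a d α B N b e β E₁ E₂ p w τ c) :
    ∀ x ∈ {x ∈ E₂ | w x ≠ 0}, HasFDerivAt τ (fderiv ℝ τ x) x := fun x hx =>
  ((Z.tau x hx).differentiableAt (by norm_num)).hasFDerivAt

lemma Sit.det (Z : Sit n ℓ A M a d α B N b e β E₁ E₂ p w τ c) :
    ∀ x ∈ {x ∈ E₂ | w x ≠ 0}, (fderiv ℝ τ x).det ^ 2 = (N.det / M.det) ^ 2 * c x ^ n := fun x hx =>
  det_sq Z.H Z.H' (Z.ht x hx.1 hx.2) (Z.h1 x hx.1 hx.2)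

lemma Sit.wmeas (Z : Sit n ℓ A M a d α B N b e β E₁ E₂ p w τ c) :
    AEMeasurable (fun x => ENNReal.ofReal (|w x| ^ p)) (volume.restrict E₂) := by
  have h : ContinuousOn (fun x => |w x| ^ p) E₂ :=
    ContinuousOn.rpow_const (Z.hwC.continuousOn.abs) (fun x _ => Or.inr Z.hp.le)
  exact (h.aemeasurable Z.hE₂.1.measurableSet).ennreal_ofReal

lemma Sit.Znull (Z : Sit n ℓ A M a d α B N b e β E₁ E₂ p w τ c) :
    volume {x ∈ {x ∈ E₂ | w x ≠ 0} | c x = 0} = 0 := by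
  set U := {x ∈ E₂ | w x ≠ 0} with hU
  set Y := {x ∈ U | c x = 0} with hY
  have hYm : MeasurableSet Y := by
    have : Y = U \ {x ∈ U | c x ≠ 0} := by
      ext x; simp only [hY, Set.mem_setOf_eq, Set.mem_diff, ne_eq, not_and, not_not]; tauto
    rw [this]; exact Z.Uopen.measurableSet.diff Z.Vopen.measurableSet
  have h1 : volume (τ '' Y) = 0 := by
    refine addHaar_image_eq_zero_of_det_fderivWithin_eq_zero volume (f' := fderiv ℝ τ)
      (fun x hx => (Z.taud x hx.1).hasFDerivWithinAt) fun x hx => ?_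
    have h := Z.det x hx.1
    rw [hx.2, zero_pow (by have := Z.hn; omega), mul_zero] at h
    exact pow_eq_zero_iff (two_ne_zero) |>.1 h
  have h2 := Z.hm (toMeasurable volume (τ '' Y)) (measurableSet_toMeasurable _ _)
  have h3 : volume (toMeasurable volume (τ '' Y) ∩ E₁) = 0 :=
    measure_mono_null Set.inter_subset_left (by rw [measure_toMeasurable, h1])
  rw [h3] at h2
  have h4 : ∫⁻ x in Y, ENNReal.ofReal (|w x| ^ p) = 0 := by
    refine le_antisymm ?_ (zero_le)
    rw [h2]
    refine lintegral_mono_set fun x hx => ⟨hx.1, ?_⟩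
    exact subset_toMeasurable _ _ ⟨x, hx, rfl⟩
  have hYE : Y ⊆ E₂ := fun x hx => hx.1.1
  rw [lintegral_eq_zero_iff' (Z.wmeas.mono_set hYE)] at h4
  have h5 : ∀ᵐ x ∂(volume.restrict Y), False := by
    filter_upwards [h4, ae_restrict_mem hYm] with x hx hxY
    have : 0 < |w x| ^ p := Real.rpow_pos_of_pos (abs_pos.2 hxY.1.2) _
    simp only [Pi.zero_apply, ENNReal.ofReal_eq_zero] at hx
    linarith
  rw [Filter.eventually_false_iff_eq_bot, ae_eq_bot, Measure.restrict_eq_zero] at h5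
  exact h5

lemma Sit.Vne (Z : Sit n ℓ A M a d α B N b e β E₁ E₂ p w τ c) :
    {x ∈ {x ∈ E₂ | w x ≠ 0} | c x ≠ 0}.Nonempty := by
  by_contra hne
  rw [Set.not_nonempty_iff_eq_empty] at hne
  have h1 := Z.Znull
  have h2 : {x ∈ {x ∈ E₂ | w x ≠ 0} | c x = 0} = {x ∈ E₂ | w x ≠ 0} := by
    ext x
    refine ⟨fun h => h.1, fun h => ⟨h, ?_⟩⟩
    by_contra hc
    have : x ∈ {x ∈ {x ∈ E₂ | w x ≠ 0} | c x ≠ 0} := ⟨h, hc⟩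
    rw [hne] at this; exact this
  rw [h2] at h1
  have h3 := Z.hm Set.univ MeasurableSet.univ
  rw [Set.univ_inter, Set.preimage_univ, Set.inter_univ, Measure.restrict_eq_zero.2 h1, lintegral_zero_measure] at h3
  exact (Z.hE₁.1.measure_pos volume Z.hE₁.2.1.nonempty).ne' h3

lemma Sit.all (Z : Sit n ℓ A M a d α B N b e β E₁ E₂ p w τ c) :
    ∀ x ∈ E₂, w x ≠ 0 ∧ c x ≠ 0 := by
  obtain ⟨x0, hx0⟩ := Z.Vne
  set V := {x ∈ {x ∈ E₂ | w x ≠ 0} | c x ≠ 0} with hV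
  set V₀ := connectedComponentIn V x0 with hV₀
  have hsub : V₀ ⊆ V := connectedComponentIn_subset V x0
  have hx0' : x0 ∈ V₀ := mem_connectedComponentIn hx0
  have hop : IsOpen V₀ := Z.Vopen.connectedComponentIn
  have hpre : IsPreconnected V₀ := isPreconnected_connectedComponentIn
  have G := Z.geo hop (fun x hx => (hsub hx).1.1) (fun x hx => (hsub hx).1.2) (fun x hx => (hsub hx).2)
  have hb : ∃ C, ∀ x ∈ V₀, ∀ k, |Fc M k (τ x)| ≤ C := by
    have hcp : IsCompact (closure E₁) := Z.hE₁.2.2.isCompact_closure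
    have : ∀ k, ∃ C, ∀ z ∈ closure E₁, |Fc M k z| ≤ C := fun k =>
      hcp.exists_bound_of_continuousOn (f := Fc M k) (Fc_contDiff (m := 1) M k).continuous.continuousOn
    choose C hC using this
    refine ⟨∑ k, |C k|, fun x hx k => ?_⟩
    refine (hC k _ (Z.hcl x (hsub hx).1.1 (hsub hx).1.2)).trans ((le_abs_self _).trans ?_)
    exact Finset.single_le_sum (f := fun k => |C k|) (fun i _ => abs_nonneg _) (Finset.mem_univ k)
  obtain ⟨δ, hδ, hlow⟩ := G.lower Z.H' hpre (Z.hE₂.2.2.subset fun x hx => (hsub hx).1.1) hb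
  have hcont : ∀ {f : (Fin n → ℝ) → ℝ} {y : Fin n → ℝ}, ContinuousAt f y → y ∈ closure V₀ →
      (∀ x ∈ V₀, δ ≤ |f x|) → f y ≠ 0 := by
    intro f y hf hy hl h0
    have h1 : ∀ᶠ z in nhds y, |f z| < δ := by
      have := hf.abs
      exact this.eventually (gt_mem_nhds (by simpa [h0] using hδ))
    obtain ⟨z, hz, hzV⟩ := mem_closure_iff_nhds.1 hy _ h1
    exact absurd (hl z hzV) (not_le.2 hz)
  have hclo : closure V₀ ∩ E₂ ⊆ V₀ := by
    rintro y ⟨hy, hyE⟩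
    have hw : w y ≠ 0 := hcont (Z.hwC.contDiffAt (Z.hE₂.1.mem_nhds hyE)).continuousAt hy fun x hx => (hlow x hx).1
    have hc : c y ≠ 0 := hcont (Z.hc y hyE hw).continuousAt hy fun x hx => (hlow x hx).2
    have hins : IsPreconnected (insert y V₀) :=
      hpre.subset_closure (Set.subset_insert _ _) (Set.insert_subset hy subset_closure)
    have hsub2 : insert y V₀ ⊆ {x ∈ {x ∈ E₂ | w x ≠ 0} | c x ≠ 0} := by
      rintro z (rfl | hz)
      · exact ⟨⟨hyE, hw⟩, hc⟩
      · exact hsub hz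
    exact hins.subset_connectedComponentIn (Set.mem_insert_of_mem _ hx0') hsub2 (Set.mem_insert _ _)
  have hfin : E₂ ⊆ V₀ := Z.hE₂.2.1.isPreconnected.subset_of_closure_inter_subset hop
    ⟨x0, hx0.1.1, hx0'⟩ hclo
  exact fun x hx => ⟨(hsub (hfin hx)).1.2, (hsub (hfin hx)).2⟩

lemma Sit.U_eq (Z : Sit n ℓ A M a d α B N b e β E₁ E₂ p w τ c) : {x ∈ E₂ | w x ≠ 0} = E₂ := by
  ext x; exact ⟨fun h => h.1, fun h => ⟨h, (Z.all x h).1⟩⟩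

lemma Sit.injOn (Z : Sit n ℓ A M a d α B N b e β E₁ E₂ p w τ c) : Set.InjOn τ E₂ := by
  intro x hx y hy hxy
  have G := Z.geo Z.hE₂.1 subset_rfl (fun x hx => (Z.all x hx).1) (fun x hx => (Z.all x hx).2)
  exact Fc_inj Z.H'.hdet (G.inj Z.H' Z.hE₂.2.1.isPreconnected hx hy fun k => by rw [hxy])

lemma Sit.fin (Z : Sit n ℓ A M a d α B N b e β E₁ E₂ p w τ c) :
    ((∀ k, α k = 0) → ∀ k, β k = 0) ∧ ((∀ k, β k = 0) → ∀ k, α k = 0) := by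
  have hU := Z.U_eq
  have hτ : ∀ x ∈ E₂, ContDiffAt ℝ 2 τ x := fun x hx => Z.tau x ⟨hx, (Z.all x hx).1⟩
  have hτd : ∀ x ∈ E₂, HasFDerivAt τ (fderiv ℝ τ x) x := fun x hx => Z.taud x ⟨hx, (Z.all x hx).1⟩
  have hdet : ∀ x ∈ E₂, (fderiv ℝ τ x).det ^ 2 = (N.det / M.det) ^ 2 * c x ^ n := fun x hx => Z.det x ⟨hx, (Z.all x hx).1⟩
  have hm := Z.hm
  rw [hU] at hm
  have hτc : ContinuousOn τ E₂ := fun x hx => (hτ x hx).continuousAt.continuousWithinAt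
  set W := E₂ ∩ τ ⁻¹' E₁ with hW
  have hWo : IsOpen W := hτc.isOpen_inter_preimage Z.hE₂.1 Z.hE₁.1
  have hWE : W ⊆ E₂ := Set.inter_subset_left
  have hWne : W.Nonempty := by
    by_contra hne
    rw [Set.not_nonempty_iff_eq_empty] at hne
    have h3 := hm E₁ Z.hE₁.1.measurableSet
    rw [← hW, hne, Set.inter_self, Measure.restrict_empty, lintegral_zero_measure] at h3
    exact (Z.hE₁.1.measure_pos volume Z.hE₁.2.1.nonempty).ne' h3
  have hwcont : ContinuousOn (fun x => |w x| ^ p) W :=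
    (ContinuousOn.rpow_const (Z.hwC.continuousOn.abs) (fun x _ => Or.inr Z.hp.le)).mono hWE
  have hDcont : ContinuousOn (fun x => |(fderiv ℝ τ x).det|) W := by
    intro x hx
    have h1 : ContinuousAt (fderiv ℝ τ) x := ((hτ x (hWE hx)).fderiv_right (m := 1) (by norm_num)).continuousAt
    have h2 : ContinuousAt (fun x => (fderiv ℝ τ x).det) x :=
      ContinuousLinearMap.continuous_det.continuousAt.comp h1
    exact h2.abs.continuousWithinAt
  have hae : (fun x => ENNReal.ofReal (|w x| ^ p)) =ᵐ[volume.restrict W]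
      fun x => ENNReal.ofReal |(fderiv ℝ τ x).det| := by
    refine ae_eq_of_forall_setLIntegral_eq_of_sigmaFinite₀
      (hwcont.aemeasurable hWo.measurableSet).ennreal_ofReal (hDcont.aemeasurable hWo.measurableSet).ennreal_ofReal ?_
    intro s hs _
    rw [Measure.restrict_restrict hs]
    have hsm : MeasurableSet (s ∩ W) := hs.inter hWo.measurableSet
    have hsE : s ∩ W ⊆ E₂ := fun x hx => hWE hx.2
    have hder : ∀ x ∈ s ∩ W, HasFDerivWithinAt τ (fderiv ℝ τ x) (s ∩ W) x := fun x hx =>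
      (hτd x (hsE hx)).hasFDerivWithinAt
    have hinj : Set.InjOn τ (s ∩ W) := Z.injOn.mono hsE
    rw [lintegral_abs_det_fderiv_eq_addHaar_image volume hsm hder hinj]
    have h1 := hm (τ '' (s ∩ W)) (measurable_image_of_fderivWithin hsm hder hinj)
    have h2 : τ '' (s ∩ W) ∩ E₁ = τ '' (s ∩ W) := by
      refine Set.inter_eq_left.2 ?_
      rintro _ ⟨x, hx, rfl⟩
      exact hx.2.2
    have h3 : E₂ ∩ τ ⁻¹' (τ '' (s ∩ W)) = s ∩ W := by
      ext x
      constructor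
      · rintro ⟨hx, y, hy, hyx⟩
        rwa [← Z.injOn (hsE hy) hx hyx]
      · intro hx
        exact ⟨hsE hx, x, hx, rfl⟩
    rw [h2, h3] at h1
    exact h1.symm
  have heq : ∀ x ∈ W, |w x| ^ p = |(fderiv ℝ τ x).det| := by
    refine Measure.eqOn_open_of_ae_eq (μ := volume) ?_ hWo hwcont hDcont
    filter_upwards [hae] with x hx
    exact (ENNReal.ofReal_eq_ofReal_iff (by positivity) (abs_nonneg _)).1 hx
  have hK : N.det / M.det ≠ 0 := div_ne_zero Z.H'.hdet Z.H.hdet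
  have hlog : ∀ x ∈ W, 2 * p * Real.log (w x) = Real.log ((N.det / M.det) ^ 2) + n * Real.log (c x) := by
    intro x hx
    have h1 : (|w x| ^ p) ^ 2 = (N.det / M.det) ^ 2 * c x ^ n := by
      rw [heq x hx, sq_abs, hdet x (hWE hx)]
    have h2 := congrArg Real.log h1
    have hc0 := (Z.all x (hWE hx)).2
    have hw0 := (Z.all x (hWE hx)).1
    rw [Real.log_mul (pow_ne_zero _ hK) (pow_ne_zero _ hc0), Real.log_pow, Real.log_pow (n := n),
      Real.log_rpow (abs_pos.2 hw0), Real.log_abs] at h2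
    rw [← h2]; push_cast; ring
  have G := Z.geo hWo hWE (fun x hx => (Z.all x (hWE hx)).1) (fun x hx => (Z.all x (hWE hx)).2)
  refine G.final hWne p ?_
  intro x hx i
  have d1 : DifferentiableAt ℝ (fun x => Real.log (w x)) x := (cda_da (G.hw x hx)).log (G.hw0 x hx)
  have d2 : DifferentiableAt ℝ (fun x => Real.log (c x)) x := (cda_da1 (G.hc x hx)).log (G.hc0 x hx)
  have h := dd_congr_on (e i) hWo hlog x hx
  have e1 : dd (e i) (fun x => Real.log (w x)) x = dd (e i) w x / w x := by
    have hw0 := G.hw0 x hx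
    rw [dd_comp _ (Real.hasDerivAt_log hw0) (cda_da (G.hw x hx))]; field_simp
  rw [dd_const_mul _ _ d1, dd_add _ (differentiableAt_const _) (d2.const_mul _), dd_const, dd_const_mul _ _ d2,
    G.dd_log _ x hx, e1] at h
  have hp := Z.hp.ne'
  have h' : 2 * (dd (e i) w x / w x) * p = n * (dd (e i) c x / c x) := by linarith
  rw [mul_div_assoc, eq_comm, div_mul_eq_mul_div, div_eq_iff hp, h']

end main

/-- If the signatures are equal but exactly one of the vectors `a`, `b`
is zero, then `L^p_{D_A}(E₁)` is not linearly isometric to any subspace of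
`L^p_{D_B}(E₂)`. -/
theorem statement1 {n : ℕ} (hn : 3 ≤ n) (p : ℝ) (hp : 0 < p)
    (hpNotEven : ∀ k : ℕ, p ≠ 2 * k)
    (E₁ E₂ : Set (Fin n → ℝ)) (hE₁ : IsBoundedDomain E₁) (hE₂ : IsBoundedDomain E₂)
    (hE₁reg : interior (closure E₁) = E₁)
    (A B : Matrix (Fin n) (Fin n) ℝ) (hA : A.IsSymm) (hB : B.IsSymm)
    (hdetA : A.det ≠ 0) (hdetB : B.det ≠ 0)
    (ℓ : ℕ) (hℓn : ℓ ≤ n)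
    (M N : Matrix (Fin n) (Fin n) ℝ)
    (hM : Mᵀ * A * M = Imat n ℓ) (hN : Nᵀ * B * N = Imat n ℓ)
    (a b : Fin n → ℝ)
    (hab : (a = 0 ∧ b ≠ 0) ∨ (a ≠ 0 ∧ b = 0)) :
    ¬ IsometricallyEmbeds p E₁ E₂ (SolSpace A a E₁ p) (SolSpace B b E₂ p) := by
  rintro ⟨T, hT1, hT2, hT3, hT4⟩
  obtain ⟨d, hA', ha', hd', hdet, hrec⟩ := diag_decomp hM a
  obtain ⟨e, hB', hb', he', hdet', hrec'⟩ := diag_decomp hN b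
  have H : DiagData n ℓ A M a d (Mᵀ.mulVec a) := ⟨hA', ha', hd', hdet, hrec⟩
  have H' : DiagData n ℓ B N b e (Nᵀ.mulVec b) := ⟨hB', hb', he', hdet', hrec'⟩
  obtain ⟨w, τ, hw, hcl, hf, ht, hm⟩ := T_structure H hp hpNotEven hE₁ hE₂ ⟨hT1, hT2, hT3, hT4⟩
  obtain ⟨c, Z⟩ := mkSit hn hp H H' hE₁ hE₂ hw hcl hf ht hm
  rcases hab with ⟨h0, h1⟩ | ⟨h1, h0⟩
  · have hk := Z.fin.1 fun k => by simp [h0]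
    apply h1
    funext i
    rw [H'.ha i]
    exact Finset.sum_eq_zero fun k _ => by rw [hk k, zero_mul]
  · have hk := Z.fin.2 fun k => by simp [h0]
    apply h1
    funext i
    rw [H.ha i]
    exact Finset.sum_eq_zero fun k _ => by rw [hk k, zero_mul]
end
end

section
/- Let E be a bounded open set in ℝⁿ and let H be a family of continuous real-valued functions on E containing the constant function 1 and separating the points of E (for every x, y ∈ E with x ≠ y there exists f ∈ H with f(x) ≠ f(y)). Then the minimal σ-algebra of subsets of E making all functions from H measurable is the σ-algebra of all Borel subsets of E. -/
open MeasureTheory Matrix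

noncomputable section

/-- Lemma 1: if a family `H` of continuous functions on a bounded open set
`E ⊂ ℝⁿ` contains the constant function `1` and separates the points of `E`, then the
minimal σ-algebra making the functions of `H` measurable is the Borel σ-algebra of `E`. -/
theorem statement8 {n : ℕ} (E : Set (Fin n → ℝ)) (hE : IsOpen E)
    (hEb : Bornology.IsBounded E)
    (H : Set ((Fin n → ℝ) → ℝ))
    (hcont : ∀ f ∈ H, ContinuousOn f E)
    (h1 : (fun _ => (1 : ℝ)) ∈ H)
    (hsep : ∀ x ∈ E, ∀ y ∈ E, x ≠ y → ∃ f ∈ H, f x ≠ f y) :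
    (⨆ f ∈ H, MeasurableSpace.comap (fun x : E => f x) (borel ℝ)) = borel E := by
  have hc : ∀ f : H, Continuous (fun x : E => f.1 x) := fun f =>
    continuousOn_iff_continuous_domRestrict.mp (hcont f.1 f.2)
  apply le_antisymm
  · refine iSup₂_le fun f hf => ?_
    have := (hc ⟨f, hf⟩).borel_measurable
    exact this.comap_le
  · obtain ⟨T, hTc, hT⟩ := TopologicalSpace.isOpen_iUnion_countable
      (fun f : H => {p : E × E | f.1 p.1 ≠ f.1 p.2})
      (fun f => isOpen_ne_fun ((hc f).comp continuous_fst) ((hc f).comp continuous_snd))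
    have : Countable T := hTc.to_subtype
    let F : E → (T → ℝ) := fun x t => t.1.1 x
    have hF : Continuous F := continuous_pi fun t => hc t.1
    have hinj : Function.Injective F := by
      intro x y hxy
      by_contra hne
      obtain ⟨f, hf, hfxy⟩ := hsep x x.2 y y.2 (fun h => hne (Subtype.ext h))
      have hmem : (x, y) ∈ ⋃ f : H, {p : E × E | f.1 p.1 ≠ f.1 p.2} :=
        Set.mem_iUnion.mpr ⟨⟨f, hf⟩, hfxy⟩
      rw [← hT] at hmem
      obtain ⟨g, hg, hgxy⟩ := Set.mem_iUnion₂.mp hmem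
      exact hgxy (congrFun hxy ⟨g, hg⟩)
    have : PolishSpace E := hE.polishSpace
    have hemb : MeasurableEmbedding F := hF.measurableEmbedding hinj
    have hb : borel E = (inferInstance : MeasurableSpace E) := BorelSpace.measurable_eq.symm
    rw [hb]
    intro s hs
    have hs' := hemb.measurableSet_image' hs
    rw [← hinj.preimage_image s]
    have hm : @Measurable E (T → ℝ)
        (⨆ f ∈ H, MeasurableSpace.comap (fun x : E => f x) (borel ℝ)) _ F := by
      refine @measurable_pi_lambda E T (fun _ => ℝ) (⨆ f ∈ H, MeasurableSpace.comap (fun x : E => f x) (borel ℝ)) _ F fun t => ?_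
      rw [measurable_iff_comap_le, BorelSpace.measurable_eq (α := ℝ)]
      exact le_iSup₂_of_le t.1.1 t.1.2 le_rfl
    exact hm hs'
end
end
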